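/- arXiv:math/0403422 — 5 statements merged into one kernel-verified Lean document; each statement's English description precedes it below -/
import Mathlib

section
/- For every ε > 0 there exist a constant C > 0 and a threshold p_0 such that for every prime p ≥ p_0 there exists a positive integer n ≤ C · p^{1/2+ε} for which n! mod p is a primitive root modulo p. -/
section

open Polynomial

/-- The Wronskian matrix of a family of polynomials. -/
noncomputable def wronskianMatrix {R : Type*} [CommRing R] {n : ℕ} (f : Fin n → R[X]) :
    Matrix (Fin n) (Fin n) R[X] :=
  Matrix.of fun i j => derivative^[(i : ℕ)] (f j)

/-- If the Wronskian of a family vanishes while the Wronskian of all but the last member does not,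
then the maximal Wronskian minors have constant ratios. -/
theorem derivative_wronskian_minor_mul {R : Type*} [CommRing R] [IsDomain R] {n : ℕ}
    (f : Fin (n + 1) → R[X]) (hdet : (wronskianMatrix f).det = 0)
    (hne : (wronskianMatrix (f ∘ (Fin.last n).succAbove)).det ≠ 0) (i : Fin (n + 1)) :
    derivative (wronskianMatrix (f ∘ i.succAbove)).det *
        (wronskianMatrix (f ∘ (Fin.last n).succAbove)).det =
      (wronskianMatrix (f ∘ i.succAbove)).det *
        derivative (wronskianMatrix (f ∘ (Fin.last n).succAbove)).det := by
  set W : Fin (n + 1) → R[X] := fun i => (wronskianMatrix (f ∘ i.succAbove)).det with hW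
  set v : Fin (n + 1) → R[X] := fun j => (-1) ^ (n + (j : ℕ)) * W j with hv
  have key : ∀ l : Fin (n + 1), ∑ j, v j * derivative^[(l : ℕ)] (f j) = 0 := by
    intro l
    have h0 : ((wronskianMatrix f).updateRow (Fin.last n) (wronskianMatrix f l)).det = 0 := by
      by_cases hl : l = Fin.last n
      · rw [hl, Matrix.updateRow_eq_self, hdet]
      · exact Matrix.det_updateRow_eq_zero hl
    rw [Matrix.det_succ_row _ (Fin.last n)] at h0
    rw [← h0]
    refine Finset.sum_congr rfl fun j _ => ?_
    have h1 : ((wronskianMatrix f).updateRow (Fin.last n) (wronskianMatrix f l)).submatrix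
        (Fin.last n).succAbove j.succAbove = wronskianMatrix (f ∘ j.succAbove) := by
      ext a b : 2
      simp [wronskianMatrix, Matrix.updateRow_apply, Fin.succAbove_last, Fin.castSucc_ne_last]
    rw [h1]
    simp only [hv, hW, Matrix.updateRow_self, Fin.val_last]
    simp only [wronskianMatrix, Matrix.of_apply]
    ring
  have key' : ∀ l : Fin n, ∑ j, derivative (v j) * derivative^[(l : ℕ)] (f j) = 0 := by
    intro l
    have h1 := congrArg derivative (key l.castSucc)
    have h2 := key l.succ
    simp only [derivative_sum, derivative_mul, Finset.sum_add_distrib, Fin.val_castSucc,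
      derivative_zero, ← Function.iterate_succ_apply' derivative] at h1
    simp only [Fin.val_succ] at h2
    rwa [h2, add_zero] at h1
  set z : Fin (n + 1) → R[X] :=
    fun j => derivative (v j) * v (Fin.last n) - v j * derivative (v (Fin.last n)) with hz
  have hzl : z (Fin.last n) = 0 := by simp only [hz]; ring
  have hzs : ∀ l : Fin n, ∑ j, z j * derivative^[(l : ℕ)] (f j) = 0 := by
    intro l
    have h1 := key' l
    have h2 := key l.castSucc
    simp only [Fin.val_castSucc] at h2
    calc ∑ j, z j * derivative^[(l : ℕ)] (f j)
        = (∑ j, derivative (v j) * derivative^[(l : ℕ)] (f j)) * v (Fin.last n)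
          - (∑ j, v j * derivative^[(l : ℕ)] (f j)) * derivative (v (Fin.last n)) := by
          rw [Finset.sum_mul, Finset.sum_mul, ← Finset.sum_sub_distrib]
          exact Finset.sum_congr rfl fun j _ => by simp only [hz]; ring
      _ = 0 := by rw [h1, h2]; ring
  have hz0 : (fun j : Fin n => z j.castSucc) = 0 := by
    apply Matrix.eq_zero_of_mulVec_eq_zero hne
    ext1 l
    have := hzs l
    rw [Fin.sum_univ_castSucc, hzl, zero_mul, add_zero] at this
    rw [Pi.zero_apply, ← this, Matrix.mulVec, dotProduct]
    refine Finset.sum_congr rfl fun j _ => ?_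
    simp [wronskianMatrix, Fin.succAbove_last, mul_comm]
  have hzi : z i = 0 := by
    refine Fin.lastCases hzl (fun j => ?_) i
    exact congrFun hz0 j
  have hd : ∀ j, derivative (v j) = (-1) ^ (n + (j : ℕ)) * derivative (W j) := by
    intro j
    rcases neg_one_pow_eq_or R[X] (n + (j : ℕ)) with h | h <;> simp [hv, h]
  have hunit : ((-1 : R[X]) ^ (n + (i : ℕ)) * (-1) ^ (n + n)) ≠ 0 := by
    simp
  have hprod : ((-1 : R[X]) ^ (n + (i : ℕ)) * (-1) ^ (n + n)) *
      (derivative (W i) * W (Fin.last n) - W i * derivative (W (Fin.last n))) = 0 := by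
    rw [← hzi]
    simp only [hz, hd]
    simp only [hv, Fin.val_last]
    ring
  exact sub_eq_zero.mp ((mul_eq_zero.mp hprod).resolve_left hunit)

theorem rootMultiplicity_modEq_of_derivative_mul_eq {p : ℕ} [Fact p.Prime] {P Q : (ZMod p)[X]}
    (hP : P ≠ 0) (hQ : Q ≠ 0) (h : derivative P * Q = P * derivative Q) (a : ZMod p) :
    P.rootMultiplicity a ≡ Q.rootMultiplicity a [MOD p] := by
  obtain ⟨P₁, hP₁, hPa⟩ := exists_eq_pow_rootMultiplicity_mul_and_not_dvd P hP a
  obtain ⟨Q₁, hQ₁, hQa⟩ := exists_eq_pow_rootMultiplicity_mul_and_not_dvd Q hQ a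
  set m := P.rootMultiplicity a
  set k := Q.rootMultiplicity a
  rw [dvd_iff_isRoot, IsRoot.def] at hPa hQa
  have hder : ∀ (n : ℕ) (S : (ZMod p)[X]), (X - C a) * derivative ((X - C a) ^ n * S) =
      (X - C a) ^ n * ((n : (ZMod p)[X]) * S + (X - C a) * derivative S) := by
    intro n S
    cases n with
    | zero => simp
    | succ n =>
      rw [derivative_mul, derivative_X_sub_C_pow]
      simp only [Nat.add_sub_cancel]
      push_cast
      simp
      ring
  have h1 : (X - C a) ^ (m + k) * (((m : (ZMod p)[X]) * P₁ + (X - C a) * derivative P₁) * Q₁ -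
      P₁ * ((k : (ZMod p)[X]) * Q₁ + (X - C a) * derivative Q₁)) = 0 := by
    have e1 := hder m P₁
    have e2 := hder k Q₁
    rw [← hP₁] at e1
    rw [← hQ₁] at e2
    have : (X - C a) * derivative P * Q = P * ((X - C a) * derivative Q) := by
      linear_combination (X - C a) * h
    rw [e1, e2] at this
    nth_rewrite 1 [hQ₁] at this
    nth_rewrite 1 [hP₁] at this
    rw [pow_add]
    linear_combination this
  have h2 := (mul_eq_zero.mp h1).resolve_left (pow_ne_zero _ (X_sub_C_ne_zero a))
  have h3 := congrArg (eval a) h2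
  simp only [eval_sub, eval_mul, eval_add, eval_natCast, eval_X, eval_C, sub_self, zero_mul,
    add_zero, eval_zero] at h3
  have h4 : ((m : ZMod p) - k) * (eval a P₁ * eval a Q₁) = 0 := by linear_combination h3
  rcases mul_eq_zero.mp h4 with h5 | h5
  · exact (ZMod.natCast_eq_natCast_iff _ _ _).mp (sub_eq_zero.mp h5)
  · exact absurd h5 (mul_ne_zero hPa hQa)

/-- The operator `c ↦ g ^ l * (u * c)^(l) / u` for a function `u` with `g * u' = u * w`. -/
noncomputable def twistedDerivative {R : Type*} [CommRing R] (g w : R[X]) : ℕ → R[X] →ₗ[R] R[X]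
  | 0 => LinearMap.id
  | l + 1 => LinearMap.mulLeft R g ∘ₗ derivative ∘ₗ twistedDerivative g w l +
      LinearMap.mulLeft R (w - (l : R[X]) * derivative g) ∘ₗ twistedDerivative g w l

theorem twistedDerivative_succ_apply {R : Type*} [CommRing R] (g w : R[X]) (l : ℕ) (c : R[X]) :
    twistedDerivative g w (l + 1) c = g * derivative (twistedDerivative g w l c) +
      (w - (l : R[X]) * derivative g) * twistedDerivative g w l c := rfl

theorem pow_mul_iterate_derivative_mul {R : Type*} [CommRing R] {g u w : R[X]}
    (h : g * derivative u = u * w) (l : ℕ) (c : R[X]) :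
    g ^ l * derivative^[l] (u * c) = u * twistedDerivative g w l c := by
  induction l with
  | zero => simp [twistedDerivative]
  | succ l ih =>
    have h1 := congrArg derivative ih
    rw [derivative_mul, derivative_mul, derivative_pow] at h1
    rw [Function.iterate_succ_apply', twistedDerivative_succ_apply]
    rcases l with _ | l
    · simp only [twistedDerivative, LinearMap.id_apply, zero_add, pow_one, Function.iterate_zero,
        id_eq, Nat.cast_zero, zero_mul, sub_zero, derivative_mul]
      linear_combination c * h
    · simp only [Nat.add_sub_cancel] at h1
      push_cast at h1 ih ⊢
      simp only [map_add, map_natCast, map_one] at h1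
      linear_combination g * h1 + twistedDerivative g w (l + 1) c * h -
        (l + 1) * derivative g * ih

theorem natDegree_twistedDerivative_le {R : Type*} [CommRing R] {g w : R[X]} {K : ℕ}
    (hg : g.natDegree ≤ K) (hw : w.natDegree ≤ K) {c : R[X]} {A : ℕ} (hc : c.natDegree ≤ A)
    (l : ℕ) : (twistedDerivative g w l c).natDegree ≤ A + l * K := by
  induction l with
  | zero => simpa [twistedDerivative] using hc
  | succ l ih =>
    rw [twistedDerivative_succ_apply]
    have e : A + (l + 1) * K = K + (A + l * K) := by ring
    rw [e]
    refine natDegree_add_le_of_degree_le (natDegree_mul_le_of_le hg ?_)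
      (natDegree_mul_le_of_le ?_ ih)
    · exact (natDegree_derivative_le _).trans ((Nat.sub_le _ _).trans ih)
    · refine (natDegree_sub_le_of_le hw ?_).trans (max_self K).le
      refine (natDegree_mul_le_of_le (natDegree_natCast _).le
        ((natDegree_derivative_le _).trans (Nat.sub_le _ _))).trans ?_
      simpa using hg

theorem prod_pow_mul_det_wronskianMatrix {R : Type*} [CommRing R] {n : ℕ} {g : R[X]}
    {u w c : Fin n → R[X]} (h : ∀ j, g * derivative (u j) = u j * w j) :
    (∏ i : Fin n, g ^ (i : ℕ)) * (wronskianMatrix fun j => u j * c j).det =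
      (∏ j, u j) * (Matrix.of fun i j : Fin n => twistedDerivative g (w j) i (c j)).det := by
  rw [← Matrix.det_mul_column, ← Matrix.det_mul_row]
  congr 1
  ext i j : 2
  simp [wronskianMatrix, pow_mul_iterate_derivative_mul (h j)]

theorem natDegree_det_twistedDerivative_le {R : Type*} [CommRing R] {n : ℕ} {g : R[X]}
    {w c : Fin n → R[X]} {K A : ℕ} (hg : g.natDegree ≤ K) (hw : ∀ j, (w j).natDegree ≤ K)
    (hc : ∀ j, (c j).natDegree ≤ A) :
    (Matrix.of fun i j : Fin n => twistedDerivative g (w j) i (c j)).det.natDegree ≤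
      n * (A + n * K) := by
  rw [Matrix.det_apply]
  refine natDegree_sum_le_of_forall_le _ _ fun σ _ => ?_
  refine (natDegree_smul_le _ _).trans ?_
  refine (natDegree_prod_le _ _).trans ?_
  refine (Finset.sum_le_card_nsmul _ _ (A + n * K) fun i _ => ?_).trans (by simp)
  simp only [Matrix.of_apply]
  refine (natDegree_twistedDerivative_le hg (hw i) (hc i) _).trans ?_
  have : ((σ i : Fin n) : ℕ) ≤ n := (σ i).2.le
  gcongr

/-- The product of the powers `(X + j) ^ e j` for `1 ≤ j ≤ K`. -/
noncomputable def shiftedPowers (p K : ℕ) (e : ℕ → ℕ) : (ZMod p)[X] :=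
  ∏ j ∈ Finset.Icc 1 K, (X + C (j : ZMod p)) ^ e j

section

variable {p : ℕ} [Fact p.Prime] {K : ℕ}

theorem shiftedPowers_ne_zero (e : ℕ → ℕ) : shiftedPowers p K e ≠ 0 :=
  Finset.prod_ne_zero_iff.mpr fun _ _ => pow_ne_zero _ (X_add_C_ne_zero _)

theorem eval_shiftedPowers (e : ℕ → ℕ) (x : ZMod p) :
    (shiftedPowers p K e).eval x = ∏ j ∈ Finset.Icc 1 K, (x + j) ^ e j := by
  simp [shiftedPowers, eval_prod]

theorem natDegree_shiftedPowers (e : ℕ → ℕ) :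
    (shiftedPowers p K e).natDegree = ∑ j ∈ Finset.Icc 1 K, e j := by
  rw [shiftedPowers, natDegree_prod_of_monic _ _ fun i _ => (monic_X_add_C _).pow _]
  simp only [natDegree_pow, natDegree_X_add_C, mul_one]

theorem exists_mul_derivative_shiftedPowers (e : ℕ → ℕ) :
    ∃ w : (ZMod p)[X], w.natDegree ≤ K ∧
      shiftedPowers p K 1 * derivative (shiftedPowers p K e) = shiftedPowers p K e * w := by
  suffices h : ∀ S : Finset ℕ, ∃ w : (ZMod p)[X], w.natDegree ≤ S.card ∧
      (∏ j ∈ S, (X + C (j : ZMod p))) * derivative (∏ j ∈ S, (X + C (j : ZMod p)) ^ e j) =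
        (∏ j ∈ S, (X + C (j : ZMod p)) ^ e j) * w by
    simpa [shiftedPowers] using h (Finset.Icc 1 K)
  intro S
  induction S using Finset.induction_on with
  | empty => exact ⟨0, by simp⟩
  | insert a S ha ih =>
    obtain ⟨w, hw, h⟩ := ih
    refine ⟨(X + C (a : ZMod p)) * w + (e a : (ZMod p)[X]) * ∏ j ∈ S, (X + C (j : ZMod p)),
      ?_, ?_⟩
    · rw [Finset.card_insert_of_notMem ha, add_comm S.card]
      refine natDegree_add_le_of_degree_le
        (natDegree_mul_le_of_le (natDegree_X_add_C _).le hw) ?_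
      refine (natDegree_mul_le_of_le (natDegree_natCast _).le
        (natDegree_prod_of_monic _ _ fun i _ => monic_X_add_C _).le).trans ?_
      simp only [natDegree_X_add_C]
      simp
    · have hp : (X + C (a : ZMod p)) * derivative ((X + C (a : ZMod p)) ^ e a) =
          (X + C (a : ZMod p)) ^ e a * (e a : (ZMod p)[X]) := by
        rcases e a with _ | n
        · simp
        · simp only [derivative_X_add_C_pow, Nat.add_sub_cancel]
          simp
          ring
      rw [Finset.prod_insert ha, Finset.prod_insert ha, derivative_mul]
      linear_combination (X + C (a : ZMod p)) ^ e a * (X + C (a : ZMod p)) * h +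
        (∏ j ∈ S, (X + C (j : ZMod p))) * (∏ j ∈ S, (X + C (j : ZMod p)) ^ e j) * hp

theorem natCast_injOn_Icc (hK : K < p) : Set.InjOn (Nat.cast : ℕ → ZMod p) (Finset.Icc 1 K) := by
  intro i hi j hj h
  simp only [Finset.coe_Icc, Set.mem_Icc] at hi hj
  rw [ZMod.natCast_eq_natCast_iff] at h
  exact h.eq_of_lt_of_lt (by lia) (by lia)

theorem rootMultiplicity_shiftedPowers (hK : K < p) (e : ℕ → ℕ) {j : ℕ}
    (hj : j ∈ Finset.Icc 1 K) :
    (shiftedPowers p K e).rootMultiplicity (-(j : ZMod p)) = e j := by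
  have h0 := shiftedPowers_ne_zero (p := p) (K := K) e
  rw [shiftedPowers, ← Finset.mul_prod_erase _ _ hj] at h0 ⊢
  rw [rootMultiplicity_mul h0]
  have h1 : rootMultiplicity (-(j : ZMod p)) ((X + C (j : ZMod p)) ^ e j) = e j := by
    have := rootMultiplicity_X_sub_C_pow (-(j : ZMod p)) (e j)
    simpa using this
  rw [h1, rootMultiplicity_eq_zero, add_zero]
  rw [IsRoot.def, eval_prod, Finset.prod_eq_zero_iff]
  rintro ⟨i, hi, h⟩
  rw [eval_pow, eval_add, eval_X, eval_C] at h
  have h2 : (i : ZMod p) = j := by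
    have := eq_zero_of_pow_eq_zero h
    linear_combination this
  rw [Finset.mem_erase] at hi
  exact hi.1 (natCast_injOn_Icc hK hi.2 hj h2)

theorem not_X_dvd_shiftedPowers (hK : K < p) (e : ℕ → ℕ) :
    ¬ (X : (ZMod p)[X]) ∣ shiftedPowers p K e := by
  rw [X_dvd_iff, coeff_zero_eq_eval_zero, eval_shiftedPowers, Finset.prod_eq_zero_iff]
  rintro ⟨j, hj, h⟩
  rw [Finset.mem_Icc] at hj
  rw [zero_add] at h
  have h1 := (ZMod.natCast_eq_zero_iff _ _).mp (eq_zero_of_pow_eq_zero h)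
  exact absurd (Nat.le_of_dvd (by lia) h1) (by lia)

/-- If `X ^ m` divides a sum of `n` polynomials then `X ^ (m - n)` divides their Wronskian. -/
theorem X_pow_dvd_det_wronskianMatrix {R : Type*} [CommRing R] {n m : ℕ} (hn : 0 < n)
    (f : Fin n → R[X]) (h : X ^ m ∣ ∑ j, f j) : X ^ (m - n) ∣ (wronskianMatrix f).det := by
  have h1 : ∀ i : Fin n, X ^ (m - n) ∣ ∑ j, wronskianMatrix f i j := by
    intro i
    have : ∑ j, wronskianMatrix f i j = derivative^[(i : ℕ)] (∑ j, f j) := by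
      simp [wronskianMatrix, iterate_derivative_sum]
    rw [this]
    exact (pow_dvd_pow _ (by have := i.2; lia)).trans
      (pow_sub_dvd_iterate_derivative_of_pow_dvd _ h)
  have h2 := congrArg (fun M => ∑ j, M ⟨0, hn⟩ j) (Matrix.adjugate_mul (wronskianMatrix f))
  simp only [Matrix.mul_apply, Matrix.smul_apply, Matrix.one_apply, smul_eq_mul, mul_ite, mul_one,
    mul_zero, Finset.sum_ite_eq, Finset.mem_univ, if_true] at h2
  rw [← h2, Finset.sum_comm]
  simp_rw [← Finset.mul_sum]
  exact Finset.dvd_sum fun i _ => (h1 i).mul_left _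

/-- Products of powers of linear factors whose exponents are well separated modulo `p` are linearly
independent over polynomials of small degree, even modulo `X ^ p`. -/
theorem not_X_pow_dvd_sum_shiftedPowers {ι : Type*} [Fintype ι] {A R : ℕ}
    (hK : K < p) {e : ι → ℕ → ℕ}
    (hsep : ∀ b b', b ≠ b' → ∃ j ∈ Finset.Icc 1 K, ∀ m₁ m₂, m₁ < R → m₂ < R →
      ¬ (e b j + m₁ ≡ e b' j + m₂ [MOD p]))
    (hR : Fintype.card ι * (A + Fintype.card ι * K) + Fintype.card ι ≤ R) (hRp : R < p)
    {c : ι → (ZMod p)[X]} (hc : ∀ b, (c b).natDegree ≤ A) (hc0 : c ≠ 0) :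
    ¬ X ^ p ∣ ∑ b, shiftedPowers p K (e b) * c b := by
  classical
  intro hdvd
  choose w hw hgw using fun b => exists_mul_derivative_shiftedPowers (p := p) (K := K) (e b)
  set u : ι → (ZMod p)[X] := fun b => shiftedPowers p K (e b) with hu
  set g : (ZMod p)[X] := shiftedPowers p K 1 with hg
  have hgK : g.natDegree ≤ K := by simp [hg, natDegree_shiftedPowers]
  have hg0 : g ≠ 0 := shiftedPowers_ne_zero 1
  have hu0 : ∀ b, u b ≠ 0 := fun b => shiftedPowers_ne_zero _
  have hpow0 : ∀ n : ℕ, (∏ i : Fin n, g ^ (i : ℕ)) ≠ 0 := fun n =>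
    Finset.prod_ne_zero_iff.mpr fun _ _ => pow_ne_zero _ hg0
  let P : ℕ → Prop := fun n => ∃ f : Fin n → ι, Function.Injective f ∧ (∀ i, c (f i) ≠ 0) ∧
    (wronskianMatrix fun i => u (f i) * c (f i)).det = 0
  have hcard : ∀ {n : ℕ} {f : Fin n → ι}, Function.Injective f → n ≤ Fintype.card ι := by
    intro n f hf
    simpa using Fintype.card_le_of_injective f hf
  have hdeg : ∀ {n : ℕ} (f : Fin n → ι), Function.Injective f →
      (Matrix.of fun i j : Fin n => twistedDerivative g (w (f j)) i (c (f j))).det.natDegree ≤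
        Fintype.card ι * (A + Fintype.card ι * K) := by
    intro n f hf
    have := hcard hf
    refine (natDegree_det_twistedDerivative_le hgK (fun j => hw (f j)) fun j => hc _).trans ?_
    gcongr
  have hP : ∃ n, P n := by
    let S : Finset ι := Finset.univ.filter fun b => c b ≠ 0
    have hSpos : 0 < S.card := by
      rw [Finset.card_pos]
      obtain ⟨b, hb⟩ := Function.ne_iff.mp hc0
      exact ⟨b, by simpa [S] using hb⟩
    let f : Fin S.card → ι := fun i => S.equivFin.symm i
    have hf : Function.Injective f := Subtype.val_injective.comp S.equivFin.symm.injective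
    refine ⟨S.card, f, hf, fun i => (Finset.mem_filter.mp (S.equivFin.symm i).2).2, ?_⟩
    have hsum : ∑ i, u (f i) * c (f i) = ∑ b, u b * c b := by
      rw [Equiv.sum_comp S.equivFin.symm fun b : S => u b * c b,
        Finset.sum_coe_sort S fun b => u b * c b, Finset.sum_filter]
      refine Finset.sum_congr rfl fun b _ => ?_
      by_cases hb : c b = 0 <;> simp [hb]
    have h1 := X_pow_dvd_det_wronskianMatrix (m := p) hSpos (fun i => u (f i) * c (f i))
      (by rw [hsum]; exact hdvd)
    have h2 := prod_pow_mul_det_wronskianMatrix (c := fun i => c (f i)) fun i => hgw (f i)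
    have h3 := h1.mul_left (∏ i : Fin S.card, g ^ (i : ℕ))
    rw [h2] at h3
    have h4 := prime_X.pow_dvd_of_dvd_mul_left _ (by
      rw [prime_X.dvd_finsetProd_iff]
      rintro ⟨i, _, h⟩
      exact not_X_dvd_shiftedPowers hK _ h) h3
    have h5 := eq_zero_of_dvd_of_natDegree_lt h4 (by
      rw [natDegree_X_pow]
      have := hdeg f hf
      have := hcard hf
      lia)
    rw [h5, mul_zero] at h2
    exact (mul_eq_zero.mp h2).resolve_left (hpow0 _)
  obtain ⟨f, hf, hfc, hdet⟩ := Nat.find_spec hP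
  have hmin := fun n => Nat.find_min hP (m := n)
  generalize Nat.find hP = n at f hf hfc hdet hmin
  rcases n with _ | n
  · simp at hdet
  have hW : ∀ i : Fin (n + 1),
      (wronskianMatrix ((fun i => u (f i) * c (f i)) ∘ i.succAbove)).det ≠ 0 := fun i h =>
    hmin n n.lt_succ_self ⟨f ∘ i.succAbove, hf.comp Fin.succAbove_right_injective,
      fun _ => hfc _, h⟩
  rcases n with _ | n
  · rw [Matrix.det_fin_one] at hdet
    simp only [wronskianMatrix, Matrix.of_apply, Fin.val_zero, Function.iterate_zero, id_eq] at hdet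
    exact mul_ne_zero (hu0 _) (hfc _) hdet
  have hne : f 0 ≠ f (Fin.last (n + 1)) := fun h => by simpa [Fin.ext_iff] using hf h
  obtain ⟨j, hj, hsepj⟩ := hsep _ _ hne
  have hmod := rootMultiplicity_modEq_of_derivative_mul_eq (hW 0) (hW (Fin.last _))
    (derivative_wronskian_minor_mul _ hdet (hW (Fin.last _)) 0) (-(j : ZMod p))
  have hmult : ∀ i : Fin (n + 2), ∃ m < R,
      rootMultiplicity (-(j : ZMod p)) (∏ i : Fin (n + 1), g ^ (i : ℕ)) +
        rootMultiplicity (-(j : ZMod p))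
          (wronskianMatrix ((fun i => u (f i) * c (f i)) ∘ i.succAbove)).det + e (f i) j =
      ∑ l, e (f l) j + m := by
    intro i
    have h2 := prod_pow_mul_det_wronskianMatrix (c := fun l => c (f (i.succAbove l)))
      fun l => hgw (f (i.succAbove l))
    have hne2 := mul_ne_zero (hpow0 (n + 1)) (hW i)
    have h2' := h2
    rw [show (wronskianMatrix fun l => shiftedPowers p K (e (f (i.succAbove l))) *
      c (f (i.succAbove l))) =
      wronskianMatrix ((fun i => u (f i) * c (f i)) ∘ i.succAbove) from rfl] at h2'
    have hne3 := hne2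
    rw [h2'] at hne3
    have h3 := congrArg (rootMultiplicity (-(j : ZMod p))) h2'
    rw [rootMultiplicity_mul hne2, rootMultiplicity_mul hne3] at h3
    have h4 : rootMultiplicity (-(j : ZMod p)) (∏ l, shiftedPowers p K (e (f (i.succAbove l)))) =
        ∑ l, e (f (i.succAbove l)) j := by
      have : (∏ l, shiftedPowers p K (e (f (i.succAbove l)))) =
          shiftedPowers p K fun j => ∑ l, e (f (i.succAbove l)) j := by
        simp only [shiftedPowers]
        rw [Finset.prod_comm]
        exact Finset.prod_congr rfl fun _ _ => Finset.prod_pow_eq_pow_sum _ _ _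
      rw [this, rootMultiplicity_shiftedPowers hK _ hj]
    refine ⟨rootMultiplicity (-(j : ZMod p)) (Matrix.of fun a b : Fin (n + 1) =>
      twistedDerivative g (w (f (i.succAbove b))) a (c (f (i.succAbove b)))).det, ?_, ?_⟩
    rotate_left
    · rw [h3, h4, Fin.sum_univ_succAbove _ i]
      ring
    · rw [← count_roots]
      refine ((Multiset.count_le_card _ _).trans (card_roots' _)).trans_lt ?_
      have := hdeg (f ∘ i.succAbove) (hf.comp Fin.succAbove_right_injective)
      have h6 := hcard hf
      simp only [Function.comp_apply] at this
      lia
  obtain ⟨m₁, hm₁, e₁⟩ := hmult 0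
  obtain ⟨m₂, hm₂, e₂⟩ := hmult (Fin.last _)
  refine hsepj m₂ m₁ hm₂ hm₁ ?_
  have h7 := hmod.symm
  rw [Nat.modEq_iff_dvd] at h7 ⊢
  convert h7 using 1
  zify at e₁ e₂
  push_cast
  linear_combination e₂ - e₁

end

section
variable {p : ℕ} [Fact p.Prime] {K : ℕ}

theorem X_pow_dvd_of_sum_X_pow_mul_eq_zero {R : Type*} [CommRing R] [IsDomain R] {n J : ℕ}
    (S : Fin J → R[X]) (h : ∑ k : Fin J, X ^ (n * (k : ℕ)) * S k = 0) (k₀ : Fin J)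
    (h₀ : ∀ k < k₀, S k = 0) : X ^ n ∣ S k₀ := by
  have h1 : X ^ (n * (k₀ : ℕ)) * X ^ n ∣ X ^ (n * (k₀ : ℕ)) * S k₀ := by
    rw [← Finset.add_sum_erase _ _ (Finset.mem_univ k₀)] at h
    rw [eq_neg_of_add_eq_zero_left h, dvd_neg]
    refine Finset.dvd_sum fun k hk => ?_
    rcases lt_or_gt_of_ne (Finset.ne_of_mem_erase hk) with hlt | hgt
    · simp [h₀ k hlt]
    · rw [← pow_add]
      refine (pow_dvd_pow _ ?_).mul_right _
      have : (k₀ : ℕ) + 1 ≤ k := hgt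
      nlinarith
  exact (mul_dvd_mul_iff_left (pow_ne_zero _ X_ne_zero)).mp h1

/-- Stepanov's method for simultaneous values of products of powers of linear factors. -/
theorem stepanov_card_le {ι : Type*} [Fintype ι] {A R J M E : ℕ}
    (hK : K < p) {e : ι → ℕ → ℕ}
    (hsep : ∀ b b', b ≠ b' → ∃ j ∈ Finset.Icc 1 K, ∀ m₁ m₂, m₁ < R → m₂ < R →
      ¬ (e b j + m₁ ≡ e b' j + m₂ [MOD p]))
    (hR : Fintype.card ι * (A + Fintype.card ι * K) + Fintype.card ι ≤ R) (hRp : R < p)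
    (hMp : M ≤ p) (hM : M * (A + M * K + J) < A * Fintype.card ι * J)
    (hE : ∀ b, ∑ j ∈ Finset.Icc 1 K, e b j ≤ E)
    (α : ι → ZMod p) (Z : Finset (ZMod p))
    (hZ : ∀ x ∈ Z, ∀ b, (shiftedPowers p K (e b)).eval x = α b)
    (hZ' : ∀ x ∈ Z, (shiftedPowers p K 1).eval x ≠ 0) :
    M * Z.card ≤ A + E + p * J := by
  classical
  rcases Nat.eq_zero_or_pos M with rfl | hMpos
  · simp
  choose w hw hgw using fun b => exists_mul_derivative_shiftedPowers (p := p) (K := K) (e b)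
  set g : (ZMod p)[X] := shiftedPowers p K 1 with hg
  have hgK : g.natDegree ≤ K := by simp [hg, natDegree_shiftedPowers]
  let V := ι × Fin J → degreeLT (ZMod p) A
  let Ψ : ℕ → V →ₗ[ZMod p] (ZMod p)[X] := fun l => ∑ bk : ι × Fin J,
    (LinearMap.mulLeft (ZMod p) (C (α bk.1) * X ^ (bk.2 : ℕ))) ∘ₗ
      twistedDerivative g (w bk.1) l ∘ₗ (degreeLT (ZMod p) A).subtype ∘ₗ LinearMap.proj bk
  have hΨ : ∀ l v, Ψ l v = ∑ bk : ι × Fin J,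
      C (α bk.1) * X ^ (bk.2 : ℕ) * twistedDerivative g (w bk.1) l (v bk) := by
    intro l v
    simp only [Ψ, LinearMap.sum_apply]
    rfl
  let Λ : V →ₗ[ZMod p] (Fin M × Fin (A + M * K + J) → ZMod p) :=
    LinearMap.pi fun lm => lcoeff (ZMod p) lm.2 ∘ₗ Ψ lm.1
  have hrank : Module.finrank (ZMod p) (Fin M × Fin (A + M * K + J) → ZMod p) <
      Module.finrank (ZMod p) V := by
    rw [Module.finrank_pi_fintype, Module.finrank_pi_fintype]
    simp only [Module.finrank_self, (degreeLTEquiv (ZMod p) A).finrank_eq, Module.finrank_fin_fun,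
      Finset.sum_const, Finset.card_univ, Fintype.card_prod, Fintype.card_fin, smul_eq_mul]
    nlinarith
  obtain ⟨v, hvker, hv0⟩ :=
    (Submodule.ne_bot_iff _).mp (LinearMap.ker_ne_bot_of_finrank_lt (f := Λ) hrank)
  have hcdeg : ∀ bk, (v bk : (ZMod p)[X]).natDegree ≤ A := fun bk =>
    natDegree_le_iff_degree_le.mpr (mem_degreeLT.mp (v bk).2).le
  have hΨ0 : ∀ l < M, Ψ l v = 0 := by
    intro l hl
    ext m
    by_cases hm : m < A + M * K + J
    · exact congrFun (LinearMap.mem_ker.mp hvker) (⟨l, hl⟩, ⟨m, hm⟩)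
    · rw [coeff_zero]
      refine coeff_eq_zero_of_natDegree_lt (lt_of_le_of_lt (b := A + M * K + J - 1) ?_ ?_)
      · rw [hΨ]
        refine natDegree_sum_le_of_forall_le _ _ fun bk _ => ?_
        have h1 : (C (α bk.1) * X ^ (bk.2 : ℕ)).natDegree ≤ (bk.2 : ℕ) := natDegree_C_mul_X_pow_le _ _
        refine (natDegree_mul_le_of_le h1
          (natDegree_twistedDerivative_le hgK (hw bk.1) (hcdeg bk) l)).trans ?_
        have h2 := bk.2.2
        have h3 : l * K ≤ M * K := Nat.mul_le_mul_right _ hl.le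
        lia
      · have : 0 < A + M * K + J := by
          by_contra h0
          have : A = 0 := by lia
          simp [this] at hM
        lia
  let U : ι × Fin J → (ZMod p)[X] := fun bk =>
    shiftedPowers p K (e bk.1) * X ^ (p * (bk.2 : ℕ))
  let Φ : (ZMod p)[X] := ∑ bk, U bk * v bk
  have hU : ∀ bk, g * derivative (U bk) = U bk * w bk.1 := by
    intro bk
    have : derivative ((X : (ZMod p)[X]) ^ (p * (bk.2 : ℕ))) = 0 := by
      simp [derivative_X_pow]
    simp only [U, derivative_mul, this]
    linear_combination X ^ (p * (bk.2 : ℕ)) * hgw bk.1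
  have hΦ0 : Φ ≠ 0 := by
    intro hΦ
    obtain ⟨bk, hbk⟩ := Function.ne_iff.mp hv0
    let T : Finset (Fin J) := Finset.univ.filter fun k => ∃ b, v (b, k) ≠ 0
    have hT : T.Nonempty := ⟨bk.2, by simpa [T] using ⟨bk.1, hbk⟩⟩
    obtain ⟨b₀, hb₀⟩ := (Finset.mem_filter.mp (T.min'_mem hT)).2
    set k₀ := T.min' hT
    refine not_X_pow_dvd_sum_shiftedPowers hK hsep hR hRp (c := fun b => (v (b, k₀) : (ZMod p)[X]))
      (fun b => hcdeg _) (fun h => hb₀ (Subtype.ext (congrFun h b₀))) ?_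
    refine X_pow_dvd_of_sum_X_pow_mul_eq_zero
      (fun k => ∑ b, shiftedPowers p K (e b) * (v (b, k) : (ZMod p)[X])) ?_ k₀ ?_
    · rw [← hΦ]
      simp only [Φ, U]
      rw [Fintype.sum_prod_type_right]
      refine Finset.sum_congr rfl fun k _ => ?_
      rw [Finset.mul_sum]
      exact Finset.sum_congr rfl fun b _ => by ring
    · intro k hk
      refine Finset.sum_eq_zero fun b _ => ?_
      have : v (b, k) = 0 := by
        by_contra hne
        exact absurd (T.min'_le k (by simpa [T] using ⟨b, hne⟩)) (not_le.mpr hk)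
      simp [this]
  have hroot : ∀ x ∈ Z, (X - C x) ^ M ∣ Φ := by
    intro x hx
    rw [← le_rootMultiplicity_iff hΦ0]
    have h1 : M - 1 < Φ.rootMultiplicity x := by
      refine lt_rootMultiplicity_of_isRoot_iterate_derivative_of_mem_nonZeroDivisors hΦ0 ?_ ?_
      · intro l hl
        have h2 : g ^ l * derivative^[l] Φ =
            ∑ bk, U bk * twistedDerivative g (w bk.1) l (v bk) := by
          simp only [Φ, iterate_derivative_sum, Finset.mul_sum]
          exact Finset.sum_congr rfl fun bk _ => pow_mul_iterate_derivative_mul (hU bk) l _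
        have h3 : (g ^ l * derivative^[l] Φ).eval x = 0 := by
          rw [h2, ← eval_zero (x := x), ← hΨ0 l (by lia), hΨ, eval_finsetSum, eval_finsetSum]
          refine Finset.sum_congr rfl fun bk _ => ?_
          simp only [U, eval_mul, eval_C, eval_pow, eval_X, hZ x hx, pow_mul, ZMod.pow_card]
        rw [eval_mul, eval_pow] at h3
        exact (mul_eq_zero.mp h3).resolve_left (pow_ne_zero _ (hZ' x hx))
      · rw [mem_nonZeroDivisors_iff_ne_zero, Ne, ZMod.natCast_eq_zero_iff,
          (Fact.out : p.Prime).dvd_factorial]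
        lia
    lia
  have hdvd : ∏ x ∈ Z, (X - C x) ^ M ∣ Φ :=
    Finset.prod_dvd_of_coprime (fun x _ y _ hxy =>
      (pairwise_coprime_X_sub_C Function.injective_id hxy).pow) hroot
  have hdeg := natDegree_le_of_dvd hdvd hΦ0
  rw [natDegree_prod_of_monic _ _ fun x _ => (monic_X_sub_C x).pow M] at hdeg
  simp only [natDegree_pow, natDegree_X_sub_C, mul_one, Finset.sum_const, smul_eq_mul] at hdeg
  rw [mul_comm] at hdeg
  refine hdeg.trans (natDegree_sum_le_of_forall_le _ _ fun bk _ => ?_)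
  have h1 : (U bk).natDegree ≤ E + p * J := by
    refine natDegree_mul_le_of_le ((natDegree_shiftedPowers _).le.trans (hE _)) ?_
    rw [natDegree_X_pow]
    exact Nat.mul_le_mul_left _ bk.2.2.le
  refine (natDegree_mul_le_of_le h1 (hcdeg bk)).trans ?_
  lia

end

section

/-- The product `(x + 1)(x + 2)⋯(x + k)`. -/
def shiftedFactorial {R : Type*} [CommRing R] (x : R) (k : ℕ) : R :=
  ∏ j ∈ Finset.Icc 1 k, (x + j)

theorem shiftedFactorial_add {R : Type*} [CommRing R] (x : R) (k l : ℕ) :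
    shiftedFactorial x (k + l) = shiftedFactorial x k * shiftedFactorial (x + k) l := by
  induction l with
  | zero => simp [shiftedFactorial]
  | succ l ih =>
    rw [← add_assoc]
    simp only [shiftedFactorial] at ih ⊢
    rw [Finset.prod_Icc_succ_top (by lia), Finset.prod_Icc_succ_top (by lia), ih]
    push_cast
    ring

theorem exists_not_modEq_of_ne {p K B R : ℕ} {S : Finset ℕ} (hS : S ⊆ Finset.Icc 1 K)
    (hRB : R * B < p) {t t' : S → Fin B} (h : t ≠ t') :
    ∃ j ∈ Finset.Icc 1 K, ∀ m₁ m₂, m₁ < R → m₂ < R →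
      ¬ ((∑ k : S, if j ≤ k then R * (t k : ℕ) else 0) + m₁ ≡
        (∑ k : S, if j ≤ k then R * (t' k : ℕ) else 0) + m₂ [MOD p]) := by
  classical
  let T : Finset S := Finset.univ.filter fun k => t k ≠ t' k
  have hT : T.Nonempty := by
    obtain ⟨k, hk⟩ := Function.ne_iff.mp h
    exact ⟨k, by simpa [T] using hk⟩
  obtain ⟨k₀, hk₀, hmax⟩ := T.exists_max_image (fun k => (k : ℕ)) hT
  refine ⟨k₀, hS k₀.2, fun m₁ m₂ hm₁ hm₂ hmod => ?_⟩
  have hne : t k₀ ≠ t' k₀ := (Finset.mem_filter.mp hk₀).2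
  rw [← Finset.add_sum_erase _ _ (Finset.mem_univ k₀), ← Finset.add_sum_erase (a := k₀) _
    (fun k : S => if (k₀ : ℕ) ≤ k then R * (t' k : ℕ) else 0) (Finset.mem_univ k₀)] at hmod
  have heq : ∑ k ∈ Finset.univ.erase k₀, (if (k₀ : ℕ) ≤ k then R * (t k : ℕ) else 0) =
      ∑ k ∈ Finset.univ.erase k₀, (if (k₀ : ℕ) ≤ k then R * (t' k : ℕ) else 0) := by
    refine Finset.sum_congr rfl fun k hk => ?_
    split_ifs with hle
    · have : t k = t' k := by
        by_contra hne'
        have h1 := hmax k (by simpa [T] using hne')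
        exact Finset.ne_of_mem_erase hk (Subtype.ext (le_antisymm h1 hle))
      rw [this]
    · rfl
  rw [heq, add_right_comm, add_right_comm (ite _ (R * (t' k₀ : ℕ)) 0)] at hmod
  have hmod' := Nat.ModEq.add_right_cancel' _ hmod
  simp only [le_refl, if_true] at hmod'
  have hlt : ∀ (a : Fin B) (m : ℕ), m < R → R * (a : ℕ) + m < p := fun a m hm => by
    have : R * ((a : ℕ) + 1) ≤ R * B := Nat.mul_le_mul_left _ a.2
    lia
  have heq' := hmod'.eq_of_lt_of_lt (hlt _ _ hm₁) (hlt _ _ hm₂)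
  apply hne
  ext
  have h2 := congrArg (· / R) heq'
  have hR : 0 < R := by lia
  simpa [Nat.mul_add_div hR, Nat.div_eq_of_lt hm₁, Nat.div_eq_of_lt hm₂] using h2

theorem stepanov_parameters_lt {A J K M Q R V p d : ℕ} (hMpos : 0 < M) (hM : 4 * M ≤ R)
    (hMp : M ^ 2 ≤ p) (hV : p ≤ V * R) (hMQ : M < Q * (d + 1)) (hAQ : R ≤ 2 * (A * Q))
    (hJ : J = d + 1 + (4 * V * (K + 1) + 1)) (hdM : d ≤ M) :
    M * (A + M * K + J) < A * Q * J := by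
  set δ := 4 * V * (K + 1) + 1 with hδ
  have hA : 0 < A := by
    rcases Nat.eq_zero_or_pos A with rfl | h
    · lia
    · exact h
  have h0 : A * M < A * (Q * (d + 1)) := Nat.mul_lt_mul_of_pos_left hMQ hA
  have h1 : A * Q * J = A * (Q * (d + 1)) + A * Q * δ := by rw [hJ]; ring
  have hVR : 4 * (p * (K + 1)) ≤ 4 * (V * R * (K + 1)) :=
    Nat.mul_le_mul_left _ (Nat.mul_le_mul_right _ hV)
  have h2 : R * δ = 4 * (V * R * (K + 1)) + R := by rw [hδ]; ring
  have h3 : R * δ ≤ 2 * (A * Q) * δ := Nat.mul_le_mul_right _ hAQ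
  have h4 : 4 * M * δ ≤ 2 * (A * Q) * δ := Nat.mul_le_mul_right _ (hM.trans hAQ)
  have h5 : M * (A + M * K + J) = A * M + M ^ 2 * K + M * d + M + M * δ := by rw [hJ]; ring
  have h6 : M ^ 2 * K ≤ p * K := Nat.mul_le_mul_right _ hMp
  have h7 : M * d ≤ M ^ 2 := by rw [pow_two]; exact Nat.mul_le_mul_left _ hdM
  have h8 : 2 * (A * Q) * δ = 2 * (A * Q * δ) := by ring
  have h9 : 4 * M * δ = 4 * (M * δ) := by ring
  have h10 : p * (K + 1) = p * K + p := by ring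
  lia

variable {p : ℕ} [Fact p.Prime] {K : ℕ}

theorem shiftedFactorial_ne_zero_of_le {x : ZMod p} {k : ℕ} (hx : shiftedFactorial x K ≠ 0)
    (hk : k ≤ K) : shiftedFactorial x k ≠ 0 := by
  obtain ⟨l, rfl⟩ := Nat.exists_eq_add_of_le hk
  rw [shiftedFactorial_add] at hx
  exact left_ne_zero_of_mul hx

theorem eval_shiftedPowers_sum (S : Finset ℕ) (hS : S ⊆ Finset.Icc 1 K) (n : S → ℕ) (x : ZMod p) :
    (shiftedPowers p K fun j => ∑ k : S, if j ≤ k then n k else 0).eval x =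
      ∏ k : S, shiftedFactorial x k ^ n k := by
  rw [eval_shiftedPowers]
  simp_rw [← Finset.prod_pow_eq_pow_sum, shiftedFactorial, ← Finset.prod_pow]
  rw [Finset.prod_comm]
  refine Finset.prod_congr rfl fun k _ => ?_
  have hk := Finset.mem_Icc.mp (hS k.2)
  have : Finset.Icc 1 (k : ℕ) = (Finset.Icc 1 K).filter (· ≤ (k : ℕ)) := by
    ext j
    simp only [Finset.mem_Icc, Finset.mem_filter]
    lia
  rw [this, Finset.prod_filter]
  refine Finset.prod_congr rfl fun j _ => ?_
  split_ifs <;> simp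

/-- The number of `x` for which the power residue classes of `shiftedFactorial x k`, for all
`k ∈ S`, are prescribed. -/
theorem card_shiftedFactorial_pow_eq_le {D τ B c V M : ℕ} {S : Finset ℕ}
    (hS : S ⊆ Finset.Icc 1 K) (hBD : B * τ ≤ D) (hB : 0 < B) (hK1 : 1 ≤ K)
    (hKp : K < p) (hQ : 4 * (B ^ S.card) ^ 2 * (K + 1) ≤ (p - 1) / D * τ)
    (hM : 4 * M ≤ (p - 1) / D * τ) (hMp : M ^ 2 ≤ p) (hpM : p ≤ c * M ^ 2)
    (hV : p ≤ V * ((p - 1) / D * τ)) (a : ℕ → ZMod p) :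
    ((Finset.univ.filter fun x : ZMod p => shiftedFactorial x K ≠ 0 ∧
      ∀ k ∈ S, shiftedFactorial x k ^ ((p - 1) / D) = a k).card : ℝ) ≤
      p / (B : ℝ) ^ S.card + c * M * K * (S.card + 11 * V) := by
  classical
  have hp : 1 < p := (Fact.out : p.Prime).one_lt
  set R := (p - 1) / D * τ with hRdef
  set Q := B ^ S.card with hQdef
  set s := S.card with hs
  set Z := Finset.univ.filter fun x : ZMod p => shiftedFactorial x K ≠ 0 ∧
      ∀ k ∈ S, shiftedFactorial x k ^ ((p - 1) / D) = a k with hZ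
  have hQpos : 0 < Q := by positivity
  have hRB : R * B < p := by
    have h1 : (p - 1) / D * D ≤ p - 1 := Nat.div_mul_le_self _ _
    have h2 : R * B = (p - 1) / D * (B * τ) := by rw [hRdef]; ring
    have h3 : (p - 1) / D * (B * τ) ≤ (p - 1) / D * D := Nat.mul_le_mul_left _ hBD
    lia
  have hRp : R < p := lt_of_le_of_lt (Nat.le_mul_of_pos_right _ hB) hRB
  have hcard : Fintype.card (S → Fin B) = Q := by simp [hQdef, hs]
  set A := R / Q - Q * K - 1 with hA
  set J := M / Q + 4 * V * (K + 1) + 2 with hJ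
  have hQQ : Q ≤ Q ^ 2 := Nat.le_self_pow (by lia) _
  have hA1 : Q * K + 1 ≤ R / Q := by
    rw [Nat.le_div_iff_mul_le hQpos]
    linarith
  have hAQ : R ≤ 2 * (A * Q) := by
    have h1 : R < Q * (R / Q + 1) := Nat.lt_mul_div_succ R hQpos
    have h2 : A + Q * K + 1 = R / Q := by lia
    rw [← h2] at h1
    have h3 : Q ^ 2 ≤ Q ^ 2 * K := Nat.le_mul_of_pos_right _ hK1
    linarith
  have hAR : Q * (A + Q * K) + Q ≤ R := by
    have h2 : A + Q * K + 1 = R / Q := by lia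
    calc Q * (A + Q * K) + Q = Q * (R / Q) := by rw [← h2]; ring
      _ ≤ R := Nat.mul_div_le R Q
  have hMpos : 0 < M := by
    rcases Nat.eq_zero_or_pos M with rfl | h
    · simp at hpM; lia
    · exact h
  have hMQ : M < Q * (M / Q + 1) := Nat.lt_mul_div_succ M hQpos
  have hdivM : M / Q ≤ M := Nat.div_le_self _ _
  have hmain : M * (A + M * K + J) < A * Q * J :=
    stepanov_parameters_lt hMpos hM hMp hV hMQ hAQ (by lia) hdivM
  have hE : ∀ t : S → Fin B, ∑ j ∈ Finset.Icc 1 K,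
      (∑ k : S, if j ≤ k then R * (t k : ℕ) else 0) ≤ p * s * K := by
    intro t
    calc _ ≤ ∑ j ∈ Finset.Icc 1 K, ∑ k : S, p := by
          refine Finset.sum_le_sum fun j _ => Finset.sum_le_sum fun k _ => ?_
          split_ifs
          · exact (Nat.mul_le_mul_left _ (t k).2.le).trans hRB.le
          · exact Nat.zero_le _
      _ = p * s * K := by simp [hs]; ring
  have hst := stepanov_card_le (ι := S → Fin B) (A := A) (R := R) (J := J) (M := M) hKp
    (e := fun t j => ∑ k : S, if j ≤ k then R * (t k : ℕ) else 0)
    (fun t t' h => exists_not_modEq_of_ne hS hRB h) (by rw [hcard]; exact hAR) hRp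
    (by lia) (by rw [hcard]; exact hmain) hE (fun t => ∏ k : S, a k ^ (τ * (t k : ℕ))) Z
    (fun x hx t => by
      rw [eval_shiftedPowers_sum S hS]
      refine Finset.prod_congr rfl fun k _ => ?_
      rw [← (Finset.mem_filter.mp hx).2.2 k k.2, ← pow_mul, hRdef, mul_assoc])
    (fun x hx => by
      have := (Finset.mem_filter.mp hx).2.1
      simpa [eval_shiftedPowers, shiftedFactorial] using this)
  have hAp : A ≤ p := by
    have : R / Q ≤ R := Nat.div_le_self _ _
    lia
  have hV1 : 1 ≤ V := by
    rcases Nat.eq_zero_or_pos V with rfl | h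
    · lia
    · exact h
  have hst' : (M : ℝ) * Z.card ≤ A + p * s * K + p * J := by exact_mod_cast hst
  have hJr : (J : ℝ) ≤ M / Q + 4 * V * (K + 1) + 2 := by
    rw [hJ]; push_cast
    have := Nat.cast_div_le (α := ℝ) (m := M) (n := Q)
    linarith
  have hMr : (0 : ℝ) < M := by exact_mod_cast hMpos
  have hApr : (A : ℝ) ≤ p := by exact_mod_cast hAp
  have hp0 : (0 : ℝ) < p := by exact_mod_cast (by lia : 0 < p)
  have hK1r : (1 : ℝ) ≤ K := by exact_mod_cast hK1
  have hV1r : (1 : ℝ) ≤ V := by exact_mod_cast hV1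
  have hpMr : (p : ℝ) ≤ c * M ^ 2 := by exact_mod_cast hpM
  have hQr : (Q : ℝ) = (B : ℝ) ^ s := by simp [hQdef]
  rw [← hQr]
  have h1 : (M : ℝ) * Z.card ≤ M * (p / Q) + p * (K * (s + 11 * V)) := by
    have h2 : 1 + s * K + 4 * V * (K + 1) + 2 ≤ (K : ℝ) * (s + 11 * V) := by
      have : (V : ℝ) ≤ K * V := le_mul_of_one_le_left (by linarith) hK1r
      linarith
    have h3 : (p : ℝ) * J ≤ p * (M / Q + 4 * V * (K + 1) + 2) :=
      mul_le_mul_of_nonneg_left hJr hp0.le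
    have h4 := mul_le_mul_of_nonneg_left h2 hp0.le
    have h5 : (p : ℝ) * (M / Q) = M * (p / Q) := by ring
    linarith
  have h2 : (p : ℝ) * (K * (s + 11 * V)) ≤ c * M ^ 2 * (K * (s + 11 * V)) := by gcongr
  refine le_of_mul_le_mul_left (h1.trans (add_le_add_right h2 _) |>.trans_eq ?_) hMr
  ring

end

section

variable {X F : Type*} [DecidableEq F]

/-- Approximate independence of `F`-valued random variables, deduced from upper bounds for the
joint distribution. -/
theorem abs_sum_prod_le_of_card_le {G : Finset X} {μ : Finset F} {S : Finset ℕ} {w : X → ℕ → F}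
    {N Err K : ℝ} (hG : N - K ≤ G.card)
    (hμ : μ.Nonempty) (hw : ∀ x ∈ G, ∀ k ∈ S, w x k ∈ μ)
    (hcard : ∀ a : ℕ → F, ((G.filter fun x => ∀ k ∈ S, w x k = a k).card : ℝ) ≤
      N / (μ.card : ℝ) ^ S.card + Err)
    {φ : ℕ → F → ℝ} (hφ : ∀ k ∈ S, ∀ z ∈ μ, |φ k z| ≤ 1)
    {k₀ : ℕ} (hk₀ : k₀ ∈ S) (hφ₀ : ∑ z ∈ μ, φ k₀ z = 0) :
    |∑ x ∈ G, ∏ k ∈ S, φ k (w x k)| ≤ (μ.card : ℝ) ^ S.card * Err + K := by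
  classical
  set P := Fintype.piFinset fun _ : S => μ with hP
  set T := N / (μ.card : ℝ) ^ S.card + Err with hT
  set cnt : (S → F) → ℝ := fun c => ((G.filter fun x => (fun k : S => w x k) = c).card : ℝ)
    with hcnt
  have hmaps : ∀ x ∈ G, (fun k : S => w x k) ∈ P := fun x hx =>
    Fintype.mem_piFinset.mpr fun k => hw x hx k k.2
  have hcntT : ∀ c, cnt c ≤ T := by
    intro c
    obtain ⟨z, -⟩ := hμ
    refine le_trans ?_ (hcard fun k => if h : k ∈ S then c ⟨k, h⟩ else z)
    refine Nat.cast_le.mpr (Finset.card_le_card fun x hx => ?_)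
    obtain ⟨hx1, hx2⟩ := Finset.mem_filter.mp hx
    refine Finset.mem_filter.mpr ⟨hx1, fun k hk => ?_⟩
    simp [hk, ← hx2]
  have hsum : ∑ x ∈ G, ∏ k ∈ S, φ k (w x k) = ∑ c ∈ P, cnt c * ∏ k : S, φ k (c k) := by
    rw [← Finset.sum_fiberwise_of_maps_to hmaps]
    refine Finset.sum_congr rfl fun c _ => ?_
    rw [hcnt, ← nsmul_eq_mul, ← Finset.sum_const]
    refine Finset.sum_congr rfl fun x hx => ?_
    rw [← (Finset.mem_filter.mp hx).2, ← Finset.prod_coe_sort]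
  have hzero : ∑ c ∈ P, ∏ k : S, φ k (c k) = 0 := by
    rw [hP, ← Finset.prod_univ_sum (fun _ : S => μ) fun k z => φ k z]
    exact Finset.prod_eq_zero (Finset.mem_univ ⟨k₀, hk₀⟩) hφ₀
  have htotal : ∑ c ∈ P, cnt c = G.card := by
    rw [Finset.card_eq_sum_card_fiberwise hmaps]
    push_cast
    rfl
  have hPcard : (P.card : ℝ) = (μ.card : ℝ) ^ S.card := by simp [hP]
  have hμ0 : (0 : ℝ) < (μ.card : ℝ) ^ S.card := by
    have : 0 < μ.card := hμ.card_pos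
    positivity
  have hrw : ∑ c ∈ P, cnt c * ∏ k : S, φ k (c k) =
      ∑ c ∈ P, (cnt c - T) * ∏ k : S, φ k (c k) := by
    simp_rw [sub_mul, Finset.sum_sub_distrib, ← Finset.mul_sum, hzero]
    simp
  rw [hsum, hrw]
  calc _ ≤ ∑ c ∈ P, |(cnt c - T) * ∏ k : S, φ k (c k)| := Finset.abs_sum_le_sum_abs _ _
    _ ≤ ∑ c ∈ P, (T - cnt c) := by
        refine Finset.sum_le_sum fun c hc => ?_
        rw [abs_mul, Finset.abs_prod, abs_sub_comm, abs_of_nonneg (sub_nonneg.mpr (hcntT c))]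
        refine mul_le_of_le_one_right (sub_nonneg.mpr (hcntT c)) ?_
        exact Finset.prod_le_one (fun _ _ => abs_nonneg _)
          fun k _ => hφ k k.2 _ (Fintype.mem_piFinset.mp hc k)
    _ = (μ.card : ℝ) ^ S.card * T - G.card := by
        rw [Finset.sum_sub_distrib, htotal, Finset.sum_const, nsmul_eq_mul, hPcard]
    _ ≤ _ := by
        rw [hT, mul_add, mul_div_cancel₀ _ hμ0.ne']
        linarith

theorem card_image_le_half {n : ℕ} (f : Fin n → ℕ)
    (h : ∀ k ∈ Finset.univ.image f, (Finset.univ.filter fun i => f i = k).card ≠ 1) :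
    2 * (Finset.univ.image f).card ≤ n := by
  have h1 := Finset.card_eq_sum_card_image f Finset.univ
  rw [Finset.card_univ, Fintype.card_fin] at h1
  refine le_of_le_of_eq ?_ h1.symm
  rw [mul_comm, ← smul_eq_mul, ← Finset.sum_const]
  refine Finset.sum_le_sum fun k hk => ?_
  have h2 := h k hk
  obtain ⟨i, _, hi⟩ := Finset.mem_image.mp hk
  have h3 : 0 < (Finset.univ.filter fun i => f i = k).card :=
    Finset.card_pos.mpr ⟨i, by simp [hi]⟩
  lia

theorem card_filter_image_le {n r : ℕ} {I : Finset ℕ} (hI : I.Nonempty) :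
    ((Fintype.piFinset fun _ : Fin n => I).filter
      fun f => (Finset.univ.image f).card ≤ r).card ≤ r ^ n * I.card ^ r := by
  classical
  have hsub : ((Fintype.piFinset fun _ : Fin n => I).filter
      fun f => (Finset.univ.image f).card ≤ r) ⊆
      ((Finset.univ : Finset (Fin n → Fin r)) ×ˢ (Fintype.piFinset fun _ : Fin r => I)).image
        fun hg => hg.2 ∘ hg.1 := by
    intro f hf
    obtain ⟨hf1, hf2⟩ := Finset.mem_filter.mp hf
    rw [Fintype.mem_piFinset] at hf1
    obtain ⟨i₀, hi₀⟩ := hI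
    set m := (Finset.univ.image f).card
    let e := (Finset.univ.image f).equivFin
    refine Finset.mem_image.mpr ⟨⟨fun i => Fin.castLE hf2 (e ⟨f i, by simp⟩),
      fun j => if hj : (j : ℕ) < m then (e.symm ⟨j, hj⟩ : ℕ) else i₀⟩, ?_, ?_⟩
    · simp only [Finset.mem_product, Finset.mem_univ, true_and, Fintype.mem_piFinset]
      intro j
      split_ifs with hj
      · obtain ⟨i, _, hi⟩ := Finset.mem_image.mp (e.symm ⟨j, hj⟩).2
        rw [← hi]
        exact hf1 i
      · exact hi₀
    · ext i
      simp [m]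
  refine (Finset.card_le_card hsub).trans (Finset.card_image_le.trans ?_)
  simp

/-- A bound for the `2 * r`-th moment of sums of approximately independent centred variables. -/
theorem sum_pow_le_of_card_le {G : Finset X} {μ : Finset F} {I : Finset ℕ} {w : X → ℕ → F}
    {N Err K : ℝ} {r : ℕ} (hErr : 0 ≤ Err) (hK : 0 ≤ K) (hG : N - K ≤ G.card) (hG' : G.card ≤ N)
    (hμ : μ.Nonempty) (hI : I.Nonempty) (hw : ∀ x ∈ G, ∀ k ∈ I, w x k ∈ μ)
    (hcard : ∀ S ⊆ I, S.card ≤ 2 * r → ∀ a : ℕ → F,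
      ((G.filter fun x => ∀ k ∈ S, w x k = a k).card : ℝ) ≤ N / (μ.card : ℝ) ^ S.card + Err)
    {v : F → ℝ} (hv : ∀ z ∈ μ, |v z| ≤ 1) (hv₀ : ∑ z ∈ μ, v z = 0) :
    ∑ x ∈ G, (∑ k ∈ I, v (w x k)) ^ (2 * r) ≤
      (r : ℝ) ^ (2 * r) * (I.card : ℝ) ^ r * N +
        (I.card : ℝ) ^ (2 * r) * ((μ.card : ℝ) ^ (2 * r) * Err + K) := by
  classical
  set P := Fintype.piFinset fun _ : Fin (2 * r) => I with hP
  have hexp : ∑ x ∈ G, (∑ k ∈ I, v (w x k)) ^ (2 * r) =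
      ∑ f ∈ P, ∑ x ∈ G, ∏ i, v (w x (f i)) := by
    rw [Finset.sum_comm]
    refine Finset.sum_congr rfl fun x _ => ?_
    rw [hP, ← Finset.prod_univ_sum (fun _ : Fin (2 * r) => I) fun _ k => v (w x k)]
    simp
  have hN : 0 ≤ N := le_trans (Nat.cast_nonneg _) hG'
  have hμ1 : (1 : ℝ) ≤ μ.card := by exact_mod_cast hμ.card_pos
  set C := (μ.card : ℝ) ^ (2 * r) * Err + K with hC
  have hC0 : 0 ≤ C := by positivity
  have hterm : ∀ f ∈ P, ∑ x ∈ G, ∏ i, v (w x (f i)) ≤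
      (if (Finset.univ.image f).card ≤ r then N else 0) + C := by
    intro f hf
    rw [Fintype.mem_piFinset] at hf
    by_cases h1 : ∃ k ∈ Finset.univ.image f, (Finset.univ.filter fun i => f i = k).card = 1
    · obtain ⟨k₀, hk₀, hk₁⟩ := h1
      have hSI : Finset.univ.image f ⊆ I := by
        intro k hk
        obtain ⟨i, _, rfl⟩ := Finset.mem_image.mp hk
        exact hf i
      have hSr : (Finset.univ.image f).card ≤ 2 * r := Finset.card_image_le.trans (by simp)
      have h2 := abs_sum_prod_le_of_card_le hG hμ (fun x hx k hk => hw x hx k (hSI hk))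
        (hcard _ hSI hSr) (φ := fun k z => v z ^ (Finset.univ.filter fun i => f i = k).card)
        (fun k _ z hz => by rw [abs_pow]; exact pow_le_one₀ (abs_nonneg _) (hv z hz)) hk₀
        (by simpa [hk₁] using hv₀)
      have h3 : (μ.card : ℝ) ^ (Finset.univ.image f).card * Err + K ≤ C := by
        rw [hC]
        gcongr
      simp_rw [fun x => Finset.prod_comp (s := Finset.univ) (fun k => v (w x k)) f]
      refine (le_abs_self _).trans (h2.trans (h3.trans (le_add_of_nonneg_left ?_)))
      split_ifs <;> positivity
    · push Not at h1
      have h2 := card_image_le_half f h1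
      rw [if_pos (by lia)]
      calc ∑ x ∈ G, ∏ i, v (w x (f i)) ≤ ∑ x ∈ G, 1 := by
            refine Finset.sum_le_sum fun x hx => (le_abs_self _).trans ?_
            rw [Finset.abs_prod]
            exact Finset.prod_le_one (fun _ _ => abs_nonneg _) fun i _ => hv _ (hw x hx _ (hf i))
        _ ≤ N + C := by
            rw [Finset.sum_const, nsmul_eq_mul, mul_one]
            linarith
  rw [hexp]
  refine (Finset.sum_le_sum hterm).trans ?_
  rw [Finset.sum_add_distrib, ← Finset.sum_filter, Finset.sum_const, Finset.sum_const,
    nsmul_eq_mul, nsmul_eq_mul]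
  have h1 : (((P.filter fun f => (Finset.univ.image f).card ≤ r).card : ℕ) : ℝ) ≤
      (r : ℝ) ^ (2 * r) * (I.card : ℝ) ^ r := by
    exact_mod_cast card_filter_image_le (n := 2 * r) (r := r) hI
  have h2 : (P.card : ℝ) = (I.card : ℝ) ^ (2 * r) := by simp [hP]
  rw [h2]
  gcongr

/-- Approximately independent variables on `μ` take a given value close to the expected number of
times, outside a small exceptional set. -/
theorem card_deviation_le_of_card_le {G : Finset X} {μ : Finset F} {I : Finset ℕ} {w : X → ℕ → F}
    {N Err K : ℝ} {r : ℕ} (hErr : 0 ≤ Err) (hK : 0 ≤ K) (hG : N - K ≤ G.card) (hG' : G.card ≤ N)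
    (hI : I.Nonempty) (hw : ∀ x ∈ G, ∀ k ∈ I, w x k ∈ μ)
    (hcard : ∀ S ⊆ I, S.card ≤ 2 * r → ∀ a : ℕ → F,
      ((G.filter fun x => ∀ k ∈ S, w x k = a k).card : ℝ) ≤ N / (μ.card : ℝ) ^ S.card + Err)
    {a : F} (ha : a ∈ μ) {δ : ℝ} (hδ : 0 ≤ δ) :
    ((G.filter fun x =>
      δ < |((I.filter fun k => w x k = a).card : ℝ) - I.card / μ.card|).card : ℝ) * δ ^ (2 * r) ≤
      (r : ℝ) ^ (2 * r) * (I.card : ℝ) ^ r * N +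
        (I.card : ℝ) ^ (2 * r) * ((μ.card : ℝ) ^ (2 * r) * Err + K) := by
  have hμ : μ.Nonempty := ⟨a, ha⟩
  have hμ1 : (1 : ℝ) ≤ μ.card := by exact_mod_cast hμ.card_pos
  have hinv : (μ.card : ℝ)⁻¹ ≤ 1 := inv_le_one_of_one_le₀ hμ1
  have hinv0 : 0 ≤ (μ.card : ℝ)⁻¹ := by positivity
  refine le_trans ?_ (sum_pow_le_of_card_le hErr hK hG hG' hμ hI hw hcard
    (v := fun z => (if z = a then 1 else 0) - (μ.card : ℝ)⁻¹) ?_ ?_)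
  · rw [← nsmul_eq_mul, ← Finset.sum_const]
    refine (Finset.sum_le_sum fun x hx => ?_).trans (Finset.sum_le_sum_of_subset_of_nonneg
      (Finset.filter_subset _ _) fun x _ _ => ?_)
    · have h1 := (Finset.mem_filter.mp hx).2
      have h2 : ∑ k ∈ I, ((if w x k = a then 1 else 0) - (μ.card : ℝ)⁻¹) =
          ((I.filter fun k => w x k = a).card : ℝ) - I.card / μ.card := by
        simp [Finset.sum_sub_distrib, div_eq_mul_inv]
      rw [h2, ← (even_two_mul r).pow_abs (_ - _)]
      exact pow_le_pow_left₀ hδ h1.le _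
    · exact (even_two_mul r).pow_nonneg _
  · intro z _
    rw [abs_le]
    split_ifs <;> constructor <;> linarith
  · simp [Finset.sum_sub_distrib, ha, (by linarith : (μ.card : ℝ) ≠ 0)]

end

section

variable {p : ℕ} [Fact p.Prime] {K : ℕ}

theorem exists_isPrimitiveRoot_zmod {D : ℕ} (hD : D ∣ p - 1) :
    ∃ ζ : ZMod p, IsPrimitiveRoot ζ D := by
  have hp := (Fact.out : p.Prime).one_lt
  obtain ⟨g, hg⟩ := IsCyclic.exists_generator (α := (ZMod p)ˣ)
  have h1 : orderOf g = p - 1 := by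
    rw [orderOf_eq_card_of_forall_mem_zpowers hg, Nat.card_eq_fintype_card, ZMod.card_units]
  obtain ⟨d, hd⟩ := hD
  have h2 : IsPrimitiveRoot g (p - 1) := h1 ▸ IsPrimitiveRoot.orderOf g
  have h3 := h2.pow (by lia) (hd.trans (mul_comm _ _))
  exact ⟨_, IsPrimitiveRoot.coe_units_iff.mpr h3⟩

theorem card_nthRootsFinset_zmod {D : ℕ} (hD : D ∣ p - 1) :
    (nthRootsFinset D (1 : ZMod p)).card = D := by
  obtain ⟨ζ, hζ⟩ := exists_isPrimitiveRoot_zmod hD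
  exact hζ.card_nthRootsFinset

theorem card_shiftedFactorial_ne_zero_ge :
    (p : ℝ) - K ≤ (Finset.univ.filter fun x : ZMod p => shiftedFactorial x K ≠ 0).card := by
  have h1 : (Finset.univ.filter fun x : ZMod p => ¬ shiftedFactorial x K ≠ 0) ⊆
      (Finset.Icc 1 K).image fun j : ℕ => -(j : ZMod p) := by
    intro x hx
    have h2 := (Finset.mem_filter.mp hx).2
    rw [not_not, shiftedFactorial, Finset.prod_eq_zero_iff] at h2
    obtain ⟨j, hj, h3⟩ := h2
    exact Finset.mem_image.mpr ⟨j, hj, (eq_neg_of_add_eq_zero_left h3).symm⟩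
  have h2 := (Finset.card_le_card h1).trans Finset.card_image_le
  have h3 := Finset.card_filter_add_card_filter_not (s := (Finset.univ : Finset (ZMod p)))
    fun x => shiftedFactorial x K ≠ 0
  rw [Finset.card_univ, ZMod.card] at h3
  rw [Nat.card_Icc, Nat.add_sub_cancel] at h2
  have h4 : p ≤ (Finset.univ.filter fun x : ZMod p => shiftedFactorial x K ≠ 0).card + K := by
    lia
  have : (p : ℝ) ≤ (Finset.univ.filter fun x : ZMod p => shiftedFactorial x K ≠ 0).card + K := by
    exact_mod_cast h4
  linarith

/-- For all but few `x`, the power residue classes modulo `D`-th powers of `shiftedFactorial x k`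
are equidistributed. -/
theorem card_deviation_shiftedFactorial_le {D c M r : ℕ} (hD : D ∣ p - 1) (hK : 1 ≤ K)
    (hKp : K < p) (hQ : 4 * (D ^ (2 * r)) ^ 2 * (K + 1) ≤ (p - 1) / D)
    (hM : 4 * M ≤ (p - 1) / D) (hMp : M ^ 2 ≤ p) (hpM : p ≤ c * M ^ 2)
    {a : ZMod p} (ha : a ^ D = 1) {δ : ℝ} (hδ : 0 ≤ δ) :
    ((Finset.univ.filter fun x : ZMod p => shiftedFactorial x K ≠ 0 ∧
      δ < |(((Finset.Icc 1 K).filter fun k =>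
        shiftedFactorial x k ^ ((p - 1) / D) = a).card : ℝ) - K / D|).card : ℝ) * δ ^ (2 * r) ≤
      (r : ℝ) ^ (2 * r) * (K : ℝ) ^ r * p +
        (K : ℝ) ^ (2 * r) * ((D : ℝ) ^ (2 * r) * (c * M * K * (2 * r + 22 * D)) + K) := by
  have hp := (Fact.out : p.Prime).one_lt
  have hD0 : 0 < D := Nat.pos_of_dvd_of_pos hD (by lia)
  have hcardμ := card_nthRootsFinset_zmod hD
  have h := card_deviation_le_of_card_le
    (G := Finset.univ.filter fun x : ZMod p => shiftedFactorial x K ≠ 0)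
    (μ := nthRootsFinset D (1 : ZMod p)) (I := Finset.Icc 1 K)
    (w := fun x k => shiftedFactorial x k ^ ((p - 1) / D)) (N := p)
    (Err := c * M * K * (2 * r + 22 * D)) (K := K) (r := r) (by positivity) (by positivity)
    card_shiftedFactorial_ne_zero_ge
    (by exact_mod_cast (Finset.card_filter_le _ _).trans_eq (by simp [ZMod.card]))
    ⟨1, by simp [hK]⟩ ?_ ?_ (a := a) ((mem_nthRootsFinset hD0 _).mpr ha) hδ
  · rw [hcardμ, Nat.card_Icc, Nat.add_sub_cancel, Finset.filter_filter] at h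
    exact h
  · intro x hx k hk
    rw [mem_nthRootsFinset hD0, ← pow_mul, Nat.div_mul_cancel hD]
    exact ZMod.pow_card_sub_one_eq_one (shiftedFactorial_ne_zero_of_le (Finset.mem_filter.mp hx).2
      (Finset.mem_Icc.mp hk).2)
  · intro S hS hSr b
    rw [hcardμ, Finset.filter_filter]
    have hDS : D ^ S.card ≤ D ^ (2 * r) := Nat.pow_le_pow_right hD0 hSr
    have hQ' : 4 * (D ^ S.card) ^ 2 * (K + 1) ≤ (p - 1) / D :=
      le_trans (by gcongr) hQ
    have hV : p ≤ 2 * D * ((p - 1) / D * 1) := by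
      have : (p - 1) / D * D = p - 1 := Nat.div_mul_cancel hD
      linarith [Nat.le_sub_one_of_lt hp, (by lia : p ≤ 2 * (p - 1))]
    refine (card_shiftedFactorial_pow_eq_le (τ := 1) (c := c) hS (mul_one D).le hD0 hK hKp
      (by rwa [mul_one]) (by rwa [mul_one]) hMp hpM hV b).trans ?_
    have hSr' : (S.card : ℝ) ≤ 2 * r := by exact_mod_cast hSr
    push_cast
    have : (S.card : ℝ) + 11 * (2 * D) ≤ 2 * r + 22 * D := by linarith
    gcongr

/-- For few `y`, many of the `shiftedFactorial y k` with `k ≤ l` are `q`-th powers. -/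
theorem exists_card_le_forall_subset_shiftedFactorial_pow_ne_one {q τ B c V M l s : ℕ}
    (hBq : B * τ ≤ q) (hB : 0 < B) (hl : 1 ≤ l)
    (hlp : l < p) (hQ : 4 * (B ^ s) ^ 2 * (l + 1) ≤ (p - 1) / q * τ)
    (hM : 4 * M ≤ (p - 1) / q * τ) (hMp : M ^ 2 ≤ p) (hpM : p ≤ c * M ^ 2)
    (hV : p ≤ V * ((p - 1) / q * τ)) :
    ∃ Y : Finset (ZMod p),
      (Y.card : ℝ) ≤ (l : ℝ) ^ s * (p / (B : ℝ) ^ s + c * M * l * (s + 11 * V)) ∧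
      ∀ y ∉ Y, shiftedFactorial y l ≠ 0 → ∀ S ∈ (Finset.Icc 1 l).powersetCard s,
        ∃ k ∈ S, shiftedFactorial y k ^ ((p - 1) / q) ≠ 1 := by
  refine ⟨((Finset.Icc 1 l).powersetCard s).biUnion fun S => Finset.univ.filter fun y : ZMod p =>
        shiftedFactorial y l ≠ 0 ∧ ∀ k ∈ S, shiftedFactorial y k ^ ((p - 1) / q) = 1, ?_, ?_⟩
  swap
  · intro y hy h0 S hS
    by_contra! h
    exact hy (Finset.mem_biUnion.mpr ⟨S, hS, by simpa using ⟨h0, h⟩⟩)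
  have h1 : ∑ S ∈ (Finset.Icc 1 l).powersetCard s, ((Finset.univ.filter fun y : ZMod p =>
        shiftedFactorial y l ≠ 0 ∧ ∀ k ∈ S, shiftedFactorial y k ^ ((p - 1) / q) = 1).card : ℝ) ≤
      ∑ S ∈ (Finset.Icc 1 l).powersetCard s, (p / (B : ℝ) ^ s + c * M * l * (s + 11 * V)) := by
    refine Finset.sum_le_sum fun S hS => ?_
    obtain ⟨hS1, hS2⟩ := Finset.mem_powersetCard.mp hS
    have := card_shiftedFactorial_pow_eq_le (c := c) hS1 hBq hB hl hlp (by rwa [hS2]) hM hMp hpM hV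
      fun _ => 1
    rwa [hS2] at this
  refine (Nat.cast_le.mpr Finset.card_biUnion_le).trans ?_
  push_cast
  refine h1.trans ?_
  rw [Finset.sum_const, nsmul_eq_mul, Finset.card_powersetCard, Nat.card_Icc, Nat.add_sub_cancel]
  gcongr
  exact_mod_cast Nat.choose_le_pow l s

theorem card_filter_mul_shiftedFactorial_pow_eq_one_le {l s h : ℕ} {x b : ZMod p} (n : ℕ)
    (hgood : ∀ k₀ < n * l, ∀ S ∈ (Finset.Icc 1 l).powersetCard s,
      ∃ k ∈ S, shiftedFactorial (x + (k₀ + 1 : ℕ)) k ^ h ≠ 1) :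
    ((Finset.Icc 1 (n * l)).filter fun k => (b * shiftedFactorial x k) ^ h = 1).card ≤ n * s := by
  induction n with
  | zero => simp
  | succ n ih =>
    have hle : n * l ≤ (n + 1) * l := Nat.mul_le_mul_right _ (Nat.le_succ n)
    have hunion : Finset.Icc 1 ((n + 1) * l) =
        Finset.Icc 1 (n * l) ∪ Finset.Ioc (n * l) ((n + 1) * l) := by
      ext k
      simp only [Finset.mem_Icc, Finset.mem_union, Finset.mem_Ioc]
      lia
    rw [hunion, Finset.filter_union, add_mul n 1 s, one_mul]
    refine (Finset.card_union_le _ _).trans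
      (Nat.add_le_add (ih fun k₀ hk₀ => hgood k₀ (hk₀.trans_le hle)) ?_)
    set T := (Finset.Ioc (n * l) ((n + 1) * l)).filter fun k =>
      (b * shiftedFactorial x k) ^ h = 1 with hT
    by_contra! hcard
    have hTne : T.Nonempty := Finset.card_pos.mp (by lia)
    set k₁ := T.min' hTne
    obtain ⟨hk₁, hk₁'⟩ := Finset.mem_filter.mp (T.min'_mem hTne)
    obtain ⟨S, hS, hScard⟩ := Finset.exists_subset_card_eq (s := T.erase k₁) (n := s) (by
      rw [Finset.card_erase_of_mem (T.min'_mem hTne)]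
      lia)
    have hmem : ∀ k ∈ S, k₁ < k ∧ k ≤ (n + 1) * l ∧ (b * shiftedFactorial x k) ^ h = 1 := by
      intro k hk
      obtain ⟨hne, hkT⟩ := Finset.mem_erase.mp (hS hk)
      obtain ⟨h1, h2⟩ := Finset.mem_filter.mp hkT
      exact ⟨lt_of_le_of_ne (T.min'_le k hkT) (Ne.symm hne), (Finset.mem_Ioc.mp h1).2, h2⟩
    have hk₁Ioc := Finset.mem_Ioc.mp hk₁
    have hmemS : (S.image fun k => k - k₁) ∈ (Finset.Icc 1 l).powersetCard s := by
      refine Finset.mem_powersetCard.mpr ⟨?_, ?_⟩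
      · intro j hj
        obtain ⟨k, hk, rfl⟩ := Finset.mem_image.mp hj
        have := hmem k hk
        rw [Finset.mem_Icc]
        lia
      · rw [Finset.card_image_of_injOn, hScard]
        intro k hk k' hk' hkk'
        have := hmem k hk
        have := hmem k' hk'
        simp only at hkk'
        lia
    obtain ⟨j, hj, hne⟩ := hgood (k₁ - 1) (by lia) _ hmemS
    obtain ⟨k, hk, rfl⟩ := Finset.mem_image.mp hj
    obtain ⟨h1, h2, h3⟩ := hmem k hk
    rw [← Nat.add_sub_cancel' h1.le, shiftedFactorial_add, ← mul_assoc, mul_pow, hk₁',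
      one_mul] at h3
    rw [Nat.sub_add_cancel (by lia)] at hne
    exact hne h3

end

section

variable {p : ℕ} [Fact p.Prime]

theorem mul_pow_eq_iff_pow_eq_div {F : Type*} [Field F] {b u a : F} (hb : b ≠ 0) (h : ℕ) :
    (b * u) ^ h = a ↔ u ^ h = a / b ^ h := by
  rw [mul_pow, eq_div_iff (pow_ne_zero _ hb), mul_comm]

theorem div_pow_pow_eq_one {D : ℕ} (hD : D ∣ p - 1) {a b : ZMod p} (hb : b ≠ 0) (ha : a ^ D = 1) :
    (a / b ^ ((p - 1) / D)) ^ D = 1 := by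
  rw [div_pow, ha, ← pow_mul, Nat.div_mul_cancel hD, ZMod.pow_card_sub_one_eq_one hb, div_one]

theorem pow_injOn_nthRootsFinset {F : Type*} [Field F] {D q : ℕ} (hD : 0 < D)
    (hDq : D.Coprime q) : Set.InjOn (fun z : F => z ^ q) (nthRootsFinset D (1 : F)) := by
  intro z hz z' hz' h
  simp only [SetLike.mem_coe, mem_nthRootsFinset hD] at hz hz' h
  have h0 : z' ≠ 0 := by
    rintro rfl
    simp [hD.ne'] at hz'
  have h1 : (z / z') ^ D = 1 := by rw [div_pow, hz, hz', div_one]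
  have h2 : (z / z') ^ q = 1 := by rw [div_pow, h, div_self (pow_ne_zero _ h0)]
  have h3 := pow_gcd_eq_one.mpr ⟨h1, h2⟩
  rwa [hDq.gcd_eq_one, pow_one, div_eq_one_iff_eq h0] at h3

/-- If the residue classes of `u k` are well distributed, then some `b * u k` is not a `q`-th
power for any prime divisor `q` of `p - 1`. -/
theorem exists_forall_pow_ne_one_of_deviation_le {D y z s W : ℕ} {I : Finset ℕ} {E : ℝ}
    {b : ZMod p} {u : ℕ → ZMod p} (hb : b ≠ 0)
    (hD : D ∣ p - 1) (hsmall : ∀ q ∈ (p - 1).primeFactors, q ≤ y → q ∣ D)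
    (hcop : ∀ q ∈ (p - 1).primeFactors, y < q → D.Coprime q)
    (hdevD : ∀ a : ZMod p, a ^ D = 1 →
      |((I.filter fun k => u k ^ ((p - 1) / D) = a).card : ℝ) - I.card / D| ≤ E)
    (hmed : ∀ q ∈ (p - 1).primeFactors, y < q → q ≤ z → ∀ a : ZMod p, a ^ (D * q) = 1 →
      |((I.filter fun k => u k ^ ((p - 1) / (D * q)) = a).card : ℝ) - I.card / (D * q : ℕ)| ≤ E)
    (hlarge : ∀ q ∈ (p - 1).primeFactors, z < q →
      ((I.filter fun k => (b * u k) ^ ((p - 1) / q) = 1).card : ℝ) ≤ s * E)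
    (hy : 0 < y) (hW : ((p - 1).primeFactors.filter fun q => y < q).card ≤ W) (hWy : 2 * W ≤ y)
    (hE : E * (1 + W * (1 + s)) < I.card / (2 * D)) :
    ∃ k ∈ I, ∀ q ∈ (p - 1).primeFactors, (b * u k) ^ ((p - 1) / q) ≠ 1 := by
  classical
  by_contra! hcon
  have hp := (Fact.out : p.Prime).one_lt
  have hD0 : 0 < D := Nat.pos_of_dvd_of_pos hD (by lia)
  have hE0 : 0 ≤ E := (abs_nonneg _).trans (hdevD 1 (one_pow _))
  set Prim := primitiveRoots D (ZMod p) with hPrim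
  have hPrim0 : 0 < Prim.card := by
    obtain ⟨ζ, hζ⟩ := exists_isPrimitiveRoot_zmod hD
    exact Finset.card_pos.mpr ⟨ζ, (mem_primitiveRoots hD0).mpr hζ⟩
  have hPrim1 : (1 : ℝ) ≤ Prim.card := by exact_mod_cast hPrim0
  set A := I.filter fun k => (b * u k) ^ ((p - 1) / D) ∈ Prim with hA
  have hAcard : (Prim.card : ℝ) * (I.card / D - E) ≤ A.card := by
    have h1 : A.card = ∑ a ∈ Prim, (A.filter fun k => (b * u k) ^ ((p - 1) / D) = a).card :=
      Finset.card_eq_sum_card_fiberwise fun k hk => (Finset.mem_filter.mp hk).2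
    rw [h1, ← nsmul_eq_mul, ← Finset.sum_const]
    push_cast
    refine Finset.sum_le_sum fun a ha => ?_
    have h2 := abs_le.mp (hdevD _ (div_pow_pow_eq_one hD hb
      ((mem_primitiveRoots hD0).mp ha).pow_eq_one))
    have h3 : (A.filter fun k => (b * u k) ^ ((p - 1) / D) = a) =
        I.filter fun k => u k ^ ((p - 1) / D) = a / b ^ ((p - 1) / D) := by
      ext k
      simp only [hA, Finset.mem_filter, ← mul_pow_eq_iff_pow_eq_div hb]
      exact ⟨fun h => ⟨h.1.1, h.2⟩, fun h => ⟨⟨h.1, h.2 ▸ ha⟩, h.2⟩⟩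
    rw [h3]
    linarith
  have hcover : A ⊆ ((p - 1).primeFactors.filter fun q => y < q).biUnion fun q =>
      A.filter fun k => (b * u k) ^ ((p - 1) / q) = 1 := by
    intro k hk
    obtain ⟨hkI, hkP⟩ := Finset.mem_filter.mp hk
    obtain ⟨q, hq, hq1⟩ := hcon k hkI
    refine Finset.mem_biUnion.mpr ⟨q, Finset.mem_filter.mpr ⟨hq, ?_⟩,
      Finset.mem_filter.mpr ⟨hk, hq1⟩⟩
    by_contra! hqy
    obtain ⟨d, rfl⟩ := hsmall q hq hqy
    have hqp := Nat.prime_of_mem_primeFactors hq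
    have hprim := (mem_primitiveRoots hD0).mp hkP
    have hd : 0 < d := Nat.pos_of_mul_pos_left hD0
    have h1 : ((b * u k) ^ ((p - 1) / (q * d))) ^ d = 1 := by
      rw [← pow_mul, ← Nat.div_div_eq_div_mul, Nat.div_mul_cancel]
      · exact hq1
      · rw [Nat.dvd_div_iff_mul_dvd (Nat.dvd_of_mem_primeFactors hq)]
        exact hD
    have h2 := Nat.le_of_dvd hd (hprim.dvd_of_pow_eq_one _ h1)
    have := hqp.two_le
    nlinarith
  have hbound : ∀ q ∈ (p - 1).primeFactors.filter fun q => y < q,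
      ((A.filter fun k => (b * u k) ^ ((p - 1) / q) = 1).card : ℝ) ≤
        Prim.card * (I.card / (D * y) + (1 + s) * E) := by
    intro q hq
    obtain ⟨hq, hyq⟩ := Finset.mem_filter.mp hq
    have hy0 : (0 : ℝ) < y := by exact_mod_cast hy
    have hD0r : (0 : ℝ) < D := by exact_mod_cast hD0
    rcases le_or_gt q z with hqz | hqz
    · have hco := hcop q hq hyq
      have hDq := hco.mul_dvd_of_dvd_of_dvd hD (Nat.dvd_of_mem_primeFactors hq)
      set Z := (nthRootsFinset D (1 : ZMod p)).filter fun x => x ^ q ∈ Prim with hZ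
      have hZcard : Z.card ≤ Prim.card :=
        Finset.card_le_card_of_injOn (fun x => x ^ q) (fun x hx => (Finset.mem_filter.mp hx).2)
          ((pow_injOn_nthRootsFinset hD0 hco).mono (Finset.filter_subset _ _))
      have hsub : (A.filter fun k => (b * u k) ^ ((p - 1) / q) = 1) ⊆
          Z.biUnion fun x => I.filter fun k => (b * u k) ^ ((p - 1) / (D * q)) = x := by
        intro k hk
        obtain ⟨hkA, hk1⟩ := Finset.mem_filter.mp hk
        obtain ⟨hkI, hkP⟩ := Finset.mem_filter.mp hkA
        refine Finset.mem_biUnion.mpr ⟨_, Finset.mem_filter.mpr ⟨?_, ?_⟩,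
          Finset.mem_filter.mpr ⟨hkI, rfl⟩⟩
        · rw [mem_nthRootsFinset hD0, ← pow_mul, mul_comm D q, ← Nat.div_div_eq_div_mul,
            Nat.div_mul_cancel]
          · exact hk1
          · rw [Nat.dvd_div_iff_mul_dvd (Nat.dvd_of_mem_primeFactors hq), mul_comm]
            exact hDq
        · rw [← pow_mul, ← Nat.div_div_eq_div_mul, Nat.div_mul_cancel]
          · exact hkP
          · rw [Nat.dvd_div_iff_mul_dvd hD]
            exact hDq
      have hfib : ∀ x ∈ Z, ((I.filter fun k => (b * u k) ^ ((p - 1) / (D * q)) = x).card : ℝ) ≤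
          I.card / (D * y) + (1 + s) * E := by
        intro x hx
        have hx1 : x ^ (D * q) = 1 := by
          rw [pow_mul, (mem_nthRootsFinset hD0 _).mp (Finset.mem_filter.mp hx).1, one_pow]
        have h1 := abs_le.mp (hmed q hq hyq hqz _ (div_pow_pow_eq_one hDq hb hx1))
        simp_rw [mul_pow_eq_iff_pow_eq_div hb]
        have h2 : (I.card : ℝ) / (D * q : ℕ) ≤ I.card / (D * y) := by
          push_cast
          gcongr
        have h3 : 0 ≤ (s : ℝ) * E := by positivity
        linarith
      calc _ ≤ ∑ x ∈ Z, ((I.filter fun k => (b * u k) ^ ((p - 1) / (D * q)) = x).card : ℝ) := by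
            exact_mod_cast (Finset.card_le_card hsub).trans Finset.card_biUnion_le
        _ ≤ Z.card * (I.card / (D * y) + (1 + s) * E) := by
            rw [← nsmul_eq_mul, ← Finset.sum_const]
            exact Finset.sum_le_sum hfib
        _ ≤ _ := by gcongr
    · have h1 : ((A.filter fun k => (b * u k) ^ ((p - 1) / q) = 1).card : ℝ) ≤ s * E :=
        (Nat.cast_le.mpr (Finset.card_le_card
          (Finset.filter_subset_filter _ (Finset.filter_subset _ _)))).trans (hlarge q hq hqz)
      refine h1.trans (le_trans ?_ (le_mul_of_one_le_left (by positivity) hPrim1))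
      have : (0 : ℝ) ≤ I.card / (D * y) := by positivity
      linarith
  have hfinal : (A.card : ℝ) ≤ W * (Prim.card * (I.card / (D * y) + (1 + s) * E)) := by
    calc (A.card : ℝ) ≤ ∑ q ∈ (p - 1).primeFactors.filter fun q => y < q,
          ((A.filter fun k => (b * u k) ^ ((p - 1) / q) = 1).card : ℝ) := by
          exact_mod_cast (Finset.card_le_card hcover).trans Finset.card_biUnion_le
      _ ≤ _ := Finset.sum_le_sum hbound
      _ ≤ _ := by
          rw [Finset.sum_const, nsmul_eq_mul]
          gcongr
  have hmain := hAcard.trans hfinal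
  rw [mul_left_comm] at hmain
  have hmain' := le_of_mul_le_mul_left hmain (by linarith)
  have hWy' : (W : ℝ) / y ≤ 1 / 2 := by
    rw [div_le_div_iff₀ (by exact_mod_cast hy) two_pos]
    exact_mod_cast (by lia : W * 2 ≤ 1 * y)
  have h1 : (W : ℝ) * (I.card / (D * y)) = I.card / D * (W / y) := by
    field_simp
  have h2 : (I.card : ℝ) / D * (W / y) ≤ I.card / D * (1 / 2) := by gcongr
  have h3 : (I.card : ℝ) / (2 * D) = I.card / D * (1 / 2) := by
    field_simp
  rw [h3] at hE
  rw [mul_add, h1] at hmain'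
  linarith

end

section

variable {p : ℕ} [Fact p.Prime]

theorem natCast_factorial_ne_zero {n : ℕ} (h : n < p) : ((n.factorial : ℕ) : ZMod p) ≠ 0 := by
  rw [Ne, ZMod.natCast_eq_zero_iff, (Fact.out : p.Prime).dvd_factorial]
  lia

theorem natCast_factorial_mul_shiftedFactorial (R : Type*) [CommRing R] (n k : ℕ) :
    (n.factorial : R) * shiftedFactorial (n : R) k = ((n + k).factorial : R) := by
  induction k with
  | zero => simp [shiftedFactorial]
  | succ k ih =>
    rw [← add_assoc, Nat.factorial_succ, Nat.cast_mul, ← ih, shiftedFactorial,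
      Finset.prod_Icc_succ_top (by lia), ← shiftedFactorial]
    push_cast
    ring

theorem shiftedFactorial_natCast_ne_zero {n k : ℕ} (h : n + k < p) :
    shiftedFactorial (n : ZMod p) k ≠ 0 := by
  have := natCast_factorial_ne_zero h
  rw [← natCast_factorial_mul_shiftedFactorial] at this
  exact right_ne_zero_of_mul this

theorem exists_natCast_notMem {N : ℕ} (hN : N < p) {Y : Finset (ZMod p)} (hY : Y.card < N) :
    ∃ n ∈ Finset.Icc 1 N, (n : ZMod p) ∉ Y := by
  by_contra! h
  have := Finset.card_le_card_of_injOn _ h (natCast_injOn_Icc hN)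
  rw [Nat.card_Icc, Nat.add_sub_cancel] at this
  lia

/-- Exceptional sets for the distribution of power residue classes modulo `D`-th powers. -/
theorem exists_card_le_forall_deviation_le {D K X : ℕ} {δ : ℝ} (hD : D ∣ p - 1)
    (h : ∀ a : ZMod p, a ^ D = 1 → (Finset.univ.filter fun x : ZMod p => shiftedFactorial x K ≠ 0 ∧
      δ < |(((Finset.Icc 1 K).filter fun k =>
        shiftedFactorial x k ^ ((p - 1) / D) = a).card : ℝ) - K / D|).card ≤ X) :
    ∃ Y : Finset (ZMod p), Y.card ≤ D * X ∧ ∀ x ∉ Y, shiftedFactorial x K ≠ 0 →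
      ∀ a : ZMod p, a ^ D = 1 → |(((Finset.Icc 1 K).filter fun k =>
        shiftedFactorial x k ^ ((p - 1) / D) = a).card : ℝ) - K / D| ≤ δ := by
  have hp := (Fact.out : p.Prime).one_lt
  have hD0 : 0 < D := Nat.pos_of_dvd_of_pos hD (by lia)
  refine ⟨(nthRootsFinset D (1 : ZMod p)).biUnion fun a =>
    Finset.univ.filter fun x : ZMod p => shiftedFactorial x K ≠ 0 ∧
      δ < |(((Finset.Icc 1 K).filter fun k =>
        shiftedFactorial x k ^ ((p - 1) / D) = a).card : ℝ) - K / D|, ?_, ?_⟩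
  · refine Finset.card_biUnion_le.trans ((Finset.sum_le_card_nsmul _ _ X fun a ha =>
      h a ((mem_nthRootsFinset hD0 _).mp ha)).trans_eq ?_)
    rw [card_nthRootsFinset_zmod hD, smul_eq_mul]
  · intro x hx h0 a ha
    by_contra! hlt
    exact hx (Finset.mem_biUnion.mpr ⟨a, (mem_nthRootsFinset hD0 _).mpr ha, by simpa using ⟨h0, hlt⟩⟩)

theorem exists_card_le_forall_add {Y : Finset (ZMod p)} (K : ℕ) :
    ∃ Y' : Finset (ZMod p), Y'.card ≤ K * Y.card ∧ ∀ x ∉ Y', ∀ k < K, x + (k + 1 : ℕ) ∉ Y := by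
  refine ⟨(Finset.range K).biUnion fun k => Y.image fun y => y - (k + 1 : ℕ), ?_, ?_⟩
  · refine Finset.card_biUnion_le.trans ((Finset.sum_le_card_nsmul _ _ Y.card fun k _ =>
      Finset.card_image_le).trans_eq ?_)
    simp
  · intro x hx k hk hY
    exact hx (Finset.mem_biUnion.mpr ⟨k, Finset.mem_range.mpr hk,
      Finset.mem_image.mpr ⟨_, hY, add_sub_cancel_right _ _⟩⟩)

/-- The sieve for factorials that are primitive roots, given bounds `X` and `Y` for the sizes of
the exceptional sets. -/
theorem exists_orderOf_factorial_eq {D y z s W n l N T X Y : ℕ}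
    (hD : D ∣ p - 1) (hsmall : ∀ q ∈ (p - 1).primeFactors, q ≤ y → q ∣ D)
    (hcop : ∀ q ∈ (p - 1).primeFactors, y < q → D.Coprime q)
    (hDz : D * z ≤ T) (hz : 0 < z)
    (hX : ∀ D' : ℕ, D' ∣ p - 1 → D' ≤ T → ∀ a : ZMod p, a ^ D' = 1 →
      (Finset.univ.filter fun x : ZMod p => shiftedFactorial x (n * l) ≠ 0 ∧
      (n : ℝ) < |(((Finset.Icc 1 (n * l)).filter fun k =>
        shiftedFactorial x k ^ ((p - 1) / D') = a).card : ℝ) - (n * l : ℕ) / D'|).card ≤ X)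
    (hY : ∀ q ∈ (p - 1).primeFactors, z < q → ∃ A : Finset (ZMod p), A.card ≤ Y ∧
      ∀ x ∉ A, shiftedFactorial x l ≠ 0 → ∀ S ∈ (Finset.Icc 1 l).powersetCard s,
        ∃ k ∈ S, shiftedFactorial x k ^ ((p - 1) / q) ≠ 1)
    (hy : 0 < y) (hW : ((p - 1).primeFactors.filter fun q => y < q).card ≤ W) (hWy : 2 * W ≤ y)
    (hyz : y ≤ z) (hE : (n : ℝ) * (1 + W * (1 + s)) < (n * l : ℕ) / (2 * D))
    (hN : (1 + W) * (T * X) + W * (n * l * Y) < N) (hNp : N + n * l + l < p) :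
    ∃ j, 0 < j ∧ j ≤ N + n * l ∧ orderOf ((j.factorial : ℕ) : ZMod p) = p - 1 := by
  classical
  have hp := (Fact.out : p.Prime).one_lt
  set Q := (p - 1).primeFactors.filter fun q => y < q with hQ
  have hdvd : ∀ q ∈ Q, D * q ∣ p - 1 := fun q hq =>
    (hcop q (Finset.mem_filter.mp hq).1 (Finset.mem_filter.mp hq).2).mul_dvd_of_dvd_of_dvd hD
      (Nat.dvd_of_mem_primeFactors (Finset.mem_filter.mp hq).1)
  have hDT : D ≤ T := (Nat.le_mul_of_pos_right _ hz).trans hDz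
  have hex : ∀ D' : ℕ, D' ∣ p - 1 → D' ≤ T → ∃ A : Finset (ZMod p), A.card ≤ T * X ∧
      ∀ x ∉ A, shiftedFactorial x (n * l) ≠ 0 → ∀ a : ZMod p, a ^ D' = 1 →
        |(((Finset.Icc 1 (n * l)).filter fun k =>
          shiftedFactorial x k ^ ((p - 1) / D') = a).card : ℝ) - (n * l : ℕ) / D'| ≤ n := by
    intro D' hD' hD'T
    obtain ⟨A, hA, hA'⟩ := exists_card_le_forall_deviation_le hD' (hX D' hD' hD'T)
    exact ⟨A, hA.trans (Nat.mul_le_mul_right _ hD'T), hA'⟩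
  obtain ⟨A₀, hA₀, hA₀'⟩ := hex D hD hDT
  have hmed : ∀ q, ∃ A : Finset (ZMod p), A.card ≤ T * X ∧ (q ∈ Q → q ≤ z →
      ∀ x ∉ A, shiftedFactorial x (n * l) ≠ 0 → ∀ a : ZMod p, a ^ (D * q) = 1 →
        |(((Finset.Icc 1 (n * l)).filter fun k =>
          shiftedFactorial x k ^ ((p - 1) / (D * q)) = a).card : ℝ) -
            (n * l : ℕ) / (D * q : ℕ)| ≤ n) := by
    intro q
    by_cases hq : q ∈ Q ∧ q ≤ z
    · obtain ⟨A, hA, hA'⟩ := hex (D * q) (hdvd q hq.1) ((Nat.mul_le_mul_left _ hq.2).trans hDz)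
      exact ⟨A, hA, fun _ _ => hA'⟩
    · exact ⟨∅, by simp, fun h1 h2 => absurd ⟨h1, h2⟩ hq⟩
  have hlarge : ∀ q, ∃ A : Finset (ZMod p), A.card ≤ n * l * Y ∧ (q ∈ Q → z < q →
      ∀ x ∉ A, ∀ k₀ < n * l, shiftedFactorial (x + (k₀ + 1 : ℕ)) l ≠ 0 →
        ∀ S ∈ (Finset.Icc 1 l).powersetCard s,
          ∃ k ∈ S, shiftedFactorial (x + (k₀ + 1 : ℕ)) k ^ ((p - 1) / q) ≠ 1) := by
    intro q
    by_cases hq : q ∈ Q ∧ z < q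
    · obtain ⟨A, hA, hA'⟩ := hY q (Finset.mem_filter.mp hq.1).1 hq.2
      obtain ⟨A', hA1, hA2⟩ := exists_card_le_forall_add (Y := A) (n * l)
      exact ⟨A', hA1.trans (Nat.mul_le_mul_left _ hA),
        fun _ _ x hx k₀ hk₀ => hA' _ (hA2 x hx k₀ hk₀)⟩
    · exact ⟨∅, by simp, fun h1 h2 => absurd ⟨h1, h2⟩ hq⟩
  choose A₁ hA₁ hA₁' using hmed
  choose A₂ hA₂ hA₂' using hlarge
  have hcard : (A₀ ∪ Q.biUnion A₁ ∪ Q.biUnion A₂).card < N := by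
    have h1 : (Q.biUnion A₁).card ≤ W * (T * X) :=
      Finset.card_biUnion_le.trans ((Finset.sum_le_card_nsmul _ _ _ fun q _ => hA₁ q).trans
        (Nat.mul_le_mul_right _ hW))
    have h2 : (Q.biUnion A₂).card ≤ W * (n * l * Y) :=
      Finset.card_biUnion_le.trans ((Finset.sum_le_card_nsmul _ _ _ fun q _ => hA₂ q).trans
        (Nat.mul_le_mul_right _ hW))
    have h3 := Finset.card_union_le (A₀ ∪ Q.biUnion A₁) (Q.biUnion A₂)
    have h4 := Finset.card_union_le A₀ (Q.biUnion A₁)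
    have h5 : (1 + W) * (T * X) = T * X + W * (T * X) := by ring
    lia
  obtain ⟨i, hi, hiA⟩ := exists_natCast_notMem (by lia) hcard
  simp only [Finset.mem_union, Finset.mem_biUnion, not_or, not_exists, not_and] at hiA
  obtain ⟨⟨hi0, hi1⟩, hi2⟩ := hiA
  obtain ⟨hi_pos, hiN⟩ := Finset.mem_Icc.mp hi
  have hne : shiftedFactorial (i : ZMod p) (n * l) ≠ 0 :=
    shiftedFactorial_natCast_ne_zero (by lia)
  have hcardI : (Finset.Icc 1 (n * l)).card = n * l := by simp
  obtain ⟨k, hk, hkq⟩ := exists_forall_pow_ne_one_of_deviation_le (D := D) (y := y) (z := z)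
    (s := s) (W := W) (I := Finset.Icc 1 (n * l)) (E := n)
    (u := fun k => shiftedFactorial (i : ZMod p) k)
    (natCast_factorial_ne_zero (by lia : i < p)) hD hsmall hcop
    (by rw [hcardI]; exact hA₀' _ hi0 hne)
    (by
      rw [hcardI]
      intro q hq hyq hqz
      have hqQ : q ∈ Q := Finset.mem_filter.mpr ⟨hq, hyq⟩
      exact hA₁' q hqQ hqz _ (hi1 q hqQ) hne)
    (by
      intro q hq hzq
      have hqQ : q ∈ Q := Finset.mem_filter.mpr ⟨hq, by lia⟩
      have := card_filter_mul_shiftedFactorial_pow_eq_one_le (b := (i.factorial : ZMod p)) n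
        fun k₀ hk₀ => hA₂' q hqQ hzq _ (hi2 q hqQ) k₀ hk₀ (by
          rw [← Nat.cast_add]
          exact shiftedFactorial_natCast_ne_zero (by lia))
      rw [mul_comm (s : ℝ)]
      exact_mod_cast this)
    hy hW hWy (by rw [hcardI]; exact hE)
  have hk' := Finset.mem_Icc.mp hk
  refine ⟨i + k, by lia, by lia, ?_⟩
  rw [← natCast_factorial_mul_shiftedFactorial]
  refine orderOf_eq_of_pow_and_pow_div_prime (by lia) ?_ fun q hq hqp =>
    hkq q (Nat.mem_primeFactors.mpr ⟨hq, hqp, by lia⟩)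
  rw [natCast_factorial_mul_shiftedFactorial]
  exact ZMod.pow_card_sub_one_eq_one (natCast_factorial_ne_zero (by lia))

end

section

theorem le_sub_one_div {p q x y : ℕ} (hq : 0 < q) (h : x * q + y * q ≤ p)
    (hy : 0 < y) : x ≤ (p - 1) / q := by
  rw [Nat.le_div_iff_mul_le hq]
  have : 0 < y * q := by positivity
  lia

variable {p : ℕ} [Fact p.Prime]

/-- Numerical form of `card_deviation_shiftedFactorial_le`. -/
theorem card_deviation_le_pow {m t c e g D : ℕ} (hm : 2 ≤ m) (ht : (5 * m) ^ (10 * m) ≤ t)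
    (ht' : 10 * m + 22 ≤ t) (hct : c ≤ t) (hp : t ^ (960 * m ^ 3) ≤ p)
    (hp' : p ≤ c * t ^ (960 * m ^ 3)) (he : e + 3 = 120 * m ^ 2)
    (hg : g + 16 * m + 4 = 480 * m ^ 3 + 480 * m ^ 2) (hD : D ∣ p - 1) (hDt : D ≤ t ^ (16 * m + 1))
    {a : ZMod p} (ha : a ^ D = 1) :
    (Finset.univ.filter fun x : ZMod p => shiftedFactorial x (t ^ e * t ^ 3) ≠ 0 ∧
      ((t ^ e : ℕ) : ℝ) < |(((Finset.Icc 1 (t ^ e * t ^ 3)).filter fun k =>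
        shiftedFactorial x k ^ ((p - 1) / D) = a).card : ℝ) - (t ^ e * t ^ 3 : ℕ) / D|).card ≤
      t ^ g := by
  have h2 : 2 * m ≤ m ^ 2 := by nlinarith
  have h3 : 2 * m ^ 2 ≤ m ^ 3 := by nlinarith [sq_nonneg m]
  have ht0 : 0 < t := by lia
  have hp1 := (Fact.out : p.Prime).one_lt
  have hD0 : 0 < D := Nat.pos_of_dvd_of_pos hD (by lia)
  have hK : t ^ e * t ^ 3 = t ^ (120 * m ^ 2) := by rw [← pow_add, he]
  rw [hK]
  have hpow : ∀ {i j : ℕ}, i ≤ j → t ^ i ≤ t ^ j := fun h => Nat.pow_le_pow_right ht0 h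
  have hmul : ∀ {i j k : ℕ}, k ≤ t → i + 1 ≤ j → k * t ^ i ≤ t ^ j := by
    intro i j k hk hij
    calc k * t ^ i ≤ t * t ^ i := Nat.mul_le_mul_right _ hk
      _ = t ^ (i + 1) := by ring
      _ ≤ t ^ j := hpow hij
  have hlow : ∀ {i k : ℕ}, k ≤ t → i + 1 ≤ 960 * m ^ 3 → k * t ^ i ≤ p := fun hk hi =>
    (hmul hk hi).trans hp
  have hDpow : D ^ (2 * (5 * m)) ≤ t ^ (160 * m ^ 2 + 10 * m) := by
    calc D ^ (2 * (5 * m)) ≤ (t ^ (16 * m + 1)) ^ (2 * (5 * m)) := Nat.pow_le_pow_left hDt _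
      _ = t ^ (160 * m ^ 2 + 10 * m) := by rw [← pow_mul]; ring_nf
  have h := card_deviation_shiftedFactorial_le (D := D) (c := c) (M := t ^ (480 * m ^ 3))
    (r := 5 * m) (K := t ^ (120 * m ^ 2)) (p := p) hD (Nat.one_le_pow _ _ ht0)
    (lt_of_lt_of_le (by
      have : t ^ (120 * m ^ 2) < t ^ (960 * m ^ 3) := Nat.pow_lt_pow_right (by lia) (by linarith)
      exact this) hp) ?_ ?_ ?_ ?_ ha (δ := ((t ^ e : ℕ) : ℝ)) (by positivity)
  · refine Nat.le_of_mul_le_mul_right ?_ (by positivity : 0 < (t ^ e) ^ (2 * (5 * m)))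
    suffices hnat : (5 * m) ^ (2 * (5 * m)) *
        (t ^ (120 * m ^ 2)) ^ (5 * m) * p + (t ^ (120 * m ^ 2)) ^ (2 * (5 * m)) *
        (D ^ (2 * (5 * m)) * (c * t ^ (480 * m ^ 3) * t ^ (120 * m ^ 2) * (2 * (5 * m) + 22 * D)) +
          t ^ (120 * m ^ 2)) ≤ t ^ g * (t ^ e) ^ (2 * (5 * m)) by
      rw [← Nat.cast_le (α := ℝ), Nat.cast_mul, Nat.cast_pow (t ^ e)]
      exact h.trans (by exact_mod_cast hnat)
    obtain ⟨f, hf⟩ : ∃ f, f + 30 * m = 1200 * m ^ 3 ∧ e * (2 * (5 * m)) = f := by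
      refine ⟨e * (2 * (5 * m)), ?_, rfl⟩
      calc e * (2 * (5 * m)) + 30 * m = 10 * m * (e + 3) := by ring
        _ = _ := by rw [he]; ring
    rw [← pow_mul t e, hf.2, ← pow_add]
    have hb1 : (5 * m) ^ (2 * (5 * m)) * (t ^ (120 * m ^ 2)) ^ (5 * m) * p ≤
        t ^ (1560 * m ^ 3 + 2) := by
      calc _ ≤ t * (t ^ (120 * m ^ 2)) ^ (5 * m) * (t * t ^ (960 * m ^ 3)) := by
            have : (5 * m) ^ (2 * (5 * m)) ≤ t := by rwa [show 2 * (5 * m) = 10 * m by ring]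
            have hpt : p ≤ t * t ^ (960 * m ^ 3) := hp'.trans (Nat.mul_le_mul_right _ hct)
            gcongr
        _ = t ^ (1560 * m ^ 3 + 2) := by rw [← pow_mul]; ring_nf
    have hb2 : 2 * (5 * m) + 22 * D ≤ t ^ (16 * m + 2) := by
      have : 1 ≤ t ^ (16 * m + 1) := Nat.one_le_pow _ _ ht0
      calc 2 * (5 * m) + 22 * D ≤ (10 * m + 22) * t ^ (16 * m + 1) := by nlinarith
        _ ≤ t * t ^ (16 * m + 1) := Nat.mul_le_mul_right _ ht'
        _ = _ := by ring
    have hb3 : (t ^ (120 * m ^ 2)) ^ (2 * (5 * m)) *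
        (D ^ (2 * (5 * m)) * (c * t ^ (480 * m ^ 3) * t ^ (120 * m ^ 2) * (2 * (5 * m) + 22 * D)) +
          t ^ (120 * m ^ 2)) ≤
        t ^ (1680 * m ^ 3 + 280 * m ^ 2 + 26 * m + 3) + t ^ (1200 * m ^ 3 + 120 * m ^ 2) := by
      calc _ ≤ (t ^ (120 * m ^ 2)) ^ (2 * (5 * m)) * (t ^ (160 * m ^ 2 + 10 * m) *
            (t * t ^ (480 * m ^ 3) * t ^ (120 * m ^ 2) * t ^ (16 * m + 2)) +
              t ^ (120 * m ^ 2)) := by gcongr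
        _ = _ := by rw [← pow_mul]; ring_nf
    obtain ⟨G, hG⟩ : ∃ G, g + f = G + 1 := ⟨g + f - 1, by lia⟩
    have hc1 : t ^ (1560 * m ^ 3 + 2) ≤ t ^ G := hpow (by linarith)
    have hc2 : t ^ (1680 * m ^ 3 + 280 * m ^ 2 + 26 * m + 3) ≤ t ^ G := hpow (by linarith)
    have hc3 : t ^ (1200 * m ^ 3 + 120 * m ^ 2) ≤ t ^ G := hpow (by linarith)
    calc _ ≤ 3 * t ^ G := by linarith
      _ ≤ t ^ (g + f) := by rw [hG]; exact hmul (by lia) le_rfl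
  · refine le_sub_one_div hD0 (y := 1) ?_ one_pos
    have h1 : 1 ≤ t ^ (120 * m ^ 2) := Nat.one_le_pow _ _ ht0
    have h4 : 1 ≤ (D ^ (2 * (5 * m))) ^ 2 := Nat.one_le_pow _ _ (by positivity)
    calc 4 * (D ^ (2 * (5 * m))) ^ 2 * (t ^ (120 * m ^ 2) + 1) * D + 1 * D
        ≤ 4 * (D ^ (2 * (5 * m))) ^ 2 * (t ^ (120 * m ^ 2) + t ^ (120 * m ^ 2)) * D +
          ((D ^ (2 * (5 * m))) ^ 2 * t ^ (120 * m ^ 2)) * D := by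
          gcongr
          exact Nat.mul_pos h4 h1
      _ = 9 * ((D ^ (2 * (5 * m))) ^ 2 * t ^ (120 * m ^ 2) * D) := by ring
      _ ≤ 9 * ((t ^ (160 * m ^ 2 + 10 * m)) ^ 2 * t ^ (120 * m ^ 2) * t ^ (16 * m + 1)) := by
          gcongr
      _ = 9 * t ^ (440 * m ^ 2 + 36 * m + 1) := by rw [← pow_mul]; ring_nf
      _ ≤ p := hlow (by lia) (by linarith)
  · refine le_sub_one_div hD0 (y := 1) ?_ one_pos
    have h1 : 1 ≤ t ^ (480 * m ^ 3) := Nat.one_le_pow _ _ ht0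
    calc 4 * t ^ (480 * m ^ 3) * D + 1 * D ≤ 4 * t ^ (480 * m ^ 3) * D + t ^ (480 * m ^ 3) * D := by
          gcongr
      _ = 5 * (t ^ (480 * m ^ 3) * D) := by ring
      _ ≤ 5 * (t ^ (480 * m ^ 3) * t ^ (16 * m + 1)) := by gcongr
      _ = 5 * t ^ (480 * m ^ 3 + 16 * m + 1) := by ring
      _ ≤ p := hlow (by lia) (by linarith)
  · rw [← pow_mul]
    exact (hpow (by linarith)).trans hp
  · rw [← pow_mul, show 480 * m ^ 3 * 2 = 960 * m ^ 3 by ring]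
    exact hp'

end

section

variable {p : ℕ} [Fact p.Prime]

/-- Numerical form of `exists_card_le_forall_subset_shiftedFactorial_pow_ne_one`. -/
theorem exists_card_le_pow_forall_subset_shiftedFactorial_pow_ne_one {m t c s q : ℕ} (hm : 2 ≤ m)
    (ht : 30 * m ^ 2 + 44 ≤ t) (hct : c ≤ t) (hp : t ^ (960 * m ^ 3) ≤ p)
    (hp' : p ≤ c * t ^ (960 * m ^ 3)) (hs : s + 1 = 30 * m ^ 2) (hq : q ∣ p - 1)
    (htq : t ^ (16 * m) ≤ q) :
    ∃ Y : Finset (ZMod p), Y.card ≤ t ^ (480 * m ^ 3 + 90 * m ^ 2 + 16 * m + 3) ∧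
      ∀ y ∉ Y, shiftedFactorial y (t ^ 3) ≠ 0 → ∀ S ∈ (Finset.Icc 1 (t ^ 3)).powersetCard s,
        ∃ k ∈ S, shiftedFactorial y k ^ ((p - 1) / q) ≠ 1 := by
  have h2 : 2 * m ≤ m ^ 2 := by nlinarith
  have h3 : 2 * m ^ 2 ≤ m ^ 3 := by nlinarith [sq_nonneg m]
  have ht0 : 0 < t := by lia
  have hp1 := (Fact.out : p.Prime).one_lt
  have hpow : ∀ {i j : ℕ}, i ≤ j → t ^ i ≤ t ^ j := fun h => Nat.pow_le_pow_right ht0 h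
  have hlow : ∀ {i k : ℕ}, k ≤ t → i + 1 ≤ 960 * m ^ 3 → k * t ^ i ≤ p := by
    intro i k hk hi
    calc k * t ^ i ≤ t * t ^ i := Nat.mul_le_mul_right _ hk
      _ = t ^ (i + 1) := by ring
      _ ≤ p := (hpow hi).trans hp
  obtain ⟨f, hf, hfs⟩ : ∃ f, f + 16 * m = 480 * m ^ 3 ∧ 16 * m * s = f := by
    refine ⟨16 * m * s, ?_, rfl⟩
    calc 16 * m * s + 16 * m = 16 * m * (s + 1) := by ring
      _ = _ := by rw [hs]; ring
  have hB : 0 < t ^ (16 * m) := by positivity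
  have hBs : (t ^ (16 * m)) ^ s = t ^ f := by rw [← pow_mul, hfs]
  set B := t ^ (16 * m) with hBdef
  set R := (p - 1) / q * (q / B) with hR
  have hRp : p - 1 ≤ R * (2 * B) := by
    have h1 : q ≤ q / B * (2 * B) := by
      have h4 := Nat.lt_div_mul_add (a := q) hB
      have h5 : 1 * B ≤ q / B * B := Nat.mul_le_mul_right _ (Nat.div_pos htq hB)
      linarith
    calc p - 1 = (p - 1) / q * q := (Nat.div_mul_cancel hq).symm
      _ ≤ (p - 1) / q * (q / B * (2 * B)) := Nat.mul_le_mul_left _ h1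
      _ = R * (2 * B) := by rw [hR]; ring
  have hle : ∀ {x : ℕ}, 0 < x → 3 * (x * B) ≤ p → x ≤ R := by
    intro x hx h
    have h1 : 0 < x * B := by positivity
    refine Nat.le_of_mul_le_mul_right (?_ : x * (2 * B) ≤ R * (2 * B)) (by positivity)
    have h4 : x * (2 * B) = 2 * (x * B) := by ring
    lia
  have ht3 : 1 ≤ t ^ 3 := Nat.one_le_pow _ _ ht0
  have h := exists_card_le_forall_subset_shiftedFactorial_pow_ne_one (p := p)
    (q := q) (τ := q / B) (B := B) (c := c) (V := 4 * B) (M := t ^ (480 * m ^ 3)) (l := t ^ 3)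
    (s := s) (Nat.mul_div_le q B) hB ht3 ?_ ?_ ?_ ?_ ?_ ?_
  · obtain ⟨Y, hY, hY'⟩ := h
    refine ⟨Y, ?_, hY'⟩
    rw [← Nat.cast_le (α := ℝ)]
    refine hY.trans ?_
    have h1 : (p : ℝ) / (B : ℝ) ^ s ≤ (t ^ (480 * m ^ 3 + 16 * m + 1) : ℕ) := by
      rw [div_le_iff₀ (by positivity)]
      have : p ≤ t ^ (480 * m ^ 3 + 16 * m + 1) * B ^ s := by
        calc p ≤ t * t ^ (960 * m ^ 3) := hp'.trans (Nat.mul_le_mul_right _ hct)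
          _ = t ^ (480 * m ^ 3 + 16 * m + 1) * B ^ s := by
            rw [hBs, ← pow_add, ← pow_succ']
            congr 1
            linarith
      exact_mod_cast this
    have hnat : (t ^ 3) ^ s * (t ^ (480 * m ^ 3 + 16 * m + 1) +
        c * t ^ (480 * m ^ 3) * t ^ 3 * (s + 11 * (4 * B))) ≤
        t ^ (480 * m ^ 3 + 90 * m ^ 2 + 16 * m + 3) := by
      have h4 : s + 11 * (4 * B) ≤ t * B := by
        calc s + 11 * (4 * B) ≤ (s + 44) * B := by nlinarith
          _ ≤ t * B := Nat.mul_le_mul_right _ (by lia)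
      have h5 : t ^ (480 * m ^ 3 + 16 * m + 1) ≤ t ^ (480 * m ^ 3 + 16 * m + 5) := hpow (by lia)
      calc _ ≤ (t ^ 3) ^ s * (t ^ (480 * m ^ 3 + 16 * m + 5) +
            t * t ^ (480 * m ^ 3) * t ^ 3 * (t * B)) := by gcongr
        _ = 2 * ((t ^ 3) ^ s * t ^ (480 * m ^ 3 + 16 * m + 5)) := by rw [hBdef]; ring
        _ ≤ t * ((t ^ 3) ^ s * t ^ (480 * m ^ 3 + 16 * m + 5)) :=
          Nat.mul_le_mul_right _ (by lia)
        _ = t ^ (480 * m ^ 3 + 90 * m ^ 2 + 16 * m + 3) := by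
          rw [← pow_mul, ← pow_add, ← pow_succ']
          congr 1
          linarith
    calc _ ≤ ((t ^ 3 : ℕ) : ℝ) ^ s * ((t ^ (480 * m ^ 3 + 16 * m + 1) : ℕ) +
        c * (t ^ (480 * m ^ 3) : ℕ) * (t ^ 3 : ℕ) * (s + 11 * (4 * B : ℕ))) := by gcongr
      _ ≤ _ := by exact_mod_cast hnat
  · exact lt_of_lt_of_le (Nat.pow_lt_pow_right (by lia) (by linarith)) hp
  · refine hle (by positivity) ?_
    calc 3 * (4 * (B ^ s) ^ 2 * (t ^ 3 + 1) * B) ≤ 3 * (4 * (B ^ s) ^ 2 * (t ^ 3 + t ^ 3) * B) := by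
          gcongr
      _ = 24 * t ^ (2 * f + 16 * m + 3) := by rw [hBs, hBdef]; ring
      _ ≤ p := hlow (by lia) (by linarith)
  · refine hle (by positivity) ?_
    calc 3 * (4 * t ^ (480 * m ^ 3) * B) = 12 * t ^ (480 * m ^ 3 + 16 * m) := by rw [hBdef]; ring
      _ ≤ p := hlow (by lia) (by linarith)
  · rw [← pow_mul]
    exact (hpow (by linarith)).trans hp
  · rw [← pow_mul, show 480 * m ^ 3 * 2 = 960 * m ^ 3 by ring]
    exact hp'
  · change p ≤ 4 * B * R
    have h1 : 4 * B * R = 2 * (R * (2 * B)) := by ring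
    lia

end

section

/-- The product of the prime factors of `n` that are at most `y`. -/
def smoothRadical (n y : ℕ) : ℕ := ∏ q ∈ n.primeFactors with q ≤ y, q

theorem smoothRadical_dvd (n y : ℕ) : smoothRadical n y ∣ n :=
  (Finset.prod_dvd_prod_of_subset _ _ _ (Finset.filter_subset _ _)).trans
    (Nat.prod_primeFactors_dvd n)

theorem smoothRadical_le_four_pow (n y : ℕ) : smoothRadical n y ≤ 4 ^ y := by
  refine le_trans ?_ (primorial_le_four_pow y)
  refine Nat.le_of_dvd (primorial_pos y) (Finset.prod_dvd_prod_of_subset _ _ _ fun q hq => ?_)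
  rw [Finset.mem_filter] at hq
  simp [hq.2, Nat.prime_of_mem_primeFactors hq.1]

theorem dvd_smoothRadical {n y q : ℕ} (hq : q ∈ n.primeFactors) (hqy : q ≤ y) :
    q ∣ smoothRadical n y :=
  Finset.dvd_prod_of_mem (fun q => q) (Finset.mem_filter.mpr ⟨hq, hqy⟩)

theorem coprime_smoothRadical {n y q : ℕ} (hq : q ∈ n.primeFactors) (hqy : y < q) :
    (smoothRadical n y).Coprime q := by
  refine Nat.Coprime.prod_left fun r hr => ?_
  rw [Finset.mem_filter] at hr
  exact (Nat.coprime_primes (Nat.prime_of_mem_primeFactors hr.1)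
    (Nat.prime_of_mem_primeFactors hq)).mpr (by lia)

theorem pow_card_primeFactors_lt_le {n y : ℕ} (hn : n ≠ 0) :
    y ^ (n.primeFactors.filter fun q => y < q).card ≤ n := by
  calc y ^ (n.primeFactors.filter fun q => y < q).card
      ≤ ∏ q ∈ n.primeFactors with y < q, q :=
        Finset.pow_card_le_prod _ _ _ fun q hq => (Finset.mem_filter.mp hq).2.le
    _ ≤ n := Nat.le_of_dvd (Nat.pos_of_ne_zero hn)
        ((Finset.prod_dvd_prod_of_subset _ _ _ (Finset.filter_subset _ _)).trans
          (Nat.prod_primeFactors_dvd n))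

theorem two_mul_card_primeFactors_log_lt_le {n t L : ℕ} (hn : n ≠ 0) (hL : 0 < L)
    (ht : 4 ^ 4 ^ (4 * L) ≤ t) (hnt : n < (2 * t) ^ L) :
    2 * (n.primeFactors.filter fun q => Nat.log 4 t < q).card ≤ Nat.log 4 t := by
  have ht0 : t ≠ 0 := by
    have : 0 < 4 ^ 4 ^ (4 * L) := by positivity
    lia
  set y := Nat.log 4 t with hy
  set W := (n.primeFactors.filter fun q => y < q).card
  have hyL : 4 ^ (4 * L) ≤ y := (Nat.le_log_iff_pow_le (by norm_num) ht0).mpr ht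
  have hty : 2 * t ≤ 4 ^ (y + 2) := by
    have := Nat.lt_pow_succ_log_self (b := 4) (by norm_num) t
    rw [← hy] at this
    rw [pow_succ]
    lia
  have h : 4 ^ (4 * L * W) < 4 ^ ((y + 2) * L) := by
    calc 4 ^ (4 * L * W) = (4 ^ (4 * L)) ^ W := pow_mul _ _ _
      _ ≤ y ^ W := Nat.pow_le_pow_left hyL _
      _ ≤ n := pow_card_primeFactors_lt_le hn
      _ < (2 * t) ^ L := hnt
      _ ≤ (4 ^ (y + 2)) ^ L := Nat.pow_le_pow_left hty _
      _ = 4 ^ ((y + 2) * L) := (pow_mul _ _ _).symm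
  have h1 : 4 * L * W < (y + 2) * L := (Nat.pow_lt_pow_iff_right (by norm_num)).mp h
  have h2 : 4 * W < y + 2 := by
    refine Nat.lt_of_mul_lt_mul_right (a := L) ?_
    calc 4 * W * L = 4 * L * W := by ring
      _ < _ := h1
  have h4 : 4 ≤ y := le_trans (Nat.le_self_pow (by lia) 4) hyL
  lia

end

section

variable {p : ℕ} [Fact p.Prime]

theorem exists_le_pow_orderOf_factorial_eq {m t c : ℕ} (hm : 2 ≤ m)
    (ht1 : (5 * m) ^ (10 * m) ≤ t) (ht2 : 60 * m ^ 2 + 44 ≤ t)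
    (ht3 : 4 ^ 4 ^ (4 * (960 * m ^ 3)) ≤ t) (hct : c ≤ t) (hp : t ^ (960 * m ^ 3) ≤ p)
    (hp' : p ≤ c * t ^ (960 * m ^ 3)) (hpt : p ≤ (2 * t) ^ (960 * m ^ 3)) :
    ∃ j, 0 < j ∧ j ≤ 2 * t ^ (480 * m ^ 3 + 480 * m ^ 2) ∧
      orderOf ((j.factorial : ℕ) : ZMod p) = p - 1 := by
  have h2 : 2 * m ≤ m ^ 2 := by nlinarith
  have h3 : 2 * m ^ 2 ≤ m ^ 3 := by nlinarith [sq_nonneg m]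
  have ht0 : 0 < t := by lia
  have hp1 := (Fact.out : p.Prime).one_lt
  have hpow : ∀ {i j : ℕ}, i ≤ j → t ^ i ≤ t ^ j := fun h => Nat.pow_le_pow_right ht0 h
  obtain ⟨e, he⟩ : ∃ e, e + 3 = 120 * m ^ 2 := ⟨120 * m ^ 2 - 3, by lia⟩
  obtain ⟨s, hs⟩ : ∃ s, s + 1 = 30 * m ^ 2 := ⟨30 * m ^ 2 - 1, by lia⟩
  obtain ⟨g, hg⟩ : ∃ g, g + 16 * m + 4 = 480 * m ^ 3 + 480 * m ^ 2 :=
    ⟨480 * m ^ 3 + 480 * m ^ 2 - 16 * m - 4, by lia⟩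
  have hK : t ^ e * t ^ 3 = t ^ (120 * m ^ 2) := by rw [← pow_add, he]
  set y := Nat.log 4 t with hy
  have hyt : y < t := Nat.log_lt_self _ ht0.ne'
  have hy0 : 0 < y := lt_of_lt_of_le (by positivity)
    ((Nat.le_log_iff_pow_le (by norm_num) ht0.ne').mpr ht3)
  have hDt : smoothRadical (p - 1) y ≤ t :=
    (smoothRadical_le_four_pow _ _).trans (Nat.pow_log_le_self 4 ht0.ne')
  have hW := two_mul_card_primeFactors_log_lt_le (n := p - 1) (by lia)
    (by positivity : 0 < 960 * m ^ 3) ht3 (by lia)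
  rw [← hy] at hW
  set W := ((p - 1).primeFactors.filter fun q => y < q).card with hWdef
  have hD0 : 0 < smoothRadical (p - 1) y :=
    Nat.pos_of_dvd_of_pos (smoothRadical_dvd _ _) (by lia)
  set A := t ^ (480 * m ^ 3 + 480 * m ^ 2 - 2) with hA
  have hAt : A * t ^ 2 = t ^ (480 * m ^ 3 + 480 * m ^ 2) := by
    rw [hA, ← pow_add]
    congr 1
    lia
  have hA0 : 0 < A := by positivity
  have hA4 : 4 * A ≤ A * t ^ 2 := by
    rw [mul_comm]
    exact Nat.mul_le_mul_left _ (le_trans (by lia) (Nat.le_self_pow two_ne_zero t))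
  have hKA : t ^ (120 * m ^ 2) ≤ A := hpow (by lia)
  have h3A : t ^ 3 ≤ A := hpow (by lia)
  have h := exists_orderOf_factorial_eq (p := p)
    (D := smoothRadical (p - 1) y) (y := y) (z := t ^ (16 * m)) (s := s) (W := W) (n := t ^ e)
    (l := t ^ 3) (N := t ^ (480 * m ^ 3 + 480 * m ^ 2)) (T := t ^ (16 * m + 1)) (X := t ^ g)
    (Y := t ^ (480 * m ^ 3 + 90 * m ^ 2 + 16 * m + 3)) (smoothRadical_dvd _ _)
    (fun q hq hqy => dvd_smoothRadical hq hqy) (fun q hq hqy => coprime_smoothRadical hq hqy)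
    (by rw [pow_succ']; exact Nat.mul_le_mul_right _ hDt) (by positivity)
    (fun D' hD' hDT a ha => card_deviation_le_pow hm ht1 (by lia) hct hp hp' he hg hD' hDT ha)
    (fun q hq hqz => exists_card_le_pow_forall_subset_shiftedFactorial_pow_ne_one hm
      (by lia) hct hp hp' hs (Nat.dvd_of_mem_primeFactors hq) hqz.le)
    hy0 le_rfl hW (hyt.le.trans (Nat.le_self_pow (by lia) t)) ?_ ?_ ?_
  · obtain ⟨j, hj0, hj, hjo⟩ := h
    refine ⟨j, hj0, hj.trans ?_, hjo⟩
    rw [hK, two_mul]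
    gcongr; lia
  · have hnat : t ^ e * (1 + W * (1 + s)) * (2 * smoothRadical (p - 1) y) < t ^ e * t ^ 3 := by
      rw [mul_assoc]
      refine Nat.mul_lt_mul_of_pos_left ?_ (by positivity)
      calc (1 + W * (1 + s)) * (2 * smoothRadical (p - 1) y)
          ≤ (t + t * (30 * m ^ 2)) * (2 * t) := by
            gcongr <;> lia
        _ = (60 * m ^ 2 + 2) * t ^ 2 := by ring
        _ < t * t ^ 2 := Nat.mul_lt_mul_of_pos_right (by lia) (by positivity)
        _ = t ^ 3 := by ring
    rw [lt_div_iff₀ (by positivity)]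
    exact_mod_cast hnat
  · have hX : (1 + W) * (t ^ (16 * m + 1) * t ^ g) ≤ A := by
      calc (1 + W) * (t ^ (16 * m + 1) * t ^ g) ≤ t * (t ^ (16 * m + 1) * t ^ g) :=
            Nat.mul_le_mul_right _ (by lia)
        _ = t ^ (g + 16 * m + 2) := by ring
        _ ≤ A := hpow (by lia)
    have hY : W * (t ^ e * t ^ 3 * t ^ (480 * m ^ 3 + 90 * m ^ 2 + 16 * m + 3)) ≤ A := by
      calc _ ≤ t * (t ^ e * t ^ 3 * t ^ (480 * m ^ 3 + 90 * m ^ 2 + 16 * m + 3)) :=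
            Nat.mul_le_mul_right _ (by lia)
        _ = t ^ (480 * m ^ 3 + 210 * m ^ 2 + 16 * m + 4) := by rw [hK]; ring
        _ ≤ A := hpow (by lia)
    calc _ ≤ A + A := Nat.add_le_add hX hY
      _ < A * t ^ 2 := by lia
      _ = _ := hAt
  · calc _ ≤ A * t ^ 2 + A + A := by rw [hK, hAt]; gcongr
      _ < 4 * (A * t ^ 2) := by lia
      _ ≤ t * (A * t ^ 2) := Nat.mul_le_mul_right _ (by lia)
      _ = t ^ (480 * m ^ 3 + 480 * m ^ 2 + 1) := by rw [hAt]; ring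
      _ ≤ p := (hpow (by lia)).trans hp

end

end

/-- For every `ε > 0` there are a constant `C > 0` and a threshold `p₀` such
that for every prime `p ≥ p₀` there is a positive integer `n ≤ C p^{1/2+ε}`
with `n!` a primitive root modulo `p`. -/
theorem exists_small_factorial_primitive_root (ε : ℝ) (hε : 0 < ε) :
    ∃ C : ℝ, 0 < C ∧ ∃ p₀ : ℕ, ∀ p : ℕ, p.Prime → p₀ ≤ p →
      ∃ n : ℕ, 0 < n ∧ (n : ℝ) ≤ C * (p : ℝ) ^ ((1 : ℝ) / 2 + ε) ∧
        orderOf ((n.factorial : ZMod p)) = p - 1 := by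
  obtain ⟨m, hm⟩ := exists_nat_ge (max 2 (1 / (2 * ε)))
  have hm2 : 2 ≤ m := by exact_mod_cast (le_max_left _ _).trans hm
  have hmε : 1 / 2 ≤ ε * m := by
    have := (le_max_right _ _).trans hm
    rw [div_le_iff₀ (by positivity)] at this
    linarith
  set L := 960 * m ^ 3 with hL
  have hL0 : L ≠ 0 := by positivity
  set T := (5 * m) ^ (10 * m) + (60 * m ^ 2 + 44) + 4 ^ 4 ^ (4 * L) + 2 ^ L with hT
  refine ⟨2, two_pos, T ^ L, fun p hp hTp => ?_⟩
  have : Fact p.Prime := ⟨hp⟩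
  set t := Nat.findGreatest (fun t => t ^ L ≤ p) p with ht
  have hTt : T ≤ t := Nat.le_findGreatest ((Nat.le_self_pow hL0 T).trans hTp) hTp
  have htp : t ^ L ≤ p := by
    refine Nat.findGreatest_spec (P := fun t => t ^ L ≤ p) (m := 1) hp.one_le ?_
    simpa using hp.one_le
  have hpt : p ≤ (2 * t) ^ L := by
    by_contra! h
    have h1 : 2 * t ≤ t :=
      Nat.le_findGreatest (P := fun t => t ^ L ≤ p) ((Nat.le_self_pow hL0 _).trans h.le) h.le
    lia
  obtain ⟨j, hj0, hj, hjo⟩ := exists_le_pow_orderOf_factorial_eq (p := p) (t := t) (c := 2 ^ L)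
    hm2 (by lia) (by lia) (by lia) (by lia) htp (by rwa [← mul_pow]) hpt
  refine ⟨j, hj0, ?_, hjo⟩
  have ht1 : (1 : ℝ) ≤ t := by
    exact_mod_cast (by lia : 1 ≤ t)
  calc (j : ℝ) ≤ 2 * (t : ℝ) ^ (480 * m ^ 3 + 480 * m ^ 2) := by exact_mod_cast hj
    _ ≤ 2 * (t : ℝ) ^ ((L : ℝ) * (1 / 2 + ε)) := by
      rw [← Real.rpow_natCast]
      gcongr
      rw [hL]
      push_cast
      nlinarith [mul_le_mul_of_nonneg_left hmε (by positivity : (0 : ℝ) ≤ 960 * m ^ 2)]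
    _ = 2 * ((t : ℝ) ^ L) ^ ((1 : ℝ) / 2 + ε) := by
      rw [Real.rpow_mul (by positivity), Real.rpow_natCast]
    _ ≤ 2 * (p : ℝ) ^ ((1 : ℝ) / 2 + ε) := by
      gcongr
      exact_mod_cast htp
end

section
/- For every fixed integer d ≥ 0 there exists a constant C = C(d) > 0 such that for every odd prime p, every polynomial f over F_p of degree d, and all integers H, N with 0 ≤ H < H + N < p, one has ∑_{χ} |∑_{n=H+1}^{H+N} χ(n! mod p) · e_p(f(n))|² ≤ C · p · N^{3/2}, where the outer sum runs over all multiplicative characters χ modulo p. -/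
open Finset in
/-- The second moment over all multiplicative characters of a character sum with coefficients of
norm at most one is controlled by the number of coincidences among its arguments. -/
theorem sum_mulChar_norm_sq_le {p : ℕ} [Fact p.Prime] {ι : Type*} (s : Finset ι)
    (x : ι → ZMod p) (hx : ∀ i ∈ s, x i ≠ 0) (c : ι → ℂ) (hc : ∀ i ∈ s, ‖c i‖ ≤ 1) :
    ∑ χ : MulChar (ZMod p) ℂ, ‖∑ i ∈ s, χ (x i) * c i‖ ^ 2 ≤
      p * #{q ∈ s ×ˢ s | x q.1 = x q.2} := by
  have key : ((∑ χ : MulChar (ZMod p) ℂ, ‖∑ i ∈ s, χ (x i) * c i‖ ^ 2 : ℝ) : ℂ) =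
      ∑ q ∈ s ×ˢ s, star (c q.1) * c q.2 *
        (if x q.1 = x q.2 then (p.totient : ℂ) else 0) := by
    have orth : ∀ q ∈ s ×ˢ s, (if x q.1 = x q.2 then (p.totient : ℂ) else 0) =
        ∑ χ : MulChar (ZMod p) ℂ, χ (x q.1)⁻¹ * χ (x q.2) := fun q hq ↦ by
      rw [← DirichletCharacter.sum_char_inv_mul_char_eq ℂ
        (isUnit_iff_ne_zero.mpr (hx q.1 (mem_product.mp hq).1))]
    have expand : ∀ q ∈ s ×ˢ s, star (c q.1) * c q.2 *
        (if x q.1 = x q.2 then (p.totient : ℂ) else 0) =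
        ∑ χ : MulChar (ZMod p) ℂ, star (c q.1) * c q.2 * (χ (x q.1)⁻¹ * χ (x q.2)) :=
      fun q hq ↦ by rw [orth q hq, mul_sum]
    rw [sum_congr rfl expand, sum_comm]
    push_cast
    refine sum_congr rfl fun χ _ ↦ ?_
    rw [← Complex.conj_mul', map_sum, sum_mul_sum, ← sum_product']
    refine sum_congr rfl fun q _ ↦ ?_
    rw [map_mul, ← RCLike.star_def, MulChar.star_apply', MulChar.inv_apply']
    ring
  have hnonneg : 0 ≤ ∑ χ : MulChar (ZMod p) ℂ, ‖∑ i ∈ s, χ (x i) * c i‖ ^ 2 :=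
    sum_nonneg fun _ _ ↦ by positivity
  rw [← Complex.norm_of_nonneg hnonneg, key, card_filter, Nat.cast_sum, mul_sum]
  refine norm_sum_le_of_le _ fun q hq ↦ ?_
  obtain ⟨h₁, h₂⟩ := mem_product.mp hq
  split_ifs
  · rw [norm_mul, norm_mul, norm_star, Complex.norm_natCast]
    have := mul_le_one₀ (hc _ h₁) (norm_nonneg _) (hc _ h₂)
    have hp : (p.totient : ℝ) ≤ p := by exact_mod_cast Nat.totient_le p
    push_cast
    nlinarith [Nat.cast_nonneg (α := ℝ) p.totient]
  · simp

theorem factorial_natCast_ne_zero {p n : ℕ} [Fact p.Prime] (hn : n < p) :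
    (n.factorial : ZMod p) ≠ 0 := by
  rw [Ne, ZMod.natCast_eq_zero_iff, (Fact.out : p.Prime).dvd_factorial]
  exact not_le.mpr hn

open Finset in
/-- For `0 < k`, the congruence `m! ≡ (m + k)!` has at most `k` solutions below `p`. -/
theorem card_factorial_eq_factorial_add_le {p : ℕ} [Fact p.Prime] {k : ℕ} (hk : 0 < k)
    (s : Finset ℕ) (hs : ∀ m ∈ s, m < p) :
    #{m ∈ s | (m.factorial : ZMod p) = (m + k).factorial} ≤ k := by
  let P : Polynomial (ZMod p) := ascPochhammer (ZMod p) k - 1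
  have hdeg : P.natDegree = k := by
    rw [Polynomial.natDegree_sub_eq_left_of_natDegree_lt] <;>
      simp [ascPochhammer_natDegree, hk]
  have hP : P ≠ 0 := fun h ↦ by simp [h] at hdeg; omega
  have hcard : #P.roots.toFinset ≤ k :=
    (Multiset.toFinset_card_le _).trans ((Polynomial.card_roots' P).trans hdeg.le)
  refine le_trans (card_le_card_of_injOn (fun m : ℕ ↦ (m : ZMod p) + 1) ?_ ?_) hcard
  · intro m hm
    obtain ⟨hm, h⟩ := mem_filter.mp hm
    have h0 := factorial_natCast_ne_zero (hs m hm)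
    rw [← Nat.factorial_mul_ascFactorial, Nat.cast_mul, Nat.cast_ascFactorial] at h
    simpa [P, hP, sub_eq_zero] using (mul_eq_left₀ h0).mp h.symm
  · intro m hm n hn h
    have h' := (ZMod.natCast_eq_natCast_iff' m n p).mp (add_right_cancel h)
    rwa [Nat.mod_eq_of_lt (hs m (mem_filter.mp hm).1),
      Nat.mod_eq_of_lt (hs n (mem_filter.mp hn).1)] at h'

open Finset in
/-- Pairs of distinct integers below `p` at distance less than `K` with congruent factorials. -/
theorem card_close_factorial_eq_le {p : ℕ} [Fact p.Prime] (K : ℕ)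
    (s : Finset ℕ) (hs : ∀ m ∈ s, m < p) :
    #{q ∈ s ×ˢ s | (q.1.factorial : ZMod p) = q.2.factorial ∧ q.1 < q.2 ∧ q.2 < q.1 + K} ≤
      K ^ 2 := by
  have hmaps : ∀ q ∈ ({q ∈ s ×ˢ s | (q.1.factorial : ZMod p) = q.2.factorial ∧
      q.1 < q.2 ∧ q.2 < q.1 + K} : Finset (ℕ × ℕ)), q.2 - q.1 ∈ range K := fun q hq ↦ by
    simp only [mem_filter, mem_range] at hq ⊢
    omega
  rw [card_eq_sum_card_fiberwise hmaps, sq]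
  refine (sum_le_card_nsmul _ _ K fun k hk ↦ ?_).trans (by simp)
  rcases Nat.eq_zero_or_pos k with rfl | hk0
  · rw [filter_eq_empty_iff.mpr]
    · simp
    · intro q hq
      simp only [mem_filter] at hq
      omega
  refine le_trans (card_le_card_of_injOn Prod.fst ?_ ?_)
    ((card_factorial_eq_factorial_add_le hk0 s hs).trans (mem_range.mp hk).le)
  · intro q hq
    simp only [coe_filter, mem_filter, mem_product, Set.mem_ofPred_eq] at hq ⊢
    obtain ⟨⟨⟨h₁, h₂⟩, h, hlt, -⟩, rfl⟩ := hq
    exact ⟨h₁, by rw [h]; congr 2; omega⟩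
  · intro q hq r hr h
    simp only [coe_filter, mem_filter, Set.mem_ofPred_eq] at hq hr
    exact Prod.ext h (by omega)

open Finset in
/-- Pairs with congruent factorials at distance less than `K`. -/
theorem card_near_factorial_eq_le {p : ℕ} [Fact p.Prime] (K : ℕ)
    (s : Finset ℕ) (hs : ∀ m ∈ s, m < p) :
    #{q ∈ s ×ˢ s | (q.1.factorial : ZMod p) = q.2.factorial ∧
      q.1 < q.2 + K ∧ q.2 < q.1 + K} ≤ #s + 2 * K ^ 2 := by
  set U : Finset (ℕ × ℕ) := {q ∈ s ×ˢ s | (q.1.factorial : ZMod p) = q.2.factorial ∧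
    q.1 < q.2 ∧ q.2 < q.1 + K}
  have hsub : ({q ∈ s ×ˢ s | (q.1.factorial : ZMod p) = q.2.factorial ∧
      q.1 < q.2 + K ∧ q.2 < q.1 + K} : Finset (ℕ × ℕ)) ⊆
      s.image (fun m ↦ (m, m)) ∪ (U ∪ U.image Prod.swap) := by
    rintro ⟨m, n⟩ hq
    obtain ⟨hmem, h, h₁, h₂⟩ := mem_filter.mp hq
    obtain ⟨hm, hn⟩ := mem_product.mp hmem
    rw [mem_union, mem_union]
    rcases lt_trichotomy m n with hlt | rfl | hlt
    · exact .inr (.inl (mem_filter.mpr ⟨hmem, h, hlt, h₂⟩))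
    · exact .inl (mem_image_of_mem _ hm)
    · exact .inr (.inr (mem_image.mpr ⟨(n, m),
        mem_filter.mpr ⟨mem_product.mpr ⟨hn, hm⟩, h.symm, hlt, h₁⟩, rfl⟩))
  have hUK : #U ≤ K ^ 2 := card_close_factorial_eq_le K s hs
  have h₁ := card_le_card hsub
  have h₂ := card_union_le (s.image (fun m ↦ (m, m))) (U ∪ U.image Prod.swap)
  have h₃ := card_union_le U (U.image Prod.swap)
  have h₄ : #(s.image (fun m ↦ (m, m))) ≤ #s := card_image_le
  have h₅ : #(U.image Prod.swap) ≤ #U := card_image_le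
  omega

open Finset in
/-- Splitting an interval of length `N` into blocks of length `K` bounds the second moment of
character sums over factorials. -/
theorem sum_mulChar_factorial_norm_sq_le {p : ℕ} [Fact p.Prime] {H N K : ℕ} (hK : 0 < K)
    (hHN : H + N < p) (c : ℕ → ℂ) (hc : ∀ n, ‖c n‖ ≤ 1) :
    ∑ χ : MulChar (ZMod p) ℂ,
        ‖∑ n ∈ Icc (H + 1) (H + N), χ (n.factorial : ZMod p) * c n‖ ^ 2 ≤
      ((N / K + 1) * (p * (N + 2 * K ^ 2)) : ℕ) := by
  set A := Icc (H + 1) (H + N) with hA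
  set T := range (N / K + 1) with hT
  let b : ℕ → ℕ := fun n ↦ (n - (H + 1)) / K
  let B : ℕ → Finset ℕ := fun j ↦ {n ∈ A | b n = j}
  have hAp : ∀ n ∈ A, n < p := fun n hn ↦ (mem_Icc.mp hn).2.trans_lt hHN
  have hb : ∀ n ∈ A, b n ∈ T := fun n hn ↦ by
    have := mem_Icc.mp hn
    exact mem_range.mpr (Nat.lt_succ_of_le (Nat.div_le_div_right (by omega)))
  have hne : ∀ n ∈ A, (n.factorial : ZMod p) ≠ 0 := fun n hn ↦
    factorial_natCast_ne_zero (hAp n hn)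
  have hcs (χ : MulChar (ZMod p) ℂ) : ‖∑ n ∈ A, χ (n.factorial : ZMod p) * c n‖ ^ 2 ≤
      (#T : ℝ) * ∑ j ∈ T, ‖∑ n ∈ B j, χ (n.factorial : ZMod p) * c n‖ ^ 2 := by
    rw [← sum_fiberwise_of_maps_to hb]
    exact (pow_le_pow_left₀ (norm_nonneg _) (norm_sum_le _ _) 2).trans sq_sum_le_card_mul_sum_sq
  have hblock (j : ℕ) :
      ∑ χ : MulChar (ZMod p) ℂ, ‖∑ n ∈ B j, χ (n.factorial : ZMod p) * c n‖ ^ 2 ≤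
        p * #{q ∈ B j ×ˢ B j | (q.1.factorial : ZMod p) = q.2.factorial} :=
    sum_mulChar_norm_sq_le (B j) (fun n ↦ (n.factorial : ZMod p))
      (fun n hn ↦ hne n (mem_filter.mp hn).1) c (fun n _ ↦ hc n)
  have hcount : ∑ j ∈ T, #{q ∈ B j ×ˢ B j | (q.1.factorial : ZMod p) = q.2.factorial} ≤
      N + 2 * K ^ 2 := by
    rw [← card_biUnion]
    · refine (card_le_card ?_).trans
        ((card_near_factorial_eq_le K A hAp).trans_eq (by simp [hA]))
      rintro ⟨m, n⟩ hq
      simp only [mem_biUnion, mem_filter, mem_product, B, b] at hq ⊢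
      obtain ⟨j, -, ⟨⟨hm, hmj⟩, hn, hnj⟩, h⟩ := hq
      have hm' := mem_Icc.mp hm
      have hn' := mem_Icc.mp hn
      have h₁ := Nat.div_add_mod (m - (H + 1)) K
      have h₂ := Nat.div_add_mod (n - (H + 1)) K
      have h₃ := Nat.mod_lt (m - (H + 1)) hK
      have h₄ := Nat.mod_lt (n - (H + 1)) hK
      rw [hmj] at h₁
      rw [hnj] at h₂
      exact ⟨⟨hm, hn⟩, h, by omega, by omega⟩
    · intro i _ j _ hij
      refine disjoint_left.mpr fun q hi hj ↦ hij ?_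
      simp only [mem_filter, mem_product, B] at hi hj
      exact hi.1.1.2.symm.trans hj.1.1.2
  calc _ ≤ ∑ χ : MulChar (ZMod p) ℂ,
        (#T : ℝ) * ∑ j ∈ T, ‖∑ n ∈ B j, χ (n.factorial : ZMod p) * c n‖ ^ 2 :=
        sum_le_sum fun χ _ ↦ hcs χ
    _ = #T * ∑ j ∈ T, ∑ χ : MulChar (ZMod p) ℂ,
          ‖∑ n ∈ B j, χ (n.factorial : ZMod p) * c n‖ ^ 2 := by rw [← mul_sum, sum_comm]
    _ ≤ #T * ∑ j ∈ T, p * (#{q ∈ B j ×ˢ B j | (q.1.factorial : ZMod p) = q.2.factorial} : ℝ) := by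
        gcongr with j _
        exact hblock j
    _ = ((N / K + 1) * (p *
          ∑ j ∈ T, #{q ∈ B j ×ˢ B j | (q.1.factorial : ZMod p) = q.2.factorial}) : ℕ) := by
        rw [hT, card_range, ← mul_sum]
        push_cast
        rfl
    _ ≤ _ := by gcongr

/-- With blocks of length `⌊√N⌋`, the block bound is of order `N ^ (3 / 2)`. -/
theorem div_sqrt_add_one_mul_le {N : ℕ} (hN : 0 < N) :
    (((N / N.sqrt + 1) * (N + 2 * N.sqrt ^ 2) : ℕ) : ℝ) ≤ 12 * (N : ℝ) ^ ((3 : ℝ) / 2) := by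
  have hpos : 0 < N.sqrt := Nat.sqrt_pos.mpr hN
  have h₁ : N.sqrt ^ 2 ≤ N := Nat.sqrt_le' N
  have h₂ : N / N.sqrt ≤ N.sqrt + 2 := by
    rw [← Nat.lt_succ_iff, Nat.div_lt_iff_lt_mul hpos]
    nlinarith [Nat.sqrt_le_add N]
  have h₃ : (N / N.sqrt + 1) * (N + 2 * N.sqrt ^ 2) ≤ (4 * N.sqrt) * (3 * N) :=
    Nat.mul_le_mul (by omega) (by omega)
  have h₄ : (N.sqrt : ℝ) ≤ √N := Real.nat_sqrt_le_real_sqrt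
  have h₅ : (N : ℝ) ^ ((3 : ℝ) / 2) = √N * N := by
    rw [show (3 : ℝ) / 2 = 1 / 2 + 1 by norm_num, Real.rpow_add_one (by positivity),
      Real.sqrt_eq_rpow]
  calc (((N / N.sqrt + 1) * (N + 2 * N.sqrt ^ 2) : ℕ) : ℝ)
      ≤ (((4 * N.sqrt) * (3 * N) : ℕ) : ℝ) := by exact_mod_cast h₃
    _ = 12 * (N.sqrt * N) := by push_cast; ring
    _ ≤ _ := by rw [h₅]; gcongr

/-- Theorem 3 (second moment of character sums with `n!`): for every fixed
degree `d` there is `C = C(d) > 0` such that for every odd prime `p`, every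
polynomial `f` over `F_p` of degree `d` and all `0 ≤ H < H + N < p`,
`∑_χ |∑_{n=H+1}^{H+N} χ(n!) e_p(f(n))|² ≤ C p N^{3/2}`, the sum being over all
multiplicative characters `χ` mod `p`. -/
theorem char_sum_factorial_second_moment (d : ℕ) :
    ∃ C : ℝ, 0 < C ∧ ∀ p : ℕ, p.Prime → Odd p →
      ∀ f : Polynomial (ZMod p), f.natDegree = d →
      ∀ H N : ℕ, 0 < N → H + N < p →
        ∑ χ : MulChar (ZMod p) ℂ,
            ‖∑ n ∈ Finset.Icc (H + 1) (H + N),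
                χ ((n.factorial : ZMod p)) *
                  Complex.exp (2 * Real.pi * Complex.I *
                    (((f.eval (n : ZMod p)).val : ℂ)) / (p : ℂ))‖ ^ 2 ≤
          C * (p : ℝ) * (N : ℝ) ^ ((3 : ℝ) / 2) := by
  refine ⟨12, by norm_num, fun p hp _ f _ H N hN hHN ↦ ?_⟩
  have : Fact p.Prime := ⟨hp⟩
  have hexp (n : ℕ) : ‖Complex.exp (2 * Real.pi * Complex.I *
      (((f.eval (n : ZMod p)).val : ℂ)) / (p : ℂ))‖ ≤ 1 := by
    rw [show 2 * Real.pi * Complex.I * (((f.eval (n : ZMod p)).val : ℂ)) / (p : ℂ) =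
      ((2 * Real.pi * (f.eval (n : ZMod p)).val / p : ℝ) : ℂ) * Complex.I by push_cast; ring,
      Complex.norm_exp_ofReal_mul_I]
  have hmain := sum_mulChar_factorial_norm_sq_le (Nat.sqrt_pos.mpr hN) hHN _ hexp
  refine hmain.trans ?_
  rw [mul_left_comm, Nat.cast_mul p]
  calc _ ≤ (p : ℝ) * (12 * (N : ℝ) ^ ((3 : ℝ) / 2)) := by
        gcongr
        exact div_sqrt_add_one_mul_le hN
    _ = _ := by ring
end

section
/- There exists an absolute constant C > 0 such that for every odd prime p and all integers H, N with 0 ≤ H < H + N < p, one has ∑_{a=0}^{p−1} |∑_{n=H+1}^{H+N} e_p(a · (n! mod p))|² ≤ C · p · N^{3/2}. -/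
open Finset in
/-- The number of collisions of `f` on `s` is the sum of the squared fibre sizes. -/
lemma card_collisions_eq_sum_sq {α β : Type*} [DecidableEq β] (s : Finset α) (t : Finset β)
    (f : α → β) (hf : ∀ n ∈ s, f n ∈ t) :
    #{x ∈ s ×ˢ s | f x.1 = f x.2} = ∑ c ∈ t, #{n ∈ s | f n = c} ^ 2 := by
  have hmaps : ∀ x ∈ ({x ∈ s ×ˢ s | f x.1 = f x.2} : Finset (α × α)), f x.1 ∈ t := fun x hx ↦
    hf _ (mem_product.1 (mem_filter.1 hx).1).1
  rw [card_eq_sum_card_fiberwise hmaps]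
  refine sum_congr rfl fun c _ ↦ ?_
  rw [sq, ← card_product]
  congr 1
  ext ⟨a, b⟩
  simp only [mem_filter, mem_product]
  grind

open Finset in
/-- Splitting `s` into `#t` parts according to `g` loses at most a factor `#t` in the number of
collisions. -/
lemma card_collisions_le_mul {α β γ : Type*} [DecidableEq β] [DecidableEq γ]
    (s : Finset α) (t : Finset γ) (f : α → β) (g : α → γ) (hg : ∀ n ∈ s, g n ∈ t) :
    #{x ∈ s ×ˢ s | f x.1 = f x.2} ≤ #t * #{x ∈ s ×ˢ s | f x.1 = f x.2 ∧ g x.1 = g x.2} := by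
  have hpair : #{x ∈ s ×ˢ s | f x.1 = f x.2 ∧ g x.1 = g x.2} =
      ∑ c ∈ s.image f, ∑ d ∈ t, #{n ∈ s | f n = c ∧ g n = d} ^ 2 := by
    have h := card_collisions_eq_sum_sq s (s.image f ×ˢ t) (fun n ↦ (f n, g n))
      fun n hn ↦ mem_product.2 ⟨mem_image_of_mem f hn, hg n hn⟩
    simpa only [Prod.mk.injEq, sum_product] using h
  rw [hpair, card_collisions_eq_sum_sq s (s.image f) f fun n hn ↦ mem_image_of_mem f hn, mul_sum]
  refine sum_le_sum fun c _ ↦ ?_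
  have hfib : #{n ∈ s | f n = c} = ∑ d ∈ t, #{n ∈ s | f n = c ∧ g n = d} := by
    rw [card_eq_sum_card_fiberwise (f := g) (t := t) fun n hn ↦ hg n (mem_filter.1 hn).1]
    simp only [filter_filter]
  rw [hfib]
  exact sq_sum_le_card_mul_sum_sq

/-- Parseval's identity for exponential sums over `ZMod p`. -/
lemma sum_norm_sq_sum_stdAddChar {p : ℕ} [Fact p.Prime] {α : Type*} (s : Finset α)
    (f : α → ZMod p) :
    ∑ a : ZMod p, ‖∑ n ∈ s, ZMod.stdAddChar (a * f n)‖ ^ 2 =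
      p * ({x ∈ s ×ˢ s | f x.1 = f x.2} : Finset (α × α)).card := by
  have hnorm (a : ZMod p) : ((‖∑ n ∈ s, ZMod.stdAddChar (a * f n)‖ ^ 2 : ℝ) : ℂ) =
      ∑ x ∈ s ×ˢ s, ZMod.stdAddChar (a * (f x.1 - f x.2)) := by
    rw [Complex.ofReal_pow, ← Complex.mul_conj', map_sum, Finset.sum_mul_sum,
      ← Finset.sum_product']
    refine Finset.sum_congr rfl fun x _ ↦ ?_
    rw [← AddChar.map_neg_eq_conj, ← AddChar.map_add_eq_mul]
    ring_nf
  have hcast : ((∑ a : ZMod p, ‖∑ n ∈ s, ZMod.stdAddChar (a * f n)‖ ^ 2 : ℝ) : ℂ) =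
      ((p * ({x ∈ s ×ˢ s | f x.1 = f x.2} : Finset (α × α)).card : ℝ) : ℂ) := by
    rw [Complex.ofReal_sum]
    simp_rw [hnorm]
    rw [Finset.sum_comm]
    simp_rw [AddChar.sum_mulShift _ (ZMod.isPrimitive_stdAddChar p), sub_eq_zero, ZMod.card]
    rw [← Nat.cast_sum, ← Finset.sum_filter, Finset.sum_const, smul_eq_mul]
    push_cast
    ring
  exact_mod_cast hcast

open Finset Polynomial in
/-- For `k ≥ 1`, the congruence `(n + k)! ≡ n!` modulo `p` has at most `k` solutions with
`n + k < p`. -/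
lemma card_factorial_add_eq_le {p : ℕ} [Fact p.Prime] {k : ℕ} (hk : 0 < k) (s : Finset ℕ)
    (hs : ∀ n ∈ s, n + k < p ∧ (((n + k).factorial : ℕ) : ZMod p) = (n.factorial : ℕ)) :
    #s ≤ k := by
  set P : (ZMod p)[X] := (ascPochhammer (ZMod p) k).comp (X + C 1) with hP
  have hdeg : P.natDegree = k := by
    rw [hP, natDegree_comp, ascPochhammer_natDegree, natDegree_X_add_C, mul_one]
  have hpos : 0 < P.degree := natDegree_pos_iff_degree_pos.1 (hdeg ▸ hk)
  have hne : P - C 1 ≠ 0 := fun h ↦ by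
    rw [sub_eq_zero.1 h] at hpos
    exact absurd hpos (not_lt.2 degree_C_le)
  have hinj : Set.InjOn (fun n : ℕ ↦ (n : ZMod p)) s := fun m hm n hn h ↦ by
    have h' := (ZMod.natCast_eq_natCast_iff' m n p).1 h
    rwa [Nat.mod_eq_of_lt (by have := hs m hm; omega),
      Nat.mod_eq_of_lt (by have := hs n hn; omega)] at h'
  have hroots : ∀ n ∈ s, (n : ZMod p) ∈ (P - C 1).roots.toFinset := fun n hn ↦ by
    obtain ⟨hlt, heq⟩ := hs n hn
    have hn0 : ((n.factorial : ℕ) : ZMod p) ≠ 0 := fun h ↦ by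
      have := (Fact.out : p.Prime).dvd_factorial.1 ((ZMod.natCast_eq_zero_iff _ _).1 h)
      omega
    rw [← Nat.factorial_mul_ascFactorial, Nat.cast_mul] at heq
    have hone := mul_left_cancel₀ hn0 (heq.trans (mul_one _).symm)
    rw [Nat.cast_ascFactorial] at hone
    push_cast at hone
    rw [Multiset.mem_toFinset, mem_roots hne]
    simp [hP, hone]
  calc #s = #(s.image fun n : ℕ ↦ (n : ZMod p)) := (card_image_of_injOn hinj).symm
    _ ≤ #(P - C 1).roots.toFinset := card_le_card (image_subset_iff.2 hroots)
    _ ≤ Multiset.card (P - C 1).roots := Multiset.toFinset_card_le _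
    _ ≤ (P - C 1).natDegree := card_roots' _
    _ = k := by rw [natDegree_sub_C, hdeg]

open Finset in
/-- The number of ordered pairs at distance less than `D` with congruent factorials. -/
lemma card_factorial_collisions_lt_le {p : ℕ} [Fact p.Prime] (D : ℕ) (s : Finset ℕ)
    (hs : ∀ n ∈ s, n < p) :
    #{x ∈ s ×ˢ s | ((x.1.factorial : ℕ) : ZMod p) = (x.2.factorial : ℕ) ∧
      x.1 < x.2 ∧ x.2 < x.1 + D} ≤ D * D := by
  refine (card_le_mul_card_image_of_maps_to (f := fun x : ℕ × ℕ ↦ x.2 - x.1) (t := range D)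
    (fun x hx ↦ ?_) D fun k hk ↦ ?_).trans_eq (by rw [card_range])
  · simp only [mem_filter, mem_product, mem_range] at hx ⊢
    omega
  · rw [mem_range] at hk
    rw [filter_filter]
    rcases Nat.eq_zero_or_pos k with rfl | hk0
    · rw [filter_false_of_mem fun x _ ↦ by omega]
      exact Nat.zero_le _
    · rw [← card_image_of_injOn (f := Prod.fst) fun x hx y hy h ↦ ?_]
      · refine (card_factorial_add_eq_le (p := p) hk0 _ fun n hn ↦ ?_).trans hk.le
        obtain ⟨⟨a, b⟩, hx, rfl⟩ := mem_image.1 hn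
        simp only [mem_filter, mem_product] at hx ⊢
        obtain ⟨⟨-, hb⟩, ⟨heq, hlt, -⟩, hsub⟩ := hx
        obtain rfl : b = a + k := by omega
        exact ⟨hs _ hb, heq.symm⟩
      · rw [mem_coe, mem_filter] at hx hy
        exact Prod.ext h (by omega)

open Finset in
/-- The number of pairs at distance less than `D` with congruent factorials. -/
lemma card_factorial_collisions_near_le {p : ℕ} [Fact p.Prime] (D : ℕ) (s : Finset ℕ)
    (hs : ∀ n ∈ s, n < p) :
    #{x ∈ s ×ˢ s | ((x.1.factorial : ℕ) : ZMod p) = (x.2.factorial : ℕ) ∧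
      x.1 < x.2 + D ∧ x.2 < x.1 + D} ≤ #s + 2 * (D * D) := by
  set L := ({x ∈ s ×ˢ s | ((x.1.factorial : ℕ) : ZMod p) = (x.2.factorial : ℕ) ∧
    x.1 < x.2 ∧ x.2 < x.1 + D} : Finset (ℕ × ℕ)) with hL
  have hcard : #L ≤ D * D := card_factorial_collisions_lt_le D s hs
  have hswap : #(L.image Prod.swap) ≤ #L := card_image_le
  have hdiag : #s.diag = #s := diag_card s
  calc _ ≤ #(s.diag ∪ (L ∪ L.image Prod.swap)) := card_le_card fun x hx ↦ ?_
    _ ≤ #s.diag + #(L ∪ L.image Prod.swap) := card_union_le _ _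
    _ ≤ #s.diag + (#L + #(L.image Prod.swap)) := by gcongr; exact card_union_le _ _
    _ ≤ _ := by omega
  obtain ⟨a, b⟩ := x
  simp only [mem_filter, mem_product] at hx
  obtain ⟨⟨ha, hb⟩, heq, h1, h2⟩ := hx
  rw [mem_union, mem_union]
  rcases lt_trichotomy a b with h | rfl | h
  · exact .inr (.inl (by simp [hL, ha, hb, heq, h, h2]))
  · exact .inl (by simp [ha])
  · exact .inr (.inr (mem_image.2 ⟨(b, a), by simp [hL, ha, hb, heq, h, h1], rfl⟩))

open Finset in
/-- The congruence `m! ≡ n!` modulo `p` has `O(N ^ (3 / 2))` solutions in an interval of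
length `N`. -/
lemma card_factorial_collisions_le {p : ℕ} [Fact p.Prime] {H N : ℕ} (hN : 0 < N)
    (hp : H + N < p) :
    #{x ∈ Icc (H + 1) (H + N) ×ˢ Icc (H + 1) (H + N) |
      ((x.1.factorial : ℕ) : ZMod p) = (x.2.factorial : ℕ)} ≤ 12 * (N * N.sqrt) := by
  set s := Icc (H + 1) (H + N) with hs
  set D := N.sqrt with hD
  have hD0 : 0 < D := Nat.sqrt_pos.2 hN
  have hDN : D * D ≤ N := Nat.sqrt_le N
  have hND : N / D ≤ D + 2 := by
    have : N ≤ D * D + D + D := Nat.sqrt_le_add N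
    exact Nat.div_le_of_le_mul (by linarith)
  have hcard : #s = N := by simp [hs]
  have hblock := card_collisions_le_mul s (range (N / D + 1))
    (fun n ↦ ((n.factorial : ℕ) : ZMod p)) (fun n ↦ (n - (H + 1)) / D) fun n hn ↦ by
      rw [mem_Icc] at hn
      exact mem_range.2 (Nat.lt_succ_of_le (Nat.div_le_div_right (by omega)))
  rw [card_range] at hblock
  refine hblock.trans ?_
  have hnear := card_factorial_collisions_near_le (p := p) D s fun n hn ↦ by
    rw [mem_Icc] at hn
    omega
  have hsub : #{x ∈ s ×ˢ s | ((x.1.factorial : ℕ) : ZMod p) = (x.2.factorial : ℕ) ∧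
      (x.1 - (H + 1)) / D = (x.2 - (H + 1)) / D} ≤ 3 * N := by
    refine ((card_le_card fun x hx ↦ ?_).trans hnear).trans (by omega)
    simp only [mem_filter, mem_product, hs, mem_Icc] at hx ⊢
    obtain ⟨hx, heq, hdiv⟩ := hx
    have h1 := Nat.div_add_mod (x.1 - (H + 1)) D
    have h2 := Nat.div_add_mod (x.2 - (H + 1)) D
    have h3 := Nat.mod_lt (x.1 - (H + 1)) hD0
    have h4 := Nat.mod_lt (x.2 - (H + 1)) hD0
    rw [hdiv] at h1
    exact ⟨hx, heq, by omega, by omega⟩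
  calc _ ≤ (4 * D) * (3 * N) := Nat.mul_le_mul (by omega) hsub
    _ = _ := by ring

/-- Theorem 4 (second moment of exponential sums with `n!`): there is an
absolute constant `C > 0` such that for every odd prime `p` and all
`0 ≤ H < H + N < p`,
`∑_{a=0}^{p-1} |∑_{n=H+1}^{H+N} e_p(a · (n! mod p))|² ≤ C p N^{3/2}`. -/
theorem exp_sum_factorial_second_moment :
    ∃ C : ℝ, 0 < C ∧ ∀ p : ℕ, p.Prime → Odd p →
      ∀ H N : ℕ, 0 < N → H + N < p →
        ∑ a ∈ Finset.range p,
            ‖∑ n ∈ Finset.Icc (H + 1) (H + N),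
                Complex.exp (2 * Real.pi * Complex.I *
                  ((a * (n.factorial % p) : ℕ) : ℂ) / (p : ℂ))‖ ^ 2 ≤
          C * (p : ℝ) * (N : ℝ) ^ ((3 : ℝ) / 2) := by
  refine ⟨12, by norm_num, fun p hp _ H N hN hpN ↦ ?_⟩
  have : Fact p.Prime := ⟨hp⟩
  have hterm (a n : ℕ) : Complex.exp (2 * Real.pi * Complex.I *
      ((a * (n.factorial % p) : ℕ) : ℂ) / (p : ℂ)) =
      ZMod.stdAddChar ((a : ZMod p) * ((n.factorial : ℕ) : ZMod p)) := by
    rw [← ZMod.natCast_mod n.factorial p, ← Nat.cast_mul, ZMod.stdAddChar_apply,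
      ZMod.toCircle_natCast]
  have hsum : ∑ a ∈ Finset.range p, ‖∑ n ∈ Finset.Icc (H + 1) (H + N),
      Complex.exp (2 * Real.pi * Complex.I *
        ((a * (n.factorial % p) : ℕ) : ℂ) / (p : ℂ))‖ ^ 2 =
      ∑ a : ZMod p, ‖∑ n ∈ Finset.Icc (H + 1) (H + N),
        ZMod.stdAddChar (a * ((n.factorial : ℕ) : ZMod p))‖ ^ 2 := by
    simp_rw [hterm]
    exact Finset.sum_bij' (fun a _ ↦ (a : ZMod p)) (fun a _ ↦ a.val) (by simp)
      (fun a _ ↦ Finset.mem_range.2 a.val_lt)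
      (fun a ha ↦ ZMod.val_cast_of_lt (Finset.mem_range.1 ha)) (by simp) (by simp)
  have hsqrt : (N.sqrt : ℝ) ≤ (N : ℝ) ^ ((1 : ℝ) / 2) := by
    rw [← Real.sqrt_eq_rpow]
    exact Real.nat_sqrt_le_real_sqrt
  have hpow : (N : ℝ) ^ ((3 : ℝ) / 2) = N * (N : ℝ) ^ ((1 : ℝ) / 2) := by
    rw [← Real.rpow_one_add' N.cast_nonneg (by norm_num)]
    norm_num
  rw [hsum, sum_norm_sq_sum_stdAddChar, hpow]
  calc _ ≤ (p : ℝ) * ((12 * (N * N.sqrt) : ℕ) : ℝ) := by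
        gcongr
        exact card_factorial_collisions_le hN hpN
    _ = 12 * p * (N * N.sqrt) := by push_cast; ring
    _ ≤ _ := by gcongr
end

section
/- For every fixed integer ℓ ≥ 1 there exists a constant C = C(ℓ) > 0 such that for every odd prime p and all integers H, N with 0 ≤ H < H + N < p, the number J_ℓ(H,N) of 2ℓ-tuples (n_1,…,n_{2ℓ}) with H+1 ≤ n_i ≤ H+N for all i and n_1! + ⋯ + n_ℓ! ≡ n_{ℓ+1}! + ⋯ + n_{2ℓ}! (mod p) satisfies J_ℓ(H,N) ≤ C · N^{2ℓ − 1 + 1/(ℓ+1)}. -/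
/-- The solutions of `f x₁ + ⋯ + f x_ℓ = f y₁ + ⋯ + f y_ℓ` with all variables in `A`. -/
def sumEqSolutions {G α : Type*} [AddCommGroup G] [DecidableEq G] (f : α → G) (ℓ : ℕ)
    (A : Finset α) : Finset ((Fin ℓ → α) × (Fin ℓ → α)) :=
  ((Fintype.piFinset fun _ : Fin ℓ => A) ×ˢ (Fintype.piFinset fun _ : Fin ℓ => A)).filter
    fun nm => (∑ i, f (nm.1 i)) = ∑ i, f (nm.2 i)

theorem card_mul_card_sumEqSolutions {G α : Type*} [AddCommGroup G] [Fintype G] [DecidableEq G]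
    (f : α → G) (ℓ : ℕ) (A : Finset α) :
    (Fintype.card G : ℝ) * (sumEqSolutions f ℓ A).card =
      ∑ ψ : AddChar G ℂ, ‖∑ a ∈ A, ψ (f a)‖ ^ (2 * ℓ) := by
  have hsum : ∀ (ψ : AddChar G ℂ) (x : Fin ℓ → α), ψ (∑ i, f (x i)) = ∏ i, ψ (f (x i)) :=
    fun ψ x => map_prod ψ.toMonoidHom (fun i => Multiplicative.ofAdd (f (x i))) Finset.univ
  have key : ∀ ψ : AddChar G ℂ, ((‖∑ a ∈ A, ψ (f a)‖ ^ (2 * ℓ) : ℝ) : ℂ) =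
      ∑ nm ∈ (Fintype.piFinset fun _ : Fin ℓ => A) ×ˢ (Fintype.piFinset fun _ : Fin ℓ => A),
        ψ ((∑ i, f (nm.1 i)) - ∑ i, f (nm.2 i)) := by
    intro ψ
    rw [pow_mul, Complex.ofReal_pow, Complex.ofReal_pow, ← Complex.mul_conj', mul_pow, map_sum,
      Finset.sum_pow', Finset.sum_pow', Finset.sum_mul_sum, Finset.sum_product]
    refine Finset.sum_congr rfl fun x _ => Finset.sum_congr rfl fun y _ => ?_
    rw [sub_eq_add_neg, AddChar.map_add_eq_mul, AddChar.map_neg_eq_conj, hsum, hsum,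
      map_prod]
  apply Complex.ofReal_injective
  rw [Complex.ofReal_sum, Finset.sum_congr rfl fun ψ _ => key ψ, Finset.sum_comm]
  simp_rw [AddChar.sum_apply_eq_ite, sub_eq_zero]
  rw [← Finset.sum_filter, Finset.sum_const, nsmul_eq_mul, mul_comm]
  simp [sumEqSolutions]

theorem card_sumEqSolutions_biUnion_le {G α κ : Type*} [AddCommGroup G] [Fintype G]
    [DecidableEq G] [DecidableEq α] (f : α → G) {ℓ : ℕ} (hℓ : 1 ≤ ℓ) (T : Finset κ)
    (B : κ → Finset α) (hB : (T : Set κ).PairwiseDisjoint B) :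
    (sumEqSolutions f ℓ (T.biUnion B)).card ≤
      T.card ^ (2 * ℓ - 1) * ∑ j ∈ T, (sumEqSolutions f ℓ (B j)).card := by
  have hG : (0 : ℝ) < Fintype.card G := by exact_mod_cast Fintype.card_pos
  suffices h : (Fintype.card G : ℝ) * (sumEqSolutions f ℓ (T.biUnion B)).card ≤
      Fintype.card G * (T.card ^ (2 * ℓ - 1) * ∑ j ∈ T, (sumEqSolutions f ℓ (B j)).card : ℝ) by
    exact_mod_cast le_of_mul_le_mul_left h hG
  rw [mul_left_comm, Nat.cast_sum, Finset.mul_sum, Finset.sum_congr rfl fun j _ =>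
    card_mul_card_sumEqSolutions f ℓ (B j), card_mul_card_sumEqSolutions, Finset.sum_comm,
    Finset.mul_sum]
  refine Finset.sum_le_sum fun ψ _ => ?_
  obtain ⟨n, hn⟩ : ∃ n, 2 * ℓ = n + 1 := ⟨2 * ℓ - 1, by omega⟩
  rw [Finset.sum_biUnion hB, hn, Nat.add_sub_cancel]
  refine (pow_le_pow_left₀ (norm_nonneg _) (norm_sum_le _ _) _).trans ?_
  exact pow_sum_le_card_mul_sum_pow (fun _ _ => norm_nonneg _) n

theorem exists_cons_range_of_card_le {s : Finset ℕ} {r K : ℕ} (h0 : 0 ∈ s) (hs : s.card ≤ r + 1)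
    (hK : ∀ x ∈ s, x < K) :
    ∃ g : Fin r → Fin K, ∀ x ∈ s, ∃ j : Fin (r + 1),
      (Fin.cons 0 fun i => (g i : ℕ) : Fin (r + 1) → ℕ) j = x := by
  have hK0 : 0 < K := hK 0 h0
  have hc : (s.erase 0).card ≤ r := by rw [Finset.card_erase_of_mem h0]; omega
  have hl : (s.erase 0).toList.length ≤ r := by simpa using hc
  have hmem : ∀ i, (s.erase 0).toList.getD i 0 < K := by
    intro i
    by_cases hi : i < (s.erase 0).toList.length
    · rw [List.getD_eq_getElem _ _ hi]
      exact hK _ (Finset.mem_of_mem_erase (Finset.mem_toList.1 (List.getElem_mem hi)))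
    · rw [List.getD_eq_default _ _ (by omega)]
      exact hK0
  refine ⟨fun i => ⟨(s.erase 0).toList.getD i 0, hmem i⟩, fun x hx => ?_⟩
  by_cases hx0 : x = 0
  · exact ⟨0, by simp [hx0]⟩
  · obtain ⟨i, hi, rfl⟩ := List.mem_iff_getElem.1
      (Finset.mem_toList.2 (Finset.mem_erase.2 ⟨hx0, hx⟩))
    refine ⟨Fin.succ ⟨i, hi.trans_le hl⟩, ?_⟩
    simp only [Fin.cons_succ]
    exact List.getD_eq_getElem _ _ hi

theorem card_functions_small_image_le {ι : Type*} [Fintype ι] [DecidableEq ι] (r K : ℕ) :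
    ((Fintype.piFinset fun _ : ι => Finset.range K).filter fun d =>
      0 ∈ Finset.univ.image d ∧ (Finset.univ.image d).card ≤ r + 1).card ≤
      (r + 1) ^ Fintype.card ι * K ^ r := by
  calc _ ≤ (Finset.univ.image fun q : (ι → Fin (r + 1)) × (Fin r → Fin K) =>
          fun i => (Fin.cons 0 fun j => (q.2 j : ℕ) : Fin (r + 1) → ℕ) (q.1 i)).card := by
        refine Finset.card_le_card fun d hd => ?_
        simp only [Finset.mem_filter, Fintype.mem_piFinset, Finset.mem_range] at hd
        obtain ⟨hdK, h0, hc⟩ := hd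
        obtain ⟨g, hg⟩ := exists_cons_range_of_card_le (K := K) h0 hc (by simpa using hdK)
        choose π hπ using fun i => hg (d i) (Finset.mem_image_of_mem d (Finset.mem_univ i))
        exact Finset.mem_image.2 ⟨(π, g), Finset.mem_univ _, funext hπ⟩
    _ ≤ _ := Finset.card_image_le
    _ = _ := by simp

theorem two_le_card_fiber_of_sum_ascPochhammer_eq_zero {F ι : Type*} [Field F] [Fintype ι]
    {ε : ι → F} (hε : ∀ i, ε i ≠ 0) {d : ι → ℕ}
    (h : ∑ i, ε i • ascPochhammer F (d i) = 0) (i : ι) :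
    2 ≤ (Finset.univ.filter fun j => d j = d i).card := by
  classical
  let S : Polynomial.Sequence F := ⟨fun n => ascPochhammer F n, fun n => by
    rw [Polynomial.degree_eq_natDegree (monic_ascPochhammer F n).ne_zero, ascPochhammer_natDegree]⟩
  have hz : ∑ i, Finsupp.single (d i) (ε i) = 0 := by
    refine linearIndependent_iff.1 S.linearIndependent _ ?_
    rw [map_sum, ← h]
    simp [Finsupp.linearCombination_single, S]
  have hi := DFunLike.congr_fun hz (d i)
  rw [Finsupp.finsetSum_apply] at hi
  simp only [Finsupp.single_apply, Finsupp.coe_zero, Pi.zero_apply, ← Finset.sum_filter] at hi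
  by_contra hlt
  have hpos : 0 < (Finset.univ.filter fun j => d j = d i).card :=
    Finset.card_pos.2 ⟨i, by simp⟩
  obtain ⟨a, ha⟩ := Finset.card_eq_one.1
    (by omega : (Finset.univ.filter fun j => d j = d i).card = 1)
  rw [ha, Finset.sum_singleton] at hi
  exact hε a hi

theorem card_roots_sum_ascPochhammer_le {p : ℕ} [Fact p.Prime] {ι : Type*} [Fintype ι]
    {ε : ι → ZMod p} {d : ι → ℕ} {K H N : ℕ} (hd : ∀ i, d i < K) (hN : H + N < p)
    (h : ∑ i, ε i • ascPochhammer (ZMod p) (d i) ≠ 0) :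
    ((Finset.Icc (H + 1) (H + N)).filter fun m =>
      ∑ i, ε i * ((m + 1).ascFactorial (d i) : ZMod p) = 0).card ≤ K := by
  set P := ∑ i, ε i • ascPochhammer (ZMod p) (d i) with hP
  have hdeg : P.natDegree ≤ K := by
    refine Polynomial.natDegree_sum_le_of_forall_le _ _ fun i _ => ?_
    refine (Polynomial.natDegree_smul_le _ _).trans ?_
    rw [ascPochhammer_natDegree]
    exact (hd i).le
  have hinj : Set.InjOn (fun m : ℕ => (m : ZMod p) + 1)
      ((Finset.Icc (H + 1) (H + N)).filter fun m =>
        ∑ i, ε i * ((m + 1).ascFactorial (d i) : ZMod p) = 0) := by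
    intro a ha b hb hab
    simp only [Finset.mem_coe, Finset.mem_filter, Finset.mem_Icc] at ha hb
    have := (ZMod.natCast_eq_natCast_iff' a b p).1 (add_right_cancel hab)
    rwa [Nat.mod_eq_of_lt (by omega), Nat.mod_eq_of_lt (by omega)] at this
  rw [← Finset.card_image_of_injOn hinj]
  refine le_trans ?_ ((P.card_roots').trans hdeg)
  refine le_trans (Finset.card_le_card ?_) (Multiset.toFinset_card_le _)
  intro x hx
  obtain ⟨m, hm, rfl⟩ := Finset.mem_image.1 hx
  rw [Multiset.mem_toFinset, Polynomial.mem_roots h, Polynomial.IsRoot, hP,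
    Polynomial.eval_finsetSum, ← (Finset.mem_filter.1 hm).2]
  refine Finset.sum_congr rfl fun i _ => ?_
  rw [Polynomial.eval_smul, smul_eq_mul, ← ascPochhammer_nat_eq_ascFactorial,
    ascPochhammer_eval_cast]
  push_cast
  rfl

theorem sum_card_sumEqSolutions_windows_le {p : ℕ} [Fact p.Prime] {ℓ K H N : ℕ} (hℓ : 1 ≤ ℓ)
    (hN : H + N < p) (g : ℕ → ℕ)
    (hg : ∀ a ∈ Finset.Icc (H + 1) (H + N), ∀ b ∈ Finset.Icc (H + 1) (H + N),
      g a = g b → a < b + K) (T : Finset ℕ) :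
    ∑ j ∈ T, (sumEqSolutions (fun n => (n.factorial : ZMod p)) ℓ
        ((Finset.Icc (H + 1) (H + N)).filter fun n => g n = j)).card ≤
      ((((Fintype.piFinset fun _ : Fin ℓ ⊕ Fin ℓ => Finset.range K).filter fun d =>
          0 ∈ Finset.univ.image d) ×ˢ Finset.Icc (H + 1) (H + N)).filter fun q =>
        ∑ i, (Sum.elim (fun _ => 1) (fun _ => -1) i : ZMod p) *
          ((q.2 + 1).ascFactorial (q.1 i) : ZMod p) = 0).card := by
  classical
  rw [← Finset.card_biUnion]
  · refine (Finset.card_le_card (t := Finset.image (fun q : (Fin ℓ ⊕ Fin ℓ → ℕ) × ℕ =>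
      ((fun i => q.2 + q.1 (Sum.inl i) : Fin ℓ → ℕ), (fun i => q.2 + q.1 (Sum.inr i) : Fin ℓ → ℕ)))
      _) ?_).trans Finset.card_image_le
    rintro ⟨x, y⟩ hxy
    obtain ⟨j, -, hj⟩ := Finset.mem_biUnion.1 hxy
    simp only [sumEqSolutions, Finset.mem_filter, Finset.mem_product, Fintype.mem_piFinset] at hj
    obtain ⟨⟨hx, hy⟩, he⟩ := hj
    have hz : ∀ i, Sum.elim x y i ∈ Finset.Icc (H + 1) (H + N) ∧ g (Sum.elim x y i) = j := by
      rintro (i | i)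
      · exact hx i
      · exact hy i
    obtain ⟨i₀, -, hmin⟩ := Finset.exists_min_image Finset.univ (Sum.elim x y)
      ⟨Sum.inl ⟨0, hℓ⟩, Finset.mem_univ _⟩
    set m := Sum.elim x y i₀ with hm
    have hadd : ∀ i, m + (Sum.elim x y i - m) = Sum.elim x y i := fun i =>
      Nat.add_sub_cancel' (hmin i (Finset.mem_univ i))
    refine Finset.mem_image.2 ⟨(fun i => Sum.elim x y i - m, m), ?_, ?_⟩
    · simp only [Finset.mem_filter, Finset.mem_product, Fintype.mem_piFinset, Finset.mem_range,
        Finset.mem_image, Finset.mem_univ, true_and]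
      refine ⟨⟨⟨fun i => ?_, i₀, by simp [hm]⟩, (hz i₀).1⟩, ?_⟩
      · have := hg _ (hz i).1 _ (hz i₀).1 ((hz i).2.trans (hz i₀).2.symm)
        have := hadd i
        omega
      · have hm0 : (m.factorial : ZMod p) ≠ 0 := by
          rw [Ne, ZMod.natCast_eq_zero_iff, (Fact.out : p.Prime).dvd_factorial, not_le]
          have := (Finset.mem_Icc.1 (hz i₀).1).2
          omega
        refine (mul_eq_zero.1 ?_).resolve_left hm0
        have hterm : ∀ i, (m.factorial : ZMod p) *
            ((m + 1).ascFactorial (Sum.elim x y i - m) : ZMod p) =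
              ((Sum.elim x y i).factorial : ZMod p) := by
          intro i
          rw [← Nat.cast_mul, Nat.factorial_mul_ascFactorial, hadd]
        simp_rw [Finset.mul_sum, mul_left_comm (m.factorial : ZMod p), hterm]
        simp [he]
    · exact Prod.ext (funext fun i => hadd (Sum.inl i)) (funext fun i => hadd (Sum.inr i))
  · intro a _ b _ hab
    refine Finset.disjoint_left.2 fun q hqa hqb => hab ?_
    simp only [sumEqSolutions, Finset.mem_filter, Finset.mem_product, Fintype.mem_piFinset]
      at hqa hqb
    exact (hqa.1.1 ⟨0, hℓ⟩).2.symm.trans (hqb.1.1 ⟨0, hℓ⟩).2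

theorem card_ascFactorial_relations_le {p : ℕ} [Fact p.Prime] {k K H N : ℕ} (hN : H + N < p) :
    ((((Fintype.piFinset fun _ : Fin (k + 1) ⊕ Fin (k + 1) => Finset.range K).filter fun d =>
          0 ∈ Finset.univ.image d) ×ˢ Finset.Icc (H + 1) (H + N)).filter fun q =>
        ∑ i, (Sum.elim (fun _ => 1) (fun _ => -1) i : ZMod p) *
          ((q.2 + 1).ascFactorial (q.1 i) : ZMod p) = 0).card ≤
      (2 * k + 2) ^ (2 * k + 2) * K ^ (2 * k + 1) * K +
        (k + 1) ^ (2 * k + 2) * K ^ k * N := by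
  classical
  set ε : Fin (k + 1) ⊕ Fin (k + 1) → ZMod p := Sum.elim (fun _ => 1) (fun _ => -1) with hε_def
  have hε : ∀ i, ε i ≠ 0 := by rintro (i | i) <;> simp [hε_def]
  have hcard : Fintype.card (Fin (k + 1) ⊕ Fin (k + 1)) = 2 * k + 2 := by simp; omega
  set D := (Fintype.piFinset fun _ : Fin (k + 1) ⊕ Fin (k + 1) => Finset.range K).filter fun d =>
          0 ∈ Finset.univ.image d with hD
  have hsmall : ∀ d ∈ D, ∑ i, ε i • ascPochhammer (ZMod p) (d i) = 0 →
      (Finset.univ.image d).card ≤ k + 1 := by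
    intro d _ hd
    have := Finset.mul_card_image_le_card (f := d) Finset.univ 2 fun b hb => by
      obtain ⟨i, -, rfl⟩ := Finset.mem_image.1 hb
      exact two_le_card_fiber_of_sum_ascPochhammer_eq_zero hε hd i
    rw [Finset.card_univ, hcard] at this
    omega
  have hall : D.card ≤ (2 * k + 2) ^ (2 * k + 2) * K ^ (2 * k + 1) := by
    refine (Finset.card_le_card fun d hd => ?_).trans
      ((card_functions_small_image_le (ι := Fin (k + 1) ⊕ Fin (k + 1)) (2 * k + 1) K).trans_eq
        (by rw [hcard]))
    obtain ⟨h1, h2⟩ := Finset.mem_filter.1 hd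
    exact Finset.mem_filter.2 ⟨h1, h2, Finset.card_image_le.trans (by rw [Finset.card_univ, hcard])⟩
  have hfew : (D.filter fun d => ∑ i, ε i • ascPochhammer (ZMod p) (d i) = 0).card ≤
      (k + 1) ^ (2 * k + 2) * K ^ k := by
    refine (Finset.card_le_card fun d hd => ?_).trans
      ((card_functions_small_image_le (ι := Fin (k + 1) ⊕ Fin (k + 1)) k K).trans_eq
        (by rw [hcard]))
    obtain ⟨h1, h2⟩ := Finset.mem_filter.1 hd
    obtain ⟨h3, h4⟩ := Finset.mem_filter.1 h1
    exact Finset.mem_filter.2 ⟨h3, h4, hsmall d h1 h2⟩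
  rw [Finset.card_filter, Finset.sum_product]
  simp_rw [← Finset.card_filter]
  rw [← Finset.sum_filter_add_sum_filter_not D
    (fun d => ∑ i, ε i • ascPochhammer (ZMod p) (d i) = 0), add_comm]
  refine add_le_add ?_ ?_
  · refine (Finset.sum_le_card_nsmul _ _ K fun d hd => ?_).trans ?_
    · obtain ⟨h1, h2⟩ := Finset.mem_filter.1 hd
      refine card_roots_sum_ascPochhammer_le (fun i => ?_) hN h2
      exact Finset.mem_range.1 (Fintype.mem_piFinset.1 (Finset.mem_filter.1 h1).1 i)
    · rw [smul_eq_mul]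
      exact Nat.mul_le_mul_right _ ((Finset.card_filter_le _ _).trans hall)
  · refine (Finset.sum_le_card_nsmul _ _ N fun d _ => ?_).trans ?_
    · exact (Finset.card_filter_le _ _).trans (by simp)
    · rw [smul_eq_mul]
      exact Nat.mul_le_mul_right _ hfew

theorem card_factorial_sumEqSolutions_le {p : ℕ} [Fact p.Prime] {k K H N : ℕ} (hK : 0 < K)
    (hKN : K ≤ N) (hN : H + N < p) :
    K ^ (2 * k + 1) * (sumEqSolutions (fun n => (n.factorial : ZMod p)) (k + 1)
        (Finset.Icc (H + 1) (H + N))).card ≤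
      (2 * N) ^ (2 * k + 1) * ((2 * k + 2) ^ (2 * k + 2) * K ^ (2 * k + 1) * K +
        (k + 1) ^ (2 * k + 2) * K ^ k * N) := by
  set A := Finset.Icc (H + 1) (H + N) with hA
  have hg : ∀ a ∈ A, ∀ b ∈ A, (a - (H + 1)) / K = (b - (H + 1)) / K → a < b + K := by
    intro a ha b hb hab
    have ha' := Finset.mem_Icc.1 ha
    have hb' := Finset.mem_Icc.1 hb
    have h1 := Nat.div_add_mod (a - (H + 1)) K
    have h2 := Nat.div_add_mod (b - (H + 1)) K
    have h3 := Nat.mod_lt (a - (H + 1)) hK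
    rw [hab] at h1
    omega
  set T := Finset.range ((N - 1) / K + 1) with hT
  set B : ℕ → Finset ℕ := fun j => A.filter fun n => (n - (H + 1)) / K = j with hB
  have hcover : T.biUnion B = A := by
    refine Finset.biUnion_filter_eq_of_maps_to fun n hn => ?_
    have hn' := Finset.mem_Icc.1 hn
    exact Finset.mem_range.2 (Nat.lt_succ_of_le (Nat.div_le_div_right (by omega)))
  have hdisj : (T : Set ℕ).PairwiseDisjoint B := fun a _ b _ hab =>
    Finset.disjoint_left.2 fun n hna hnb =>
      hab ((Finset.mem_filter.1 hna).2.symm.trans (Finset.mem_filter.1 hnb).2)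
  have hTK : K * T.card ≤ 2 * N := by
    rw [hT, Finset.card_range, mul_add, mul_one]
    have := Nat.mul_div_le (N - 1) K
    omega
  have hholder := card_sumEqSolutions_biUnion_le (fun n : ℕ => (n.factorial : ZMod p))
    (Nat.le_add_left 1 k) T B hdisj
  rw [hcover, show 2 * (k + 1) - 1 = 2 * k + 1 by omega] at hholder
  have hwin := (sum_card_sumEqSolutions_windows_le (Nat.le_add_left 1 k) hN
    (fun n => (n - (H + 1)) / K) hg T).trans (card_ascFactorial_relations_le hN)
  calc _ ≤ K ^ (2 * k + 1) * (T.card ^ (2 * k + 1) * _) :=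
        Nat.mul_le_mul_left _ (hholder.trans (Nat.mul_le_mul_left _ hwin))
    _ = (K * T.card) ^ (2 * k + 1) * _ := by rw [mul_pow, ← mul_assoc]
    _ ≤ _ := Nat.mul_le_mul_right _ (Nat.pow_le_pow_left hTK _)


/-- Bound on `J_ℓ(H,N)`, the number of solutions of
`n_1! + ⋯ + n_ℓ! ≡ n_{ℓ+1}! + ⋯ + n_{2ℓ}! (mod p)` with
`H + 1 ≤ n_i ≤ H + N`: it is at most `C N^{2ℓ - 1 + 1/(ℓ+1)}`. -/
theorem count_factorial_sum_congruence (ℓ : ℕ) (hℓ : 1 ≤ ℓ) :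
    ∃ C : ℝ, 0 < C ∧ ∀ p : ℕ, p.Prime → Odd p →
      ∀ H N : ℕ, 0 < N → H + N < p →
        ((((Fintype.piFinset fun _ : Fin ℓ => Finset.Icc (H + 1) (H + N)) ×ˢ
              (Fintype.piFinset fun _ : Fin ℓ => Finset.Icc (H + 1) (H + N))).filter
            fun nm => (∑ i, ((nm.1 i).factorial : ZMod p)) =
              ∑ i, ((nm.2 i).factorial : ZMod p)).card : ℝ) ≤
          C * (N : ℝ) ^ (2 * (ℓ : ℝ) - 1 + 1 / ((ℓ : ℝ) + 1)) := by
  obtain ⟨k, rfl⟩ : ∃ k, ℓ = k + 1 := ⟨ℓ - 1, by omega⟩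
  refine ⟨2 ^ (2 * k + 1) * (2 * (2 * k + 2) ^ (2 * k + 2) + (k + 1) ^ (2 * k + 2)), by positivity,
    fun p hp _ H N hN0 hN => ?_⟩
  have : Fact p.Prime := ⟨hp⟩
  have hN1 : (1 : ℝ) ≤ N := by exact_mod_cast hN0
  have hNpos : (0 : ℝ) < N := by linarith
  set x : ℝ := (N : ℝ) ^ (1 / (((k + 1 : ℕ) : ℝ) + 1)) with hx
  have hx1 : 1 ≤ x := Real.one_le_rpow hN1 (by positivity)
  have hxpow : x ^ (k + 2) = N := by
    rw [hx, ← Real.rpow_natCast, ← Real.rpow_mul hNpos.le]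
    rw [show 1 / (((k + 1 : ℕ) : ℝ) + 1) * ((k + 2 : ℕ) : ℝ) = 1 by push_cast; field_simp; ring,
      Real.rpow_one]
  have hxN : x ≤ N := by
    rw [← hxpow]
    exact le_self_pow₀ hx1 (by omega)
  set K := ⌈x⌉₊ with hKdef
  have hxK : x ≤ K := Nat.le_ceil x
  have hKx : (K : ℝ) ≤ 2 * x := by
    have := Nat.ceil_lt_add_one (by linarith : 0 ≤ x)
    linarith
  have hK : 0 < K := Nat.ceil_pos.2 (by linarith)
  have hKN : K ≤ N := Nat.ceil_le.2 hxN
  have hKpos : (0 : ℝ) < K := by exact_mod_cast hK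
  have hmain := card_factorial_sumEqSolutions_le (k := k) hK hKN hN
  have hmainR : (K : ℝ) ^ (2 * k + 1) *
      (sumEqSolutions (fun n => (n.factorial : ZMod p)) (k + 1)
        (Finset.Icc (H + 1) (H + N))).card ≤
      (2 * N) ^ (2 * k + 1) * ((2 * k + 2) ^ (2 * k + 2) * K ^ (2 * k + 1) * K +
        (k + 1) ^ (2 * k + 2) * K ^ k * N) := by exact_mod_cast hmain
  have hKkN : (K : ℝ) ^ k * N ≤ K ^ (2 * k + 1) * x := by
    calc (K : ℝ) ^ k * N = K ^ k * (x ^ (k + 1) * x) := by rw [← hxpow]; ring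
      _ ≤ K ^ k * (K ^ (k + 1) * x) := by gcongr
      _ = _ := by ring
  have hexp : (N : ℝ) ^ (2 * ((k + 1 : ℕ) : ℝ) - 1 + 1 / (((k + 1 : ℕ) : ℝ) + 1)) =
      N ^ (2 * k + 1) * x := by
    rw [Real.rpow_add hNpos, ← Real.rpow_natCast]
    congr 2
    push_cast
    ring
  rw [hexp]
  refine le_of_mul_le_mul_left (hmainR.trans ?_) (pow_pos hKpos (2 * k + 1))
  calc (2 * (N : ℝ)) ^ (2 * k + 1) * ((2 * k + 2) ^ (2 * k + 2) * K ^ (2 * k + 1) * K +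
        (k + 1) ^ (2 * k + 2) * K ^ k * N)
      = (2 * (N : ℝ)) ^ (2 * k + 1) * ((2 * k + 2) ^ (2 * k + 2) * K ^ (2 * k + 1) * K +
        (k + 1) ^ (2 * k + 2) * (K ^ k * N)) := by ring
    _ ≤ (2 * (N : ℝ)) ^ (2 * k + 1) * ((2 * k + 2) ^ (2 * k + 2) * K ^ (2 * k + 1) * (2 * x) +
        (k + 1) ^ (2 * k + 2) * (K ^ (2 * k + 1) * x)) := by gcongr
    _ = _ := by rw [mul_pow]; ring
end

section
/- For every fixed integer ℓ ≥ 1 there exists a constant C = C(ℓ) > 0 such that for every odd prime p and all integers H, N with 0 ≤ H < H + N < p, the number I_ℓ(H,N) of 2ℓ-tuples (n_1,…,n_{2ℓ}) with H+1 ≤ n_i ≤ H+N for all i and n_1!⋯n_ℓ! ≡ n_{ℓ+1}!⋯n_{2ℓ}! (mod p) satisfies I_ℓ(H,N) ≤ C · N^{2ℓ − 1 + 2^{−ℓ}}. -/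
/-- The number of pairs in `S` on which `f` agrees is the sum of the squares of the fibre sizes. -/
theorem card_filter_eq_sum_sq_card_fiber {α γ : Type*} [DecidableEq γ] (S : Finset α)
    (f : α → γ) (T : Finset γ) (hT : ∀ x ∈ S, f x ∈ T) :
    ((S ×ˢ S).filter fun x => f x.1 = f x.2).card =
      ∑ c ∈ T, (S.filter fun x => f x = c).card ^ 2 := by
  classical
  rw [Finset.card_eq_sum_card_fiberwise (f := fun x => f x.1) (t := T)]
  · refine Finset.sum_congr rfl fun c _ => ?_
    rw [sq, ← Finset.card_product]
    congr 1
    ext ⟨x, y⟩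
    simp only [Finset.mem_filter, Finset.mem_product]
    constructor
    · rintro ⟨⟨⟨hx, hy⟩, h⟩, rfl⟩
      exact ⟨⟨hx, rfl⟩, hy, h.symm⟩
    · rintro ⟨⟨hx, rfl⟩, hy, h⟩
      exact ⟨⟨⟨hx, hy⟩, h.symm⟩, rfl⟩
  · intro x hx
    simp only [Finset.coe_filter, Finset.mem_product, Set.mem_ofPred_eq] at hx
    exact hT _ hx.1.1

/-- Restricting to pairs lying in a common block of a partition into `#B` blocks loses at most
a factor `#B` in the number of coincidences of `f`. -/
theorem card_filter_eq_le_card_mul_card_filter_block {α β γ : Type*} [DecidableEq β]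
    [DecidableEq γ] (S : Finset α) (f : α → γ) (b : α → β) (B : Finset β)
    (hB : ∀ x ∈ S, b x ∈ B) :
    ((S ×ˢ S).filter fun x => f x.1 = f x.2).card ≤
      B.card * ((S ×ˢ S).filter fun x => f x.1 = f x.2 ∧ b x.1 = b x.2).card := by
  classical
  have h := card_filter_eq_sum_sq_card_fiber S (fun x => (f x, b x)) (S.image f ×ˢ B)
    fun x hx => Finset.mem_product.2 ⟨Finset.mem_image_of_mem f hx, hB x hx⟩
  simp only [Prod.mk.injEq] at h
  rw [h, card_filter_eq_sum_sq_card_fiber S f (S.image f) fun x hx => Finset.mem_image_of_mem f hx,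
    Finset.sum_product, Finset.mul_sum]
  refine Finset.sum_le_sum fun c _ => ?_
  rw [Finset.card_eq_sum_card_fiberwise (f := b) (t := B)]
  · simp only [Finset.filter_filter, Prod.mk.injEq]
    exact sq_sum_le_card_mul_sum_sq (s := B)
      (f := fun d => (S.filter fun x => f x = c ∧ b x = d).card)
  · intro x hx
    exact hB x (Finset.mem_filter.1 hx).1

/-- For a fixed shift `h ≥ 1`, the congruence `n! a ≡ (n + h)! b (mod p)` has at most `h`
solutions `n` in a set of integers below `p`. -/
theorem card_filter_factorial_shift_le {p : ℕ} [Fact p.Prime] (A : Finset ℕ)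
    (hA : ∀ n ∈ A, n < p) {h : ℕ} (hh : 0 < h) (a b : ZMod p) (hb : b ≠ 0) :
    (A.filter fun n => (n.factorial : ZMod p) * a = ((n + h).factorial : ZMod p) * b).card ≤ h := by
  classical
  set q : Polynomial (ZMod p) := ascPochhammer (ZMod p) h - Polynomial.C (a / b) with hq
  have hdeg : q.natDegree = h := by
    rw [hq, Polynomial.natDegree_sub_C, ascPochhammer_natDegree]
  have hq0 : q ≠ 0 := by
    rintro h0
    rw [h0, Polynomial.natDegree_zero] at hdeg
    omega
  calc _ ≤ q.roots.toFinset.card := ?_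
    _ ≤ Multiset.card q.roots := Multiset.toFinset_card_le _
    _ ≤ h := hdeg ▸ q.card_roots'
  refine Finset.card_le_card_of_injOn (fun n => ((n + 1 : ℕ) : ZMod p)) ?_ ?_
  · intro n hn
    obtain ⟨hnA, hn⟩ := Finset.mem_filter.1 hn
    have hn0 : (n.factorial : ZMod p) ≠ 0 := by
      rw [Ne, ZMod.natCast_eq_zero_iff, (Fact.out : p.Prime).dvd_factorial]
      exact not_le.2 (hA n hnA)
    rw [← Nat.factorial_mul_ascFactorial, Nat.cast_mul, mul_assoc] at hn
    have hn' := mul_left_cancel₀ hn0 hn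
    simp only [Finset.mem_coe, Multiset.mem_toFinset]
    rw [Polynomial.mem_roots hq0, Polynomial.IsRoot.def, hq, Polynomial.eval_sub,
      Polynomial.eval_C, ← ascPochhammer_eval_cast, ascPochhammer_nat_eq_ascFactorial, hn',
      mul_div_cancel_right₀ _ hb, sub_self]
  · intro n hn m hm hnm
    have hn := hA n (Finset.mem_filter.1 hn).1
    have hm := hA m (Finset.mem_filter.1 hm).1
    simp only [Nat.cast_add, Nat.cast_one, add_left_inj] at hnm
    rwa [ZMod.natCast_eq_natCast_iff', Nat.mod_eq_of_lt hn, Nat.mod_eq_of_lt hm] at hnm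

/-- The congruence `x! a ≡ y! b (mod p)` has few solutions with `0 < y - x < D`. -/
theorem card_filter_factorial_lt_le {p : ℕ} [Fact p.Prime] (A : Finset ℕ)
    (hA : ∀ n ∈ A, n < p) (D : ℕ) (a b : ZMod p) (hb : b ≠ 0) :
    ((A ×ˢ A).filter fun x => (x.1.factorial : ZMod p) * a = (x.2.factorial : ZMod p) * b ∧
      x.1 < x.2 ∧ x.2 < x.1 + D).card ≤ ∑ h ∈ Finset.range D, h := by
  classical
  rw [Finset.card_eq_sum_card_fiberwise (f := fun x => x.2 - x.1) (t := Finset.range D)]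
  · refine Finset.sum_le_sum fun h _ => ?_
    rcases Nat.eq_zero_or_pos h with rfl | hh
    · rw [Nat.le_zero, Finset.card_eq_zero, Finset.filter_eq_empty_iff]
      rintro x hx
      have := (Finset.mem_filter.1 hx).2.2
      omega
    · refine le_trans ?_ (card_filter_factorial_shift_le A hA hh a b hb)
      refine Finset.card_le_card_of_injOn Prod.fst ?_ ?_
      · rintro ⟨x, y⟩ hx
        simp only [Finset.coe_filter, Finset.mem_filter, Finset.mem_product,
          Set.mem_ofPred_eq] at hx ⊢
        obtain ⟨⟨⟨hxA, -⟩, he, hlt, -⟩, rfl⟩ := hx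
        rw [Nat.add_sub_cancel' hlt.le]
        exact ⟨hxA, he⟩
      · rintro ⟨x, y⟩ hx ⟨x', y'⟩ hx' hxx
        simp only [Finset.coe_filter, Finset.mem_filter, Finset.mem_product,
          Set.mem_ofPred_eq] at hx hx' hxx
        ext <;> simp <;> omega
  · intro x hx
    have := (Finset.mem_filter.1 hx).2.2
    simp only [Finset.coe_range, Set.mem_Iio]
    omega

/-- The congruence `x! a ≡ y! b (mod p)` has few solutions with `0 < |x - y| < D`. -/
theorem card_filter_factorial_ne_le {p : ℕ} [Fact p.Prime] (A : Finset ℕ)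
    (hA : ∀ n ∈ A, n < p) (D : ℕ) (a b : ZMod p) (ha : a ≠ 0) (hb : b ≠ 0) :
    ((A ×ˢ A).filter fun x => (x.1.factorial : ZMod p) * a = (x.2.factorial : ZMod p) * b ∧
      x.1 ≠ x.2 ∧ x.2 < x.1 + D ∧ x.1 < x.2 + D).card ≤ D ^ 2 := by
  classical
  have h1 := card_filter_factorial_lt_le A hA D a b hb
  have h2 := card_filter_factorial_lt_le A hA D b a ha
  have hD : (∑ h ∈ Finset.range D, h) + ∑ h ∈ Finset.range D, h ≤ D ^ 2 := by
    rw [← mul_two, Finset.sum_range_id_mul_two, sq]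
    exact Nat.mul_le_mul_left _ (Nat.sub_le _ _)
  refine le_trans ?_ ((add_le_add h1 h2).trans hD)
  rw [← Finset.card_image_of_injective ((A ×ˢ A).filter fun x =>
    (x.1.factorial : ZMod p) * b = (x.2.factorial : ZMod p) * a ∧
      x.1 < x.2 ∧ x.2 < x.1 + D) Prod.swap_injective]
  refine (Finset.card_le_card ?_).trans (Finset.card_union_le _ _)
  rintro ⟨x, y⟩ hx
  simp only [Finset.mem_filter, Finset.mem_product] at hx
  obtain ⟨⟨hxA, hyA⟩, he, hne, hl, hr⟩ := hx
  rw [Finset.mem_union]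
  rcases lt_or_gt_of_ne hne with hlt | hlt
  · exact Or.inl (Finset.mem_filter.2 ⟨Finset.mem_product.2 ⟨hxA, hyA⟩, he, hlt, hl⟩)
  · exact Or.inr (Finset.mem_image.2 ⟨(y, x), Finset.mem_filter.2
      ⟨Finset.mem_product.2 ⟨hyA, hxA⟩, he.symm, hlt, hr⟩, rfl⟩)

/-- The solutions of `∏ n_i! ≡ ∏ m_i! (mod p)` with all of the `k + k` variables in `A`. -/
def factorialSolutions (p : ℕ) (A : Finset ℕ) (k : ℕ) : Finset ((Fin k → ℕ) × (Fin k → ℕ)) :=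
  ((Fintype.piFinset fun _ : Fin k => A) ×ˢ (Fintype.piFinset fun _ : Fin k => A)).filter
    fun nm => (∏ i, ((nm.1 i).factorial : ZMod p)) = ∏ i, ((nm.2 i).factorial : ZMod p)

/-- Solutions in `k + 1` variables per side whose first coordinates are equal. -/
theorem card_factorialSolutions_filter_eq_le {p : ℕ} [Fact p.Prime] (A : Finset ℕ)
    (hA : ∀ n ∈ A, n < p) (k : ℕ) :
    ((factorialSolutions p A (k + 1)).filter fun x => x.1 0 = x.2 0).card ≤
      A.card * (factorialSolutions p A k).card := by
  classical
  rw [← Finset.card_product]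
  refine Finset.card_le_card_of_injOn
    (fun x => (x.1 0, (Fin.tail x.1, Fin.tail x.2))) ?_ ?_
  · rintro ⟨n, m⟩ hx
    simp only [factorialSolutions, Finset.coe_filter, Finset.mem_filter, Finset.mem_product,
      Set.mem_ofPred_eq, Fintype.mem_piFinset, Finset.coe_product, Set.mem_prod,
      Finset.mem_coe, Fin.prod_univ_succ] at hx ⊢
    obtain ⟨⟨⟨hn, hm⟩, he⟩, h0⟩ := hx
    refine ⟨hn 0, ⟨fun i => hn i.succ, fun i => hm i.succ⟩, ?_⟩
    rw [← h0] at he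
    refine mul_left_cancel₀ ?_ he
    rw [Ne, ZMod.natCast_eq_zero_iff, (Fact.out : p.Prime).dvd_factorial]
    exact not_le.2 (hA _ (hn 0))
  · rintro ⟨n, m⟩ hx ⟨n', m'⟩ hx' h
    have h0 : n 0 = m 0 := (Finset.mem_filter.1 hx).2
    have h0' : n' 0 = m' 0 := (Finset.mem_filter.1 hx').2
    simp only [Prod.mk.injEq] at h ⊢
    obtain ⟨h1, h2, h3⟩ := h
    constructor
    · rw [← Fin.cons_self_tail n, ← Fin.cons_self_tail n', h1, h2]
    · rw [← Fin.cons_self_tail m, ← Fin.cons_self_tail m', ← h0, ← h0', h1, h3]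

/-- Solutions in `k + 1` variables per side whose first coordinates are distinct but close. -/
theorem card_factorialSolutions_filter_ne_le {p : ℕ} [Fact p.Prime] (A : Finset ℕ)
    (hA : ∀ n ∈ A, n < p) (k D : ℕ) :
    ((factorialSolutions p A (k + 1)).filter fun x =>
      x.1 0 ≠ x.2 0 ∧ x.2 0 < x.1 0 + D ∧ x.1 0 < x.2 0 + D).card ≤
      D ^ 2 * A.card ^ (2 * k) := by
  classical
  have hfac : ∀ n : Fin k → ℕ, n ∈ (Fintype.piFinset fun _ : Fin k => A) →
      ∏ i, ((n i).factorial : ZMod p) ≠ 0 := by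
    intro n hn
    refine Finset.prod_ne_zero_iff.2 fun i _ => ?_
    rw [Ne, ZMod.natCast_eq_zero_iff, (Fact.out : p.Prime).dvd_factorial]
    exact not_le.2 (hA _ (Fintype.mem_piFinset.1 hn i))
  have hcard : A.card ^ (2 * k) = ((Fintype.piFinset fun _ : Fin k => A) ×ˢ
      (Fintype.piFinset fun _ : Fin k => A)).card := by
    simp [Finset.card_product, two_mul, pow_add]
  rw [hcard]
  refine Finset.card_le_mul_card_image_of_maps_to
    (f := fun x : (Fin (k + 1) → ℕ) × (Fin (k + 1) → ℕ) =>
      (Fin.tail x.1, Fin.tail x.2)) ?_ _ ?_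
  · rintro ⟨n, m⟩ hx
    simp only [factorialSolutions, Finset.mem_filter, Finset.mem_product,
      Fintype.mem_piFinset] at hx ⊢
    exact ⟨fun i => hx.1.1.1 i.succ, fun i => hx.1.1.2 i.succ⟩
  · rintro ⟨u, v⟩ huv
    obtain ⟨hu, hv⟩ := Finset.mem_product.1 huv
    refine le_trans ?_ (card_filter_factorial_ne_le A hA D _ _ (hfac u hu) (hfac v hv))
    refine Finset.card_le_card_of_injOn (fun x => (x.1 0, x.2 0)) ?_ ?_
    · rintro ⟨n, m⟩ hx
      simp only [factorialSolutions, Finset.coe_filter, Finset.mem_filter, Finset.mem_product,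
        Set.mem_ofPred_eq, Fintype.mem_piFinset, Fin.prod_univ_succ, Prod.mk.injEq] at hx ⊢
      obtain ⟨⟨⟨⟨hn, hm⟩, he⟩, h0⟩, rfl, rfl⟩ := hx
      exact ⟨⟨hn 0, hm 0⟩, he, h0⟩
    · rintro ⟨n, m⟩ hx ⟨n', m'⟩ hx' h
      have hx := (Finset.mem_filter.1 hx).2
      have hx' := (Finset.mem_filter.1 hx').2
      simp only [Prod.mk.injEq] at h hx hx' ⊢
      constructor
      · rw [← Fin.cons_self_tail n, ← Fin.cons_self_tail n', h.1, hx.1, hx'.1]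
      · rw [← Fin.cons_self_tail m, ← Fin.cons_self_tail m', h.2, hx.2, hx'.2]

/-- The recursive bound for the number of solutions, from splitting the range of the first
variable into blocks of length `D`. -/
theorem card_factorialSolutions_succ_le {p : ℕ} [Fact p.Prime] {H N : ℕ} (hp : H + N < p)
    (k : ℕ) {D : ℕ} (hD : 0 < D) :
    (factorialSolutions p (Finset.Icc (H + 1) (H + N)) (k + 1)).card ≤
      (N / D + 1) * (N * (factorialSolutions p (Finset.Icc (H + 1) (H + N)) k).card +
        D ^ 2 * N ^ (2 * k)) := by
  classical
  set A := Finset.Icc (H + 1) (H + N) with hAdef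
  have hA : ∀ n ∈ A, n < p := fun n hn => by
    have := Finset.mem_Icc.1 hn
    omega
  have hcard : A.card = N := by simp [hAdef]
  have h1 := card_factorialSolutions_filter_eq_le A hA k
  have h2 := card_factorialSolutions_filter_ne_le A hA k D
  rw [hcard] at h1 h2
  have hblock := card_filter_eq_le_card_mul_card_filter_block
    (Fintype.piFinset fun _ : Fin (k + 1) => A)
    (fun n => ∏ i, ((n i).factorial : ZMod p)) (fun n => (n 0 - (H + 1)) / D)
    (Finset.range (N / D + 1)) (by
      intro n hn
      have := Finset.mem_Icc.1 (Fintype.mem_piFinset.1 hn 0)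
      rw [Finset.mem_range, Nat.lt_succ_iff]
      exact Nat.div_le_div_right (by omega))
  rw [Finset.card_range] at hblock
  refine hblock.trans (Nat.mul_le_mul_left _ (le_trans ?_ (add_le_add h1 h2)))
  refine (Finset.card_le_card ?_).trans (Finset.card_union_le _ _)
  rintro ⟨n, m⟩ hx
  obtain ⟨hnm, he, hb⟩ := Finset.mem_filter.1 hx
  have hmem : (n, m) ∈ factorialSolutions p A (k + 1) := Finset.mem_filter.2 ⟨hnm, he⟩
  obtain ⟨hn, hm⟩ := Finset.mem_product.1 hnm
  have hn0 := Finset.mem_Icc.1 (Fintype.mem_piFinset.1 hn 0)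
  have hm0 := Finset.mem_Icc.1 (Fintype.mem_piFinset.1 hm 0)
  rw [Finset.mem_union, Finset.mem_filter, Finset.mem_filter]
  by_cases h0 : n 0 = m 0
  · exact Or.inl ⟨hmem, h0⟩
  · refine Or.inr ⟨hmem, h0, ?_⟩
    dsimp only at hb hn0 hm0 ⊢
    have e1 := Nat.div_add_mod (n 0 - (H + 1)) D
    have e2 := Nat.div_add_mod (m 0 - (H + 1)) D
    have l1 := Nat.mod_lt (n 0 - (H + 1)) hD
    have l2 := Nat.mod_lt (m 0 - (H + 1)) hD
    rw [hb] at e1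
    omega

/-- The number of solutions with all variables in an interval of length `N` below `p` is
`O_k(N ^ (2k - 1 + 2 ^ (-k)))`. -/
theorem exists_card_factorialSolutions_le (k : ℕ) :
    ∃ C : ℝ, 0 < C ∧ ∀ p : ℕ, p.Prime → ∀ H N : ℕ, 0 < N → H + N < p →
      ((factorialSolutions p (Finset.Icc (H + 1) (H + N)) k).card : ℝ) ≤
        C * (N : ℝ) ^ (2 * (k : ℝ) - 1 + 2 ^ (-(k : ℝ))) := by
  induction k with
  | zero =>
    refine ⟨1, one_pos, fun p _ H N _ _ => ?_⟩
    have h : (factorialSolutions p (Finset.Icc (H + 1) (H + N)) 0).card ≤ 1 :=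
      (Finset.card_filter_le _ _).trans (by simp)
    simpa using h
  | succ k ih =>
    obtain ⟨C, hC, ih⟩ := ih
    refine ⟨2 * (C + 4), by positivity, fun p hp H N hN hHN => ?_⟩
    have : Fact p.Prime := ⟨hp⟩
    have hN0 : (0 : ℝ) < N := by exact_mod_cast hN
    have hN1 : (1 : ℝ) ≤ N := by exact_mod_cast hN
    set t : ℝ := 2 ^ (-((k + 1 : ℕ) : ℝ)) with ht
    have ht0 : 0 ≤ t := by positivity
    have ht1 : t ≤ 1 := Real.rpow_le_one_of_one_le_of_nonpos one_le_two
      (neg_nonpos.2 (Nat.cast_nonneg _))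
    have h2t : (2 : ℝ) ^ (-(k : ℝ)) = t + t := by
      rw [ht, ← mul_two, ← Real.rpow_add_one two_ne_zero]
      congr 1
      push_cast
      ring
    set X : ℝ := (N : ℝ) ^ t with hX
    have hX1 : 1 ≤ X := Real.one_le_rpow hN1 ht0
    have hX0 : 0 < X := one_pos.trans_le hX1
    have hXN : X ≤ N := (Real.rpow_le_rpow_of_exponent_le hN1 ht1).trans_eq (Real.rpow_one _)
    have hprev : (N : ℝ) * (N : ℝ) ^ (2 * (k : ℝ) - 1 + 2 ^ (-(k : ℝ))) =
        X ^ 2 * (N : ℝ) ^ (2 * k) := by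
      rw [h2t, ← Real.rpow_natCast (N : ℝ), sq, hX, ← Real.rpow_add hN0, ← Real.rpow_add hN0,
        mul_comm (N : ℝ), ← Real.rpow_add_one hN0.ne']
      congr 1
      push_cast
      ring
    have hnext : (N : ℝ) ^ (2 * ((k + 1 : ℕ) : ℝ) - 1 + t) = N * X * (N : ℝ) ^ (2 * k) := by
      rw [← Real.rpow_natCast (N : ℝ), mul_assoc, hX, ← Real.rpow_add hN0,
        mul_comm (N : ℝ), ← Real.rpow_add_one hN0.ne']
      congr 1
      push_cast
      ring
    set D : ℕ := ⌈X⌉₊ with hD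
    have hD0 : 0 < D := Nat.ceil_pos.2 hX0
    have hXD : X ≤ D := Nat.le_ceil X
    have hDX : (D : ℝ) ≤ 2 * X := by
      have := Nat.ceil_lt_add_one hX0.le
      linarith
    have hM : ((N / D : ℕ) : ℝ) + 1 ≤ 2 * (N / X) := by
      have h1 : ((N / D : ℕ) : ℝ) ≤ N / X :=
        Nat.cast_div_le.trans (div_le_div_of_nonneg_left hN0.le hX0 hXD)
      have h2 : 1 ≤ N / X := (one_le_div hX0).2 hXN
      linarith
    have hrec : ((factorialSolutions p (Finset.Icc (H + 1) (H + N)) (k + 1)).card : ℝ) ≤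
        ((N / D : ℕ) + 1) * (N * (factorialSolutions p (Finset.Icc (H + 1) (H + N)) k).card +
          (D : ℝ) ^ 2 * (N : ℝ) ^ (2 * k)) := by
      exact_mod_cast card_factorialSolutions_succ_le hHN k hD0
    rw [hnext]
    calc _ ≤ _ := hrec
      _ ≤ 2 * (N / X) * (N * (C * (N : ℝ) ^ (2 * (k : ℝ) - 1 + 2 ^ (-(k : ℝ)))) +
          (2 * X) ^ 2 * (N : ℝ) ^ (2 * k)) := by
        gcongr
        exact ih p hp H N hN hHN
      _ = 2 * (N / X) * (C * (X ^ 2 * (N : ℝ) ^ (2 * k)) +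
          (2 * X) ^ 2 * (N : ℝ) ^ (2 * k)) := by
        rw [← hprev]
        ring
      _ = 2 * (C + 4) * (N * X * (N : ℝ) ^ (2 * k)) := by
        field_simp
        ring


/-- Theorem 5: bound on `I_ℓ(H,N)`, the number of solutions of
`n_1! ⋯ n_ℓ! ≡ n_{ℓ+1}! ⋯ n_{2ℓ}! (mod p)` with `H + 1 ≤ n_i ≤ H + N`:
it is at most `C N^{2ℓ - 1 + 2^{-ℓ}}`. -/
theorem count_factorial_product_congruence (ℓ : ℕ) (hℓ : 1 ≤ ℓ) :
    ∃ C : ℝ, 0 < C ∧ ∀ p : ℕ, p.Prime → Odd p →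
      ∀ H N : ℕ, 0 < N → H + N < p →
        ((((Fintype.piFinset fun _ : Fin ℓ => Finset.Icc (H + 1) (H + N)) ×ˢ
              (Fintype.piFinset fun _ : Fin ℓ => Finset.Icc (H + 1) (H + N))).filter
            fun nm => (∏ i, ((nm.1 i).factorial : ZMod p)) =
              ∏ i, ((nm.2 i).factorial : ZMod p)).card : ℝ) ≤
          C * (N : ℝ) ^ (2 * (ℓ : ℝ) - 1 + 2 ^ (-(ℓ : ℝ))) := by
  obtain ⟨C, hC, h⟩ := exists_card_factorialSolutions_le ℓ
  exact ⟨C, hC, fun p hp _ H N hN hHN => h p hp H N hN hHN⟩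
end
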